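/- In dimension 20, every finite set S of points on the unit sphere of EuclideanSpace ℝ (Fin 20) (i.e., ‖x‖ = 1 for all x ∈ S) such that any two distinct points of S are at Euclidean distance at least 1 has cardinality at most 36764; that is, the kissing number in dimension 20 is at most 36764. -/

import Mathlib

namespace Kiss
open MvPolynomial

/-- Fischer pairing. -/
noncomputable def fac {n : ℕ} (α : Fin n →₀ ℕ) : ℝ := ∏ i, ((α i).factorial : ℝ)

noncomputable def fis {n : ℕ} (q : MvPolynomial (Fin n) ℝ) : MvPolynomial (Fin n) ℝ →ₗ[ℝ] ℝ :=
  (basisMonomials (Fin n) ℝ).constr ℝ (fun α => fac α * coeff α q)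

lemma fis_monomial {n : ℕ} (q : MvPolynomial (Fin n) ℝ) (α : Fin n →₀ ℕ) (c : ℝ) :
    fis q (monomial α c) = c * (fac α * coeff α q) := by
  have h : monomial α c = c • (basisMonomials (Fin n) ℝ α) := by
    rw [coe_basisMonomials, smul_monomial, smul_eq_mul, mul_one]
  rw [h, map_smul, fis, Module.Basis.constr_basis, smul_eq_mul]

lemma fac_nonneg {n : ℕ} (α : Fin n →₀ ℕ) : 0 ≤ fac α :=
  Finset.prod_nonneg (fun _ _ => Nat.cast_nonneg _)

lemma fis_self_nonneg {n : ℕ} (p : MvPolynomial (Fin n) ℝ) : 0 ≤ fis p p := by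
  have : fis p p = ∑ α ∈ p.support, coeff α p * (fac α * coeff α p) := by
    conv_lhs => rw [p.as_sum]
    rw [map_sum]
    have e : (∑ v ∈ p.support, monomial v (coeff v p)) = p := p.as_sum.symm
    refine Finset.sum_congr rfl (fun α _ => ?_)
    rw [e, fis_monomial]
  rw [this]
  refine Finset.sum_nonneg (fun α _ => ?_)
  nlinarith [mul_nonneg (fac_nonneg α) (mul_self_nonneg (coeff α p))]

lemma fac_add {n : ℕ} (α : Fin n →₀ ℕ) (i : Fin n) :
    fac (α + Finsupp.single i 1) = (α i + 1) * fac α := by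
  unfold fac
  rw [← Finset.mul_prod_erase _ _ (Finset.mem_univ i),
    ← Finset.mul_prod_erase Finset.univ (fun j => ((α j).factorial : ℝ)) (Finset.mem_univ i)]
  have : ∏ x ∈ Finset.univ.erase i, (((α + Finsupp.single i 1 : Fin n →₀ ℕ) x).factorial : ℝ)
      = ∏ x ∈ Finset.univ.erase i, ((α x).factorial : ℝ) := by
    refine Finset.prod_congr rfl (fun x hx => ?_)
    have : x ≠ i := (Finset.mem_erase.1 hx).1
    simp [Finsupp.single_apply, this.symm]
  rw [this]
  simp [Nat.factorial_succ]
  ring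

lemma fis_X_mul {n : ℕ} (i : Fin n) (p q : MvPolynomial (Fin n) ℝ) :
    fis q (X i * p) = fis (pderiv i q) p := by
  induction p using MvPolynomial.induction_on' with
  | monomial α c =>
    rw [X, monomial_mul, fis_monomial, fis_monomial, add_comm (Finsupp.single i 1) α, fac_add]
    have : coeff α (pderiv i q) = coeff (α + Finsupp.single i 1) q * (α i + 1) := by
      induction q using MvPolynomial.induction_on' with
      | monomial β d =>
        rw [pderiv_monomial, coeff_monomial, coeff_monomial]
        by_cases h : β = α + Finsupp.single i 1
        · subst h; simp
        · rw [if_neg h]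
          by_cases h2 : β i = 0
          · simp [h2]
          · rw [if_neg]
            · simp
            · rintro rfl
              apply h
              ext j
              by_cases hj : j = i
              · subst hj; simp; omega
              · simp [Finsupp.single_apply, Ne.symm hj]
      | add a b ha hb => simp only [map_add, coeff_add, ha, hb]; ring
    rw [this]; ring
  | add a b ha hb => rw [mul_add, map_add, ha, hb, map_add]

lemma fis_add {n : ℕ} (a b p : MvPolynomial (Fin n) ℝ) : fis (a + b) p = fis a p + fis b p := by
  induction p using MvPolynomial.induction_on' with
  | monomial α c => simp only [fis_monomial, coeff_add]; ring
  | add x y hx hy => rw [map_add, hx, hy, map_add, map_add]; ring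

lemma fis_C_mul {n : ℕ} (c : ℝ) (b p : MvPolynomial (Fin n) ℝ) :
    fis (C c * b) p = c * fis b p := by
  induction p using MvPolynomial.induction_on' with
  | monomial α c => simp only [fis_monomial, coeff_C_mul]; ring
  | add x y hx hy => rw [map_add, hx, hy, map_add]; ring

lemma fis_zero {n : ℕ} (p : MvPolynomial (Fin n) ℝ) : fis 0 p = 0 := by
  have := fis_C_mul 0 0 p
  simpa using this

lemma fis_sum {n : ℕ} {ι : Type*} (s : Finset ι) (f : ι → MvPolynomial (Fin n) ℝ)
    (p : MvPolynomial (Fin n) ℝ) : fis (∑ i ∈ s, f i) p = ∑ i ∈ s, fis (f i) p := by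
  classical
  induction s using Finset.induction_on with
  | empty => simp [fis_zero]
  | insert a s ha ih => rw [Finset.sum_insert ha, Finset.sum_insert ha, fis_add, ih]

lemma fis_C_mul_left {n : ℕ} (c : ℝ) (b p : MvPolynomial (Fin n) ℝ) :
    fis b (C c * p) = c * fis b p := by
  rw [← smul_eq_C_mul, map_smul, smul_eq_mul]

section
variable {n : ℕ} (x : Fin n → ℝ)

noncomputable def lin : MvPolynomial (Fin n) ℝ := ∑ i, C (x i) * X i
noncomputable def rad (n : ℕ) : MvPolynomial (Fin n) ℝ := ∑ i, X i * X i
noncomputable def nsq : ℝ := ∑ i, x i * x i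
noncomputable def dirD (p : MvPolynomial (Fin n) ℝ) : MvPolynomial (Fin n) ℝ :=
  ∑ i, C (x i) * pderiv i p
noncomputable def eul (p : MvPolynomial (Fin n) ℝ) : MvPolynomial (Fin n) ℝ :=
  ∑ i, X i * pderiv i p
noncomputable def lap (p : MvPolynomial (Fin n) ℝ) : MvPolynomial (Fin n) ℝ :=
  ∑ i, pderiv i (pderiv i p)

lemma pderiv_lin (i : Fin n) : pderiv i (lin x) = C (x i) := by
  simp [lin, pderiv_X, Pi.single_apply, Derivation.leibniz]

lemma pderiv_rad (i : Fin n) : pderiv i (rad n) = 2 * X i := by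
  simp [rad, pderiv_X, Pi.single_apply, Derivation.leibniz, Finset.sum_add_distrib]
  ring

lemma dirD_lin_mul (g : MvPolynomial (Fin n) ℝ) :
    dirD x (lin x * g) = C (nsq x) * g + lin x * dirD x g := by
  simp only [dirD, Derivation.leibniz, pderiv_lin, smul_eq_mul, nsq, map_sum, Finset.mul_sum,
    Finset.sum_mul, ← Finset.sum_add_distrib, C_mul]
  exact Finset.sum_congr rfl (fun i _ => by ring)

lemma dirD_rad_mul (g : MvPolynomial (Fin n) ℝ) :
    dirD x (rad n * g) = 2 * lin x * g + rad n * dirD x g := by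
  simp only [dirD, Derivation.leibniz, pderiv_rad, smul_eq_mul]
  rw [lin, Finset.mul_sum, Finset.mul_sum, Finset.sum_mul, ← Finset.sum_add_distrib]
  exact Finset.sum_congr rfl (fun i _ => by ring)

lemma lap_lin_mul (g : MvPolynomial (Fin n) ℝ) :
    lap (lin x * g) = lin x * lap g + 2 * dirD x g := by
  simp only [lap, dirD, Derivation.leibniz, pderiv_lin, smul_eq_mul, map_add, pderiv_C]
  rw [Finset.mul_sum, Finset.mul_sum, ← Finset.sum_add_distrib]
  exact Finset.sum_congr rfl (fun i _ => by ring)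

lemma lap_rad_mul (g : MvPolynomial (Fin n) ℝ) :
    lap (rad n * g) = rad n * lap g + 2 * n * g + 4 * eul g := by
  have h2 (i : Fin n) : pderiv i (2 : MvPolynomial (Fin n) ℝ) = 0 := by
    rw [show (2 : MvPolynomial (Fin n) ℝ) = C 2 from rfl]
    exact pderiv_C
  have : ∀ i : Fin n, pderiv i (pderiv i (rad n * g)) =
      rad n * pderiv i (pderiv i g) + 2 * g + 4 * (X i * pderiv i g) := by
    intro i
    simp only [Derivation.leibniz, pderiv_rad, smul_eq_mul, map_add, pderiv_X_self, h2]
    ring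
  simp only [lap, this, Finset.sum_add_distrib, eul, Finset.mul_sum]
  simp
  ring

lemma dirD_C_mul (c : ℝ) (g : MvPolynomial (Fin n) ℝ) : dirD x (C c * g) = C c * dirD x g := by
  simp only [dirD, pderiv_C_mul, Finset.mul_sum]
  exact Finset.sum_congr rfl (fun i _ => by ring)

lemma dirD_sub (f g : MvPolynomial (Fin n) ℝ) : dirD x (f - g) = dirD x f - dirD x g := by
  simp only [dirD, map_sub, mul_sub, Finset.sum_sub_distrib]

lemma lap_C_mul (c : ℝ) (g : MvPolynomial (Fin n) ℝ) : lap (C c * g) = C c * lap g := by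
  simp only [lap, pderiv_C_mul, Finset.mul_sum, smul_eq_C_mul]

lemma lap_sub (f g : MvPolynomial (Fin n) ℝ) : lap (f - g) = lap f - lap g := by
  simp only [lap, map_sub, Finset.sum_sub_distrib]

lemma lin_homog : (lin x).IsHomogeneous 1 := by
  refine IsHomogeneous.sum _ _ _ (fun i _ => ?_)
  simpa using (isHomogeneous_C (Fin n) (x i)).mul (isHomogeneous_X ℝ i)

lemma rad_homog : (rad n).IsHomogeneous 2 := by
  refine IsHomogeneous.sum _ _ _ (fun i _ => ?_)
  simpa using (isHomogeneous_X ℝ i).mul (isHomogeneous_X ℝ i)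

/-- Zonal harmonic polynomial; `n = m + 2` is the intended dimension. -/
noncomputable def zon (m : ℕ) {n : ℕ} (x : Fin n → ℝ) : ℕ → MvPolynomial (Fin n) ℝ
  | 0 => 1
  | 1 => lin x
  | k + 2 => C ((2 * k + m + 2 : ℝ) / (k + m + 1)) * (lin x * zon m x (k + 1))
      - C ((k + 1 : ℝ) / (k + m + 1) * nsq x) * (rad n * zon m x k)

lemma zon_homog (m : ℕ) : ∀ k, (zon m x k).IsHomogeneous k
  | 0 => isHomogeneous_one _ _
  | 1 => lin_homog x
  | k + 2 => by
    rw [zon]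
    refine IsHomogeneous.sub ?_ ?_
    · have := (isHomogeneous_C (Fin n) ((2 * k + m + 2 : ℝ) / (k + m + 1))).mul
        ((lin_homog x).mul (zon_homog m (k + 1)))
      rwa [show 0 + (1 + (k + 1)) = k + 2 by omega] at this
    · have := (isHomogeneous_C (Fin n) ((k + 1 : ℝ) / (k + m + 1) * nsq x)).mul
        ((rad_homog (n := n)).mul (zon_homog m k))
      rwa [show 0 + (2 + k) = k + 2 by omega] at this

lemma eul_homog {k : ℕ} {g : MvPolynomial (Fin n) ℝ} (hg : g.IsHomogeneous k) :
    eul g = k * g := by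
  rw [eul, hg.sum_X_mul_pderiv]; simp

lemma dirD_zon (m : ℕ) : ∀ k, dirD x (zon m x (k + 1)) = C ((k + 1 : ℝ) * nsq x) * zon m x k
  | 0 => by
    have := dirD_lin_mul x 1
    simp [dirD, zon] at this ⊢
    rw [this]
  | 1 => by
    have h0 := dirD_zon m 0
    simp only [zon, dirD_sub, dirD_C_mul, dirD_lin_mul, dirD_rad_mul] at h0 ⊢
    have h1 : dirD x (1 : MvPolynomial (Fin n) ℝ) = 0 := by simp [dirD]
    rw [h0, h1]
    have hm : (m + 1 : ℝ) ≠ 0 := by positivity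
    have e1 : (C (((2 : ℝ) * (0:ℕ) + m + 2) / ((0:ℕ) + m + 1)) : MvPolynomial (Fin n) ℝ)
      = 1 + C (1 / (m + 1 : ℝ)) := by
      rw [← C_1, ← C_add]; congr 1; push_cast; field_simp; ring
    have e2 : (C (((0 : ℕ) + 1 : ℝ) / ((0 : ℕ) + m + 1) * nsq x) : MvPolynomial (Fin n) ℝ)
      = C (1 / (m + 1 : ℝ)) * C (nsq x) := by
      rw [← C_mul]; congr 1; push_cast; ring
    have e3 : (C (((1 : ℕ) + 1 : ℝ) * nsq x) : MvPolynomial (Fin n) ℝ) = 2 * C (nsq x) := by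
      rw [C_mul]; norm_num; left; rfl
    rw [e1, e2, e3]
    simp
    ring
  | k + 2 => by
    have h0 := dirD_zon m k
    have h1 := dirD_zon m (k + 1)
    have hz : zon m x (k + 2) = C ((2 * k + m + 2 : ℝ) / (k + m + 1)) * (lin x * zon m x (k + 1))
      - C ((k + 1 : ℝ) / (k + m + 1) * nsq x) * (rad n * zon m x k) := by rw [zon]
    rw [show k + 2 + 1 = (k + 1) + 2 from rfl, zon, dirD_sub, dirD_C_mul, dirD_C_mul,
      dirD_lin_mul, dirD_rad_mul, h0, h1]
    have p1 : (k + m + 1 : ℝ) ≠ 0 := by positivity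
    have p2 : (k + m + 2 : ℝ) ≠ 0 := by positivity
    have key : ∀ (a b c d e : ℝ) (L Rr Z2 Z1 Z0 : MvPolynomial (Fin n) ℝ),
        Z2 = C a * (L * Z1) - C (b * nsq x) * (Rr * Z0) →
        ∀ (a' b' : ℝ), a' + b' * (k+1) / b = k + 3 → b ≠ 0 →
         a' * (k+2) - b' * 2 - b' * (k+1) / b * a = 0 →
        C a' * (C (nsq x) * Z2 + L * (C ((k + 2) * nsq x) * Z1)) -
          C (b' * nsq x) * (2 * L * Z1 + Rr * (C ((k + 1) * nsq x) * Z0))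
          = C ((k + 3) * nsq x) * Z2 := by
      intro a b c d e L Rr Z2 Z1 Z0 hZ a' b' h1 hb h2
      have e1 : (C a' : MvPolynomial (Fin n) ℝ) + C (b' * (k+1) / b) = C (k + 3 : ℝ) := by
        rw [← C_add, h1]
      have e2 : (C a' : MvPolynomial (Fin n) ℝ) * C (k+2 : ℝ) - C b' * 2
          - C (b' * (k+1) / b) * C a = 0 := by
        rw [← C_mul, ← C_mul, show (2 : MvPolynomial (Fin n) ℝ) = C 2 from rfl, ← C_mul, ← C_sub,
          ← C_sub, h2, C_0]
      have e3 : (C b' : MvPolynomial (Fin n) ℝ) * C (k+1 : ℝ) = C (b' * (k+1) / b) * C b := by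
        rw [← C_mul, ← C_mul]; congr 1; field_simp
      have c2 : (C ((k + 2) * nsq x) : MvPolynomial (Fin n) ℝ) = C (k + 2 : ℝ) * C (nsq x) := C_mul
      have c1 : (C ((k + 1) * nsq x) : MvPolynomial (Fin n) ℝ) = C (k + 1 : ℝ) * C (nsq x) := C_mul
      have c3 : (C ((k + 3) * nsq x) : MvPolynomial (Fin n) ℝ) = C (k + 3 : ℝ) * C (nsq x) := C_mul
      have c4 : (C (b' * nsq x) : MvPolynomial (Fin n) ℝ) = C b' * C (nsq x) := C_mul
      have c5 : (C (b * nsq x) : MvPolynomial (Fin n) ℝ) = C b * C (nsq x) := C_mul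
      rw [c1, c2, c3, c4]
      rw [c5] at hZ
      generalize (C (b' * (k+1) / b) : MvPolynomial (Fin n) ℝ) = t at *
      generalize (C (k+1 : ℝ) : MvPolynomial (Fin n) ℝ) = k1 at *
      generalize (C (k+2 : ℝ) : MvPolynomial (Fin n) ℝ) = k2 at *
      generalize (C (k+3 : ℝ) : MvPolynomial (Fin n) ℝ) = k3 at *
      linear_combination (C (nsq x) * Z2) * e1 + (C (nsq x) * L * Z1) * e2
        - (C (nsq x) * C (nsq x) * Rr * Z0) * e3 - t * C (nsq x) * hZ
    have := key _ _ 0 0 0 _ _ _ _ _ hz ((2 * ((k+1 : ℕ):ℝ) + m + 2) / (((k+1:ℕ):ℝ) + m + 1))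
      ((((k + 1 : ℕ) : ℝ) + 1) / (((k + 1 : ℕ):ℝ) + m + 1)) ?_ ?_ ?_
    · convert this using 2 <;> push_cast <;> ring_nf
    · push_cast; field_simp; ring
    · positivity
    · push_cast; field_simp; ring

lemma lap_zon (m : ℕ) (hn : n = m + 2) : ∀ k, lap (zon m x k) = 0
  | 0 => by simp [lap, zon]
  | 1 => by simp [lap, zon, pderiv_lin]
  | k + 2 => by
    have h0 := lap_zon m hn k
    have h1 := lap_zon m hn (k + 1)
    have hd := dirD_zon x m k
    rw [zon, lap_sub, lap_C_mul, lap_C_mul, lap_lin_mul, lap_rad_mul, h0, h1, hd,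
      eul_homog (zon_homog x m k)]
    have p1 : (k + m + 1 : ℝ) ≠ 0 := by positivity
    have e : (C ((2 * k + m + 2 : ℝ) / (k + m + 1)) : MvPolynomial (Fin n) ℝ) *
      (2 * C ((k + 1 : ℝ) * nsq x)) = C ((k + 1 : ℝ) / (k + m + 1) * nsq x) *
        ((2 * n + 4 * k : MvPolynomial (Fin n) ℝ)) := by
      have : (2 * n + 4 * k : MvPolynomial (Fin n) ℝ) = C (2 * n + 4 * k : ℝ) := by
        simp [C_add, C_mul]; rfl
      rw [this, show (2 : MvPolynomial (Fin n) ℝ) = C 2 from rfl, ← C_mul, ← C_mul, ← C_mul]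
      congr 1
      subst hn
      push_cast
      field_simp
      ring
    generalize (C ((2 * k + m + 2 : ℝ) / (k + m + 1)) : MvPolynomial (Fin n) ℝ) = A at *
    generalize (C ((k + 1 : ℝ) * nsq x) : MvPolynomial (Fin n) ℝ) = A1 at *
    generalize (C ((k + 1 : ℝ) / (k + m + 1) * nsq x) : MvPolynomial (Fin n) ℝ) = A2 at *
    linear_combination (zon m x k) * e

lemma zon_decomp (m n : ℕ) : ∀ k, ∃ c : ℝ, 0 < c ∧ ∀ x : Fin n → ℝ,
    ∃ h, zon m x k = C c * lin x ^ k + rad n * h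
  | 0 => ⟨1, one_pos, fun x => ⟨0, by simp [zon]⟩⟩
  | 1 => ⟨1, one_pos, fun x => ⟨0, by simp [zon]⟩⟩
  | k + 2 => by
    obtain ⟨c, hc, h⟩ := zon_decomp m n (k + 1)
    refine ⟨(2 * k + m + 2 : ℝ) / (k + m + 1) * c, by positivity, fun x => ?_⟩
    obtain ⟨h, e⟩ := h x
    refine ⟨C ((2 * k + m + 2 : ℝ) / (k + m + 1)) * lin x * h
        - C ((k + 1 : ℝ) / (k + m + 1) * nsq x) * zon m x k, ?_⟩
    have e2 : (C ((2 * k + m + 2 : ℝ) / (k + m + 1) * c) : MvPolynomial (Fin n) ℝ)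
      = C ((2 * k + m + 2 : ℝ) / (k + m + 1)) * C c := C_mul
    rw [zon, e, e2]
    generalize (C ((2 * k + m + 2 : ℝ) / (k + m + 1)) : MvPolynomial (Fin n) ℝ) = A at *
    generalize (C ((k + 1 : ℝ) / (k + m + 1) * nsq x) : MvPolynomial (Fin n) ℝ) = A2 at *
    ring

lemma fis_rad_mul (h q : MvPolynomial (Fin n) ℝ) : fis q (rad n * h) = fis (lap q) h := by
  rw [rad, Finset.sum_mul, map_sum, lap, fis_sum]
  exact Finset.sum_congr rfl (fun i _ => by rw [mul_assoc, fis_X_mul, fis_X_mul])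

lemma fis_lin_mul (h q : MvPolynomial (Fin n) ℝ) : fis q (lin x * h) = fis (dirD x q) h := by
  rw [lin, Finset.sum_mul, map_sum, dirD, fis_sum]
  exact Finset.sum_congr rfl (fun i _ => by
    rw [mul_assoc, fis_C_mul_left, fis_X_mul, fis_C_mul])

lemma dirD_homog {k : ℕ} {f : MvPolynomial (Fin n) ℝ} (hf : f.IsHomogeneous (k + 1)) :
    (dirD x f).IsHomogeneous k := by
  refine IsHomogeneous.sum _ _ _ (fun i _ => ?_)
  simpa using (isHomogeneous_C (Fin n) (x i)).mul (hf.pderiv (i := i))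

lemma fis_lin_pow (k : ℕ) : ∀ {f : MvPolynomial (Fin n) ℝ}, f.IsHomogeneous k →
    fis f (lin x ^ k) = k.factorial * eval x f := by
  induction k with
  | zero =>
    intro f hf
    obtain ⟨c, rfl⟩ : ∃ c, f = C c := ⟨_, (totalDegree_eq_zero_iff_eq_C.1
      (Nat.le_zero.1 hf.totalDegree_le))⟩
    have : fis (C c : MvPolynomial (Fin n) ℝ) (monomial 0 1) = c := by
      rw [fis_monomial]; simp [fac]
    simpa using this
  | succ k ih =>
    intro f hf
    rw [pow_succ', fis_lin_mul, ih (dirD_homog x hf)]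
    have h := congrArg (eval x) (eul_homog hf)
    have h2 : eval x (dirD x f) = eval x (eul f) := by
      simp [dirD, eul]
    rw [h2, h]
    simp [Nat.factorial_succ]
    ring

lemma fis_zon (m : ℕ) (hn : n = m + 2) (k : ℕ) : ∃ c : ℝ, 0 < c ∧ ∀ x y : Fin n → ℝ,
    fis (zon m y k) (zon m x k) = c * eval x (zon m y k) := by
  obtain ⟨c, hc, h⟩ := zon_decomp m n k
  refine ⟨c * k.factorial, by positivity, fun x y => ?_⟩
  obtain ⟨g, hg⟩ := h x
  rw [hg, map_add, fis_C_mul_left, fis_rad_mul, lap_zon y m hn, fis_zero,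
    fis_lin_pow x k (zon_homog y m k)]
  ring

/-- the real recursion -/
noncomputable def geg (m : ℕ) (s q : ℝ) : ℕ → ℝ
  | 0 => 1
  | 1 => s
  | k + 2 => ((2 * k + m + 2 : ℝ) / (k + m + 1)) * (s * geg m s q (k + 1))
      - ((k + 1 : ℝ) / (k + m + 1)) * (q * geg m s q k)

lemma eval_zon (m : ℕ) (x y : Fin n → ℝ) : ∀ k,
    eval x (zon m y k) = geg m (∑ i, x i * y i) (nsq x * nsq y) k
  | 0 => by simp [zon, geg]
  | 1 => by
    simp only [zon, geg, lin, map_sum, map_mul, eval_C, eval_X]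
    exact Finset.sum_congr rfl (fun i _ => mul_comm _ _)
  | k + 2 => by
    rw [zon, geg, map_sub, eval_mul, eval_mul, eval_mul, eval_mul, eval_zon m x y k,
      eval_zon m x y (k + 1), eval_C, eval_C]
    have h1 : eval x (lin y) = ∑ i, x i * y i := by
      simp only [lin, map_sum, map_mul, eval_C, eval_X]
      exact Finset.sum_congr rfl (fun i _ => mul_comm _ _)
    have h2 : eval x (rad n) = nsq x := by simp [rad, nsq]
    rw [h1, h2]
    ring

lemma geg_psd_fin (m : ℕ) (hn : n = m + 2) (k : ℕ) {ι : Type*} (s : Finset ι)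
    (c : ι → ℝ) (v : ι → Fin n → ℝ) :
    0 ≤ ∑ a ∈ s, ∑ b ∈ s, c a * c b *
      geg m (∑ i, v a i * v b i) (nsq (v a) * nsq (v b)) k := by
  obtain ⟨K, hK, h⟩ := fis_zon (n := n) m hn k
  have h0 := fis_self_nonneg (∑ a ∈ s, C (c a) * zon m (v a) k)
  rw [fis_sum] at h0
  have : ∑ b ∈ s, fis (C (c b) * zon m (v b) k) (∑ a ∈ s, C (c a) * zon m (v a) k)
    = K * ∑ a ∈ s, ∑ b ∈ s, c a * c b *
      geg m (∑ i, v a i * v b i) (nsq (v a) * nsq (v b)) k := by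
    rw [Finset.sum_comm, Finset.mul_sum]
    refine Finset.sum_congr rfl (fun b _ => ?_)
    rw [map_sum, Finset.mul_sum]
    refine Finset.sum_congr rfl (fun a _ => ?_)
    rw [fis_C_mul, fis_C_mul_left, h, eval_zon]
    ring
  rw [this] at h0
  exact nonneg_of_mul_nonneg_right h0 hK

lemma geg_psd {E : Type*} [NormedAddCommGroup E] [InnerProductSpace ℝ E] [FiniteDimensional ℝ E]
    (m : ℕ) (hn : Module.finrank ℝ E = m + 2) (k : ℕ) {ι : Type*} (s : Finset ι)
    (c : ι → ℝ) (v : ι → E) :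
    0 ≤ ∑ a ∈ s, ∑ b ∈ s, c a * c b *
      geg m (inner ℝ (v a) (v b)) (inner ℝ (v a) (v a) * inner ℝ (v b) (v b)) k := by
  let B := (stdOrthonormalBasis ℝ E)
  have hi : ∀ x y : E, inner ℝ x y = ∑ i, B.repr x i * B.repr y i := by
    intro x y
    rw [← B.repr.inner_map_map x y]
    rw [PiLp.inner_apply]
    exact Finset.sum_congr rfl (fun i _ => by simp [mul_comm])
  have := geg_psd_fin (n := Module.finrank ℝ E) m hn k s c (fun a i => B.repr (v a) i)
  simpa only [nsq, ← hi] using this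

/-- the three-point version -/
lemma geg_psd3 {E : Type*} [NormedAddCommGroup E] [InnerProductSpace ℝ E] [FiniteDimensional ℝ E]
    (m : ℕ) (hn : Module.finrank ℝ E = m + 3) (k : ℕ) (z : E) (hz : ‖z‖ = 1) (s : Finset E)
    (hs : ∀ x ∈ s, ‖x‖ = 1) (c : E → ℝ) :
    0 ≤ ∑ a ∈ s, ∑ b ∈ s, c a * c b *
      geg m (inner ℝ a b - inner ℝ a z * inner ℝ b z)
        ((1 - inner ℝ a z ^ 2) * (1 - inner ℝ b z ^ 2)) k := by
  have hz0 : z ≠ 0 := by rintro rfl; simp at hz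
  have hzz : inner ℝ z z = (1 : ℝ) := by rw [real_inner_self_eq_norm_sq, hz]; norm_num
  have hf : Module.finrank ℝ ((ℝ ∙ z)ᗮ : Submodule ℝ E) = m + 2 := by
    have := Submodule.finrank_add_finrank_orthogonal (ℝ ∙ z)
    rw [finrank_span_singleton hz0, hn] at this
    omega
  let v : E → ((ℝ ∙ z)ᗮ : Submodule ℝ E) := fun a => ⟨a - (inner ℝ a z : ℝ) • z, by
    rw [Submodule.mem_orthogonal_singleton_iff_inner_right, inner_sub_right, inner_smul_right, hzz,
      real_inner_comm]
    ring⟩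
  have hv : ∀ a b, inner ℝ (v a) (v b) = (inner ℝ a b - inner ℝ a z * inner ℝ b z : ℝ) := by
    intro a b
    rw [Submodule.coe_inner]
    simp only [v, inner_sub_left, inner_sub_right, inner_smul_left, inner_smul_right, hzz,
      real_inner_comm z b]
    simp
    try rw [real_inner_comm b z]
    try ring
  have h := geg_psd m hf k s c v
  refine le_of_le_of_eq h (Finset.sum_congr rfl (fun a ha => Finset.sum_congr rfl (fun b hb => ?_)))
  have h1 : inner ℝ a a = (1 : ℝ) := by rw [real_inner_self_eq_norm_sq, hs a ha]; norm_num
  have h2 : inner ℝ b b = (1 : ℝ) := by rw [real_inner_self_eq_norm_sq, hs b hb]; norm_num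
  rw [hv, hv, hv, h1, h2, pow_two, pow_two]

end
end Kiss

namespace Kiss
lemma geg_zero (m : ℕ) : ∀ k, geg m 0 0 (k + 1) = 0
  | 0 => by simp [geg]
  | k + 1 => by simp [geg]

section
variable {ι₀ ι₁ : Type} [Fintype ι₀] [Fintype ι₁] (e : ι₀ → ℝ) (g₀ : ι₀ → ℝ → ℝ) (κ : ι₁ → ℕ)
  (g₁ : ι₁ → ℝ → ℝ)

noncomputable def Yf (g₀ : ι₀ → ℝ → ℝ) (κ : ι₁ → ℕ) (g₁ : ι₁ → ℝ → ℝ) (u v t : ℝ) : ℝ :=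
  ∑ r, g₀ r u * g₀ r v + ∑ j, g₁ j u * g₁ j v *
    geg 17 (t - u * v) ((1 - u ^ 2) * (1 - v ^ 2)) (κ j + 1)

abbrev E20 := EuclideanSpace ℝ (Fin 20)

open Classical in
noncomputable def Phi (z x y : E20) : ℝ :=
  ∑ r, (if x = z then e r else g₀ r (inner ℝ x z)) * (if y = z then e r else g₀ r (inner ℝ y z))
  + ∑ j, g₁ j (inner ℝ x z) * g₁ j (inner ℝ y z) *
    geg 17 (inner ℝ x y - inner ℝ x z * inner ℝ y z)
      ((1 - inner ℝ x z ^ 2) * (1 - inner ℝ y z ^ 2)) (κ j + 1)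

lemma Phi_nonneg (S : Finset E20) (hnorm : ∀ x ∈ S, ‖x‖ = 1) (z : E20) (hz : z ∈ S) :
    0 ≤ ∑ x ∈ S, ∑ y ∈ S, Phi e g₀ κ g₁ z x y := by
  classical
  simp only [Phi, Finset.sum_add_distrib]
  refine add_nonneg ?_ ?_
  · have : ∀ f : ι₀ → E20 → ℝ, ∑ x ∈ S, ∑ y ∈ S, ∑ r, f r x * f r y
        = ∑ r, (∑ x ∈ S, f r x) * (∑ x ∈ S, f r x) := by
      intro f
      simp only [Finset.sum_mul_sum]
      rw [Finset.sum_comm]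
      rw [Finset.sum_congr rfl (fun y _ => Finset.sum_comm)]
      rw [Finset.sum_comm]
      refine Finset.sum_congr rfl (fun y _ => Finset.sum_comm)
    rw [this (fun r x => if x = z then e r else g₀ r (inner ℝ x z))]
    exact Finset.sum_nonneg (fun r _ => mul_self_nonneg _)
  · have : ∀ f : ι₁ → E20 → E20 → ℝ, ∑ x ∈ S, ∑ y ∈ S, ∑ r, f r x y
        = ∑ r, ∑ x ∈ S, ∑ y ∈ S, f r x y := by
      intro f
      rw [Finset.sum_comm]
      rw [Finset.sum_congr rfl (fun y _ => Finset.sum_comm)]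
      rw [Finset.sum_comm]
      refine Finset.sum_congr rfl (fun y _ => Finset.sum_comm)
    rw [this]
    refine Finset.sum_nonneg (fun j _ => ?_)
    exact geg_psd3 17 (by simp) (κ j + 1) z (hnorm z hz) S hnorm (fun x => g₁ j (inner ℝ x z))

lemma Phi_zzz (z : E20) (hz : ‖z‖ = 1) : Phi e g₀ κ g₁ z z z = ∑ r, e r * e r := by
  have : inner ℝ z z = (1 : ℝ) := by rw [real_inner_self_eq_norm_sq, hz]; norm_num
  have h2 : ‖z‖ ^ 2 = 1 := by rw [hz]; norm_num
  simp [Phi, h2, geg_zero]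

lemma Phi_zzy (z y : E20) (hz : ‖z‖ = 1) (h : y ≠ z) :
    Phi e g₀ κ g₁ z z y = ∑ r, e r * g₀ r (inner ℝ y z) := by
  have : inner ℝ z z = (1 : ℝ) := by rw [real_inner_self_eq_norm_sq, hz]; norm_num
  have h2 : inner ℝ z y = (inner ℝ y z : ℝ) := real_inner_comm _ _
  have h3 : ‖z‖ ^ 2 = 1 := by rw [hz]; norm_num
  simp [Phi, h3, h, h2, geg_zero]

lemma Phi_symm (z x y : E20) : Phi e g₀ κ g₁ z x y = Phi e g₀ κ g₁ z y x := by
  simp only [Phi]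
  congr 1
  · exact Finset.sum_congr rfl (fun r _ => mul_comm _ _)
  · refine Finset.sum_congr rfl (fun r _ => ?_)
    rw [real_inner_comm x y, mul_comm (g₁ r (inner ℝ x z)), mul_comm (inner ℝ x z : ℝ),
      mul_comm (1 - inner ℝ x z ^ 2 : ℝ)]

lemma Phi_gen (z x y : E20) (hx : x ≠ z) (hy : y ≠ z) :
    Phi e g₀ κ g₁ z x y = Yf g₀ κ g₁ (inner ℝ x z) (inner ℝ y z) (inner ℝ x y) := by
  simp [Phi, Yf, hx, hy]

lemma gram_nonneg (x y z : E20) (hx : ‖x‖ = 1) (hy : ‖y‖ = 1) (hz : ‖z‖ = 1) :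
    0 ≤ 1 + 2 * inner ℝ x z * inner ℝ y z * inner ℝ x y - inner ℝ x z ^ 2 - inner ℝ y z ^ 2
      - (inner ℝ x y : ℝ) ^ 2 := by
  have ix : inner ℝ x x = (1 : ℝ) := by rw [real_inner_self_eq_norm_sq, hx]; norm_num
  have iy : inner ℝ y y = (1 : ℝ) := by rw [real_inner_self_eq_norm_sq, hy]; norm_num
  have iz : inner ℝ z z = (1 : ℝ) := by rw [real_inner_self_eq_norm_sq, hz]; norm_num
  have h := real_inner_mul_inner_self_le (x - (inner ℝ x z : ℝ) • z) (y - (inner ℝ y z : ℝ) • z)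
  simp only [inner_sub_left, inner_sub_right, inner_smul_left, inner_smul_right, ix, iy, iz,
    real_inner_comm x z, real_inner_comm y z, real_inner_comm x y] at h
  simp only [conj_trivial] at h
  nlinarith [h]

lemma Yf_symm (u v t : ℝ) : Yf g₀ κ g₁ u v t = Yf g₀ κ g₁ v u t := by
  simp only [Yf]
  congr 1
  · exact Finset.sum_congr rfl (fun r _ => mul_comm _ _)
  · refine Finset.sum_congr rfl (fun r _ => ?_)
    rw [mul_comm (g₁ r u), mul_comm u v, mul_comm (1 - u ^ 2)]

theorem sum_arg (S : Finset E20) (hnorm : ∀ x ∈ S, ‖x‖ = 1)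
    (hin : ∀ x ∈ S, ∀ y ∈ S, x ≠ y → (inner ℝ x y : ℝ) ≤ 1 / 2)
    (L : ℕ) (a : ℕ → ℝ) (ha : ∀ k, 0 ≤ a k) (α β : ℝ)
    (hpair : ∀ u : ℝ, -1 ≤ u → u ≤ 1 / 2 → ∑ k ∈ Finset.range L, a k * geg 18 u 1 k
      + Yf g₀ κ g₁ u u 1 + 2 * ∑ r, e r * g₀ r u ≤ -α)
    (htriple : ∀ u v t : ℝ, -1 ≤ u → u ≤ 1 / 2 → -1 ≤ v → v ≤ 1 / 2 → -1 ≤ t → t ≤ 1 / 2 →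
      0 ≤ 1 + 2 * u * v * t - u ^ 2 - v ^ 2 - t ^ 2 →
      Yf g₀ κ g₁ u v t + Yf g₀ κ g₁ u t v + Yf g₀ κ g₁ v t u ≤ -(3 * β))
    (hS : 0 < S.card)
    (hpt : ∑ k ∈ Finset.range L, a k * geg 18 1 1 k + ∑ r, e r * e r
      < (S.card - 1) * α + (S.card - 1) * (S.card - 2) * β) : False := by
  classical
  set p : ℝ → ℝ := fun u => ∑ k ∈ Finset.range L, a k * geg 18 u 1 k with hp
  have hone : ∀ x ∈ S, inner ℝ x x = (1 : ℝ) := fun x hx => by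
    rw [real_inner_self_eq_norm_sq, hnorm x hx]; norm_num
  have hP : 0 ≤ ∑ x ∈ S, ∑ y ∈ S, p (inner ℝ x y) := by
    have : ∑ x ∈ S, ∑ y ∈ S, p (inner ℝ x y) = ∑ k ∈ Finset.range L, a k * ∑ x ∈ S, ∑ y ∈ S,
        1 * 1 * geg 18 (inner ℝ x y) (inner ℝ x x * inner ℝ y y) k := by
      simp only [hp, Finset.mul_sum]
      rw [Finset.sum_congr rfl (fun y _ => Finset.sum_comm)]
      rw [Finset.sum_comm]
      refine Finset.sum_congr rfl (fun k _ => Finset.sum_congr rfl (fun x hx =>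
        Finset.sum_congr rfl (fun y hy => ?_)))
      rw [hone x hx, hone y hy]; norm_num
    rw [this]
    exact Finset.sum_nonneg (fun k _ => mul_nonneg (ha k)
      (geg_psd 18 (by simp) k S (fun _ => 1) (fun x => x)))
  have hT : 0 ≤ ∑ z ∈ S, ∑ x ∈ S, ∑ y ∈ S, Phi e g₀ κ g₁ z x y :=
    Finset.sum_nonneg (fun z hz => Phi_nonneg e g₀ κ g₁ S hnorm z hz)
  set En : ℝ := ∑ r, e r * e r with hE
  set δ : E20 → E20 → ℝ := fun x y => if x = y then 1 else 0 with hδ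
  set b : E20 → E20 → ℝ := fun x y => if x = y then En else -α - p (inner ℝ x y) with hb
  have hlow : ∀ x ∈ S, ∀ y ∈ S, (-1 : ℝ) ≤ inner ℝ x y := fun x hx y hy => by
    have := abs_real_inner_le_norm x y
    rw [hnorm x hx, hnorm y hy] at this
    have := (abs_le.1 this).1
    linarith
  have hpr : ∀ x ∈ S, ∀ y ∈ S, x ≠ y →
      Yf g₀ κ g₁ (inner ℝ x y) (inner ℝ x y) 1 + 2 * ∑ r, e r * g₀ r (inner ℝ x y)
        ≤ -α - p (inner ℝ x y) := fun x hx y hy h => by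
    have := hpair _ (hlow x hx y hy) (hin x hx y hy h)
    simp only [hp]; linarith
  have hPsi : ∀ z ∈ S, ∀ x ∈ S, ∀ y ∈ S,
      Phi e g₀ κ g₁ z x y + Phi e g₀ κ g₁ x z y + Phi e g₀ κ g₁ y x z ≤
      δ z x * b x y + δ x y * b y z + δ z y * b z x
        + (1 - δ z x - δ x y - δ z y + 2 * (δ z x * δ x y)) * (-(3 * β)) := by
    intro z hz x hx y hy
    by_cases h1 : z = x
    · subst h1
      by_cases h2 : z = y
      · subst h2
        simp only [Phi_zzz e g₀ κ g₁ z (hnorm z hz), hδ, hb, if_true]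
        linarith
      · have h2' : y ≠ z := Ne.symm h2
        rw [Phi_zzy e g₀ κ g₁ z y (hnorm z hz) h2', Phi_gen e g₀ κ g₁ y z z h2 h2, hone z hz]
        have := hpr z hz y hy h2
        rw [real_inner_comm z y]
        simp only [hδ, hb, if_true, if_neg h2]
        linarith
    · have h1' : x ≠ z := Ne.symm h1
      by_cases h2 : x = y
      · subst h2
        rw [Phi_symm e g₀ κ g₁ x z x, Phi_zzy e g₀ κ g₁ x z (hnorm x hx) h1,
          Phi_gen e g₀ κ g₁ z x x h1' h1', hone x hx]
        have := hpr x hx z hz h1'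
        rw [real_inner_comm x z]
        simp only [hδ, hb, if_true, if_neg h1, if_neg h1']
        linarith
      · have h2' : y ≠ x := Ne.symm h2
        by_cases h3 : z = y
        · subst h3
          rw [Phi_symm e g₀ κ g₁ z x z, Phi_zzy e g₀ κ g₁ z x (hnorm z hz) h1',
            Phi_gen e g₀ κ g₁ x z z h1 h1, hone z hz]
          have := hpr z hz x hx h1
          rw [real_inner_comm z x]
          simp only [hδ, hb, if_true, if_neg h1, if_neg h1']
          linarith
        · have h3' : y ≠ z := Ne.symm h3
          rw [Phi_gen e g₀ κ g₁ z x y h1' h3', Phi_gen e g₀ κ g₁ x z y h1 h2',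
            Phi_gen e g₀ κ g₁ y x z h2 h3]
          have := htriple (inner ℝ x z) (inner ℝ y z) (inner ℝ x y) (hlow x hx z hz)
            (hin x hx z hz h1') (hlow y hy z hz) (hin y hy z hz h3') (hlow x hx y hy)
            (hin x hx y hy h2) (gram_nonneg x y z (hnorm x hx) (hnorm y hy) (hnorm z hz))
          rw [real_inner_comm x z, real_inner_comm y z, real_inner_comm x y,
            Yf_symm g₀ κ g₁ (inner ℝ x y) (inner ℝ y z)]
          simp only [hδ, if_neg h1, if_neg h2, if_neg h3]
          linarith
  have hsum := Finset.sum_le_sum (fun z hz => Finset.sum_le_sum (fun x hx =>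
    Finset.sum_le_sum (fun y hy => hPsi z hz x hx y hy)))
  simp only [Finset.sum_add_distrib] at hsum
  set T := ∑ z ∈ S, ∑ x ∈ S, ∑ y ∈ S, Phi e g₀ κ g₁ z x y with hTdef
  have t1 : ∑ z ∈ S, ∑ x ∈ S, ∑ y ∈ S, Phi e g₀ κ g₁ x z y = T := by
    rw [Finset.sum_comm]
  have t2 : ∑ z ∈ S, ∑ x ∈ S, ∑ y ∈ S, Phi e g₀ κ g₁ y x z = T := by
    rw [Finset.sum_congr rfl (fun z _ => Finset.sum_comm), Finset.sum_comm]
    rw [hTdef]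
    exact Finset.sum_congr rfl (fun z _ => Finset.sum_comm)
  have d1 : ∀ f : E20 → ℝ, ∀ z ∈ S, ∑ x ∈ S, δ z x * f x = f z := by
    intro f z hz
    simp only [hδ, ite_mul, one_mul, zero_mul, Finset.sum_ite_eq, if_pos hz]
  set Bs := ∑ x ∈ S, ∑ y ∈ S, b x y with hBs
  have b1 : ∑ z ∈ S, ∑ x ∈ S, ∑ y ∈ S, δ z x * b x y = Bs := by
    rw [hBs]
    refine Finset.sum_congr rfl (fun z hz => ?_)
    simp only [← Finset.mul_sum]
    exact d1 (fun x => ∑ y ∈ S, b x y) z hz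
  have b2 : ∑ z ∈ S, ∑ x ∈ S, ∑ y ∈ S, δ x y * b y z = Bs := by
    rw [hBs, Finset.sum_comm]
    refine Finset.sum_congr rfl (fun x hx => Finset.sum_congr rfl (fun z hz => ?_))
    exact d1 (fun y => b y z) x hx
  have b3 : ∑ z ∈ S, ∑ x ∈ S, ∑ y ∈ S, δ z y * b z x = Bs := by
    rw [hBs]
    refine Finset.sum_congr rfl (fun z hz => Finset.sum_congr rfl (fun x hx => ?_))
    exact d1 (fun y => b z x) z hz
  have dd : ∀ z ∈ S, ∑ x ∈ S, δ z x = 1 := fun z hz => by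
    have := d1 (fun _ => 1) z hz
    simpa using this
  set N : ℝ := (S.card : ℝ) with hN
  have c1 : ∑ z ∈ S, ∑ x ∈ S, ∑ y ∈ S,
      (1 - δ z x - δ x y - δ z y + 2 * (δ z x * δ x y)) * (-(3 * β))
      = (N * (N - 1) * (N - 2)) * (-(3 * β)) := by
    simp only [← Finset.sum_mul]
    congr 1
    simp only [Finset.sum_add_distrib, Finset.sum_sub_distrib, ← Finset.mul_sum]
    have e1 : ∑ z ∈ S, ∑ x ∈ S, ∑ y ∈ S, δ z x = N * N := by
      rw [Finset.sum_congr rfl (fun z hz => show ∑ x ∈ S, ∑ y ∈ S, δ z x = N by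
        rw [Finset.sum_comm]; simp [dd z hz, hN])]
      simp [hN]
    have e2 : ∑ z ∈ S, ∑ x ∈ S, ∑ y ∈ S, δ x y = N * N := by
      rw [Finset.sum_congr rfl (fun z hz => show ∑ x ∈ S, ∑ y ∈ S, δ x y = N by
        rw [Finset.sum_congr rfl (fun x hx => dd x hx)]; simp [hN])]
      simp [hN]
    have e3 : ∑ z ∈ S, ∑ x ∈ S, ∑ y ∈ S, δ z y = N * N := by
      rw [Finset.sum_congr rfl (fun z hz => show ∑ x ∈ S, ∑ y ∈ S, δ z y = N by
        simp [dd z hz, hN])]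
      simp [hN]
    have e4 : ∑ z ∈ S, ∑ x ∈ S, δ z x * ∑ y ∈ S, δ x y = N := by
      rw [Finset.sum_congr rfl (fun z hz => d1 (fun x => ∑ y ∈ S, δ x y) z hz),
        Finset.sum_congr rfl (fun z hz => dd z hz)]
      simp [hN]
    rw [e1, e2, e3, e4]
    simp
    ring
  have hbp : Bs + ∑ x ∈ S, ∑ y ∈ S, p (inner ℝ x y) = N * (En + p 1) - N * (N - 1) * α := by
    rw [hBs, ← Finset.sum_add_distrib]
    have : ∀ x ∈ S, ∑ y ∈ S, b x y + ∑ y ∈ S, p (inner ℝ x y) = (En + p 1) - (N - 1) * α := by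
      intro x hx
      rw [← Finset.sum_add_distrib]
      have h2 : ∀ y ∈ S, b x y + p (inner ℝ x y) = δ x y * (En + p 1 + α) + (-α) := by
        intro y hy
        by_cases h : x = y
        · subst h; simp only [hb, hδ, if_true, hone x hx]; ring
        · simp only [hb, hδ, if_neg h]; ring
      rw [Finset.sum_congr rfl h2, Finset.sum_add_distrib, ← Finset.sum_mul, dd x hx]
      simp [hN]; ring
    rw [Finset.sum_congr rfl this]
    simp [hN]; ring
  rw [t1, t2, b1, b2, b3, c1] at hsum
  have hNpos : 0 < N := by rw [hN]; exact_mod_cast hS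
  have hpt' : p 1 + En < (N - 1) * α + (N - 1) * (N - 2) * β := hpt
  nlinarith [mul_lt_mul_of_pos_left hpt' hNpos]
end
end Kiss

namespace Kiss
open Finset
/-- de Casteljau evaluation -/
noncomputable def bz : ℕ → (ℕ → ℝ) → ℝ → ℝ
  | 0, g, _ => g 0
  | n+1, g, a => (1 - a) * bz n g a + a * bz n (fun i => g (i+1)) a

def Df {R : Type} [Add R] (s : ℕ) (g : ℕ → R) : ℕ → R := fun i => g i + g (i+s)

theorem bz_congr (n : ℕ) : ∀ (g h : ℕ → ℝ) (a : ℝ), (∀ j, j ≤ n → g j = h j) → bz n g a = bz n h a := by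
  induction n with
  | zero => intro g h a H; simpa [bz] using H 0 le_rfl
  | succ n ih =>
    intro g h a H
    simp only [bz]
    rw [ih g h a (fun j hj => H j (by omega)), ih (fun i => g (i+1)) (fun i => h (i+1)) a (fun j hj => H (j+1) (by omega))]

theorem bz_mono (n : ℕ) : ∀ (g h : ℕ → ℝ) (a : ℝ), 0 ≤ a → a ≤ 1 → (∀ j, j ≤ n → g j ≤ h j) → bz n g a ≤ bz n h a := by
  induction n with
  | zero => intro g h a _ _ H; simpa [bz] using H 0 le_rfl
  | succ n ih =>
    intro g h a h0 h1 H
    simp only [bz]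
    have := ih g h a h0 h1 (fun j hj => H j (by omega))
    have := ih (fun i => g (i+1)) (fun i => h (i+1)) a h0 h1 (fun j hj => H (j+1) (by omega))
    have : 0 ≤ 1 - a := by linarith
    gcongr

theorem bz_lin (n : ℕ) : ∀ (g h : ℕ → ℝ) (p q a : ℝ), bz n (fun i => p * g i + q * h i) a = p * bz n g a + q * bz n h a := by
  induction n with
  | zero => intro g h p q a; simp [bz]
  | succ n ih =>
    intro g h p q a
    simp only [bz]
    rw [ih g h, ih (fun i => g (i+1)) (fun i => h (i+1))]; ring

theorem bz_smul (n : ℕ) (g : ℕ → ℝ) (p a : ℝ) : bz n (fun i => p * g i) a = p * bz n g a := by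
  have := bz_lin n g g p 0 a
  simpa using this

theorem bz_const (n : ℕ) : ∀ (p a : ℝ), bz n (fun _ => p) a = p := by
  induction n with
  | zero => intro p a; simp [bz]
  | succ n ih => intro p a; simp only [bz, ih]; ring

theorem bz_swap (n m : ℕ) : ∀ (c : ℕ → ℕ → ℝ) (x y : ℝ),
    bz n (fun j => bz m (fun i => c i j) x) y = bz m (fun i => bz n (fun j => c i j) y) x := by
  induction n with
  | zero => intro c x y; simp [bz]
  | succ n ih =>
    intro c x y
    simp only [bz]
    rw [ih c x y, ih (fun i j => c i (j+1)) x y, ← bz_lin]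

theorem bz_left (n : ℕ) : ∀ (g : ℕ → ℝ) (a : ℝ),
    2^n * bz n g (a/2) = bz n (fun j => 2^(n-j) * ((Df 1)^[j] g) 0) a := by
  induction n with
  | zero => intro g a; simp [bz]
  | succ n ih =>
    intro g a
    have e1 : bz n (Df 1 g) (a/2) = bz n g (a/2) + bz n (fun i => g (i+1)) (a/2) := by
      have := bz_lin n g (fun i => g (i+1)) 1 1 (a/2)
      simp only [one_mul] at this; exact this
    have h1 := ih g a
    have h2 := ih (Df 1 g) a
    simp only [bz]
    have c1 : bz n (fun j => (2:ℝ)^(n+1-j) * ((Df 1)^[j] g) 0) a = 2 * bz n (fun j => 2^(n-j) * ((Df 1)^[j] g) 0) a := by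
      rw [← bz_smul]; apply bz_congr; intro j hj
      rw [show n+1-j = (n-j)+1 by omega, pow_succ]; ring
    have c2 : bz n (fun j => (2:ℝ)^(n+1-(j+1)) * ((Df 1)^[j+1] g) 0) a = bz n (fun j => 2^(n-j) * ((Df 1)^[j] (Df 1 g)) 0) a := by
      apply bz_congr; intro j hj
      rw [Function.iterate_succ_apply, show n+1-(j+1) = n-j by omega]
    rw [c1, c2, ← h1, ← h2, e1, pow_succ]; ring

theorem Df_iter_succ (n : ℕ) : ∀ (g : ℕ → ℝ) (j : ℕ), ((Df 1)^[n] (fun i => g (i+1))) j = ((Df 1)^[n] g) (j+1) := by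
  induction n with
  | zero => intro g j; rfl
  | succ n ih =>
    intro g j
    rw [Function.iterate_succ_apply, Function.iterate_succ_apply, ← ih]; rfl

theorem bz_right (n : ℕ) : ∀ (g : ℕ → ℝ) (a : ℝ),
    2^n * bz n g ((1+a)/2) = bz n (fun j => 2^j * ((Df 1)^[n-j] g) j) a := by
  induction n with
  | zero => intro g a; simp [bz]
  | succ n ih =>
    intro g a
    have e1 : bz n (Df 1 g) ((1+a)/2) = bz n g ((1+a)/2) + bz n (fun i => g (i+1)) ((1+a)/2) := by
      have := bz_lin n g (fun i => g (i+1)) 1 1 ((1+a)/2)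
      simp only [one_mul] at this; exact this
    have h1 := ih (Df 1 g) a
    have h2 := ih (fun i => g (i+1)) a
    simp only [bz]
    have c1 : bz n (fun j => (2:ℝ)^j * ((Df 1)^[n+1-j] g) j) a = bz n (fun j => 2^j * ((Df 1)^[n-j] (Df 1 g)) j) a := by
      apply bz_congr; intro j hj
      rw [show n+1-j = (n-j)+1 by omega, Function.iterate_succ_apply]
    have c2 : bz n (fun j => (2:ℝ)^(j+1) * ((Df 1)^[n+1-(j+1)] g) (j+1)) a = 2 * bz n (fun j => 2^j * ((Df 1)^[n-j] (fun i => g (i+1))) j) a := by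
      rw [← bz_smul]; apply bz_congr; intro j hj
      rw [Df_iter_succ, show n+1-(j+1) = n-j by omega, pow_succ]; ring
    rw [c1, c2, ← h1, ← h2, e1, pow_succ]; ring

theorem bz_sum (n : ℕ) : ∀ (g : ℕ → ℝ) (a : ℝ),
    bz n g a = ∑ j ∈ range (n+1), (n.choose j : ℝ) * a^j * (1-a)^(n-j) * g j := by
  induction n with
  | zero => intro g a; simp [bz]
  | succ n ih =>
    intro g a
    simp only [bz]
    rw [ih, ih, Finset.sum_range_succ' _ (n+1)]
    have : ∀ j ∈ range (n+1), (((n+1).choose (j+1) : ℕ) : ℝ) * a^(j+1) * (1-a)^(n+1-(j+1)) * g (j+1)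
       = a * ((n.choose j : ℝ) * a^j * (1-a)^(n-j) * g (j+1)) + (n.choose (j+1) : ℝ) * a^(j+1) * (1-a)^(n-j) * g (j+1) := by
      intro j hj
      rw [Nat.choose_succ_succ, show n+1-(j+1) = n-j by omega]; push_cast; ring
    rw [Finset.sum_congr rfl this, Finset.sum_add_distrib, ← Finset.mul_sum]
    have h2 : (1-a) * ∑ j ∈ range (n+1), (n.choose j : ℝ) * a^j * (1-a)^(n-j) * g j
       = ∑ j ∈ range (n+1), (n.choose (j+1) : ℝ) * a^(j+1) * (1-a)^(n-j) * g (j+1) + ((n+1).choose 0 : ℝ) * a^0 * (1-a)^(n+1-0) * g 0 := by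
      rw [Finset.sum_range_succ', Finset.sum_range_succ _ n, mul_add, Finset.mul_sum]
      have : ∀ j ∈ range n, (1-a) * ((n.choose (j+1) : ℝ) * a^(j+1) * (1-a)^(n-(j+1)) * g (j+1)) = (n.choose (j+1) : ℝ) * a^(j+1) * (1-a)^(n-j) * g (j+1) := by
        intro j hj
        have : j < n := Finset.mem_range.1 hj
        rw [show n - j = (n-(j+1))+1 by omega, pow_succ]; ring
      rw [Finset.sum_congr rfl this]
      simp [Nat.choose_succ_self]; ring
    rw [h2]; ring
end Kiss

namespace Kiss
open Finset

def pk (w : ℕ) : (ℕ → ℕ) → ℕ → ℕ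
  | _, 0 => 0
  | c, n+1 => c 0 + 2^w * pk w (fun i => c (i+1)) n

theorem pk_congr (w n : ℕ) : ∀ (c d : ℕ → ℕ), (∀ i, i < n → c i = d i) → pk w c n = pk w d n := by
  induction n with
  | zero => intro c d _; rfl
  | succ n ih =>
    intro c d h
    simp only [pk]
    rw [h 0 (by omega), ih _ (fun i => d (i+1)) (fun i hi => h (i+1) (by omega))]

theorem pk_add (w n : ℕ) : ∀ (c d : ℕ → ℕ), pk w c n + pk w d n = pk w (fun i => c i + d i) n := by
  induction n with
  | zero => intro c d; rfl
  | succ n ih => intro c d; simp only [pk]; rw [← ih]; ring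

theorem pk_mul (w n k : ℕ) : ∀ (c : ℕ → ℕ), pk w c n * k = pk w (fun i => c i * k) n := by
  induction n with
  | zero => intro c; simp [pk]
  | succ n ih => intro c; simp only [pk]; rw [← ih]; ring

theorem pk_zero (w n : ℕ) : ∀ (c : ℕ → ℕ), (∀ i, i < n → c i = 0) → pk w c n = 0 := by
  induction n with
  | zero => intro c _; rfl
  | succ n ih => intro c h; simp only [pk]; rw [h 0 (by omega), ih _ (fun i hi => h (i+1) (by omega))]; simp

theorem pk_append (w m n : ℕ) : ∀ (c : ℕ → ℕ), pk w c (m+n) = pk w c m + 2^(w*m) * pk w (fun i => c (i+m)) n := by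
  induction m with
  | zero => intro c; simp [pk]
  | succ m ih =>
    intro c
    rw [show m+1+n = (m+n)+1 by omega]
    simp only [pk]
    rw [ih]
    have : (fun i => c (i + m + 1)) = (fun i => c (i + (m+1))) := rfl
    rw [this, mul_add, mul_add, pow_add]; ring

theorem pk_lt (w n : ℕ) : ∀ (c : ℕ → ℕ), (∀ i, i < n → c i < 2^w) → pk w c n < 2^(w*n) := by
  induction n with
  | zero => intro c _; simp [pk]
  | succ n ih =>
    intro c h
    simp only [pk]
    have h0 := h 0 (by omega)
    have h1 := ih _ (fun i hi => h (i+1) (by omega))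
    calc c 0 + 2^w * pk w (fun i => c (i+1)) n < 2^w + 2^w * pk w (fun i => c (i+1)) n := by omega
      _ = 2^w * (pk w (fun i => c (i+1)) n + 1) := by ring
      _ ≤ 2^w * 2^(w*n) := Nat.mul_le_mul_left _ h1
      _ = 2^(w*(n+1)) := by rw [← pow_add]; ring_nf

theorem pk_ext (w K N : ℕ) (c : ℕ → ℕ) (h0 : ∀ i, K ≤ i → c i = 0) : pk w c (K+N) = pk w c K := by
  rw [pk_append, pk_zero w N _ (fun i _ => h0 _ (by omega))]; simp

theorem pk_shr (w s K : ℕ) (c : ℕ → ℕ) (h : ∀ i, c i < 2^w) (h0 : ∀ i, K ≤ i → c i = 0) :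
    pk w c K >>> (w*s) = pk w (fun i => c (i+s)) K := by
  rw [← pk_ext w K s c h0, add_comm K s, pk_append, Nat.shiftRight_eq_div_pow, Nat.add_mul_div_left _ _ (by positivity),
    Nat.div_eq_of_lt (pk_lt w s c (fun i _ => h i))]
  simp

theorem pk_shl (w s K : ℕ) (c : ℕ → ℕ) (h0 : ∀ i, K ≤ i + s → c i = 0) :
    pk w c K <<< (w*s) = pk w (fun i => if s ≤ i then c (i-s) else 0) K := by
  rw [← pk_ext w K s (fun i => if s ≤ i then c (i-s) else 0), add_comm K s, pk_append, pk_zero w s, Nat.shiftLeft_eq]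
  · rw [zero_add, mul_comm]; congr 1
    apply pk_congr; intro i hi; simp
  · intro i hi; simp [Nat.not_le.2 hi]
  · intro i hi
    by_cases hs : s ≤ i
    · simp [hs]; exact h0 _ (by omega)
    · simp [hs]

theorem and_split (w a b x y : ℕ) (ha : a < 2^w) (hb : b < 2^w) :
    (a + 2^w * x) &&& (b + 2^w * y) = (a &&& b) + 2^w * (x &&& y) := by
  apply Nat.eq_of_testBit_eq
  intro i
  rw [Nat.testBit_and, add_comm a, add_comm b, add_comm (a &&& b), Nat.testBit_two_pow_mul_add _ ha, Nat.testBit_two_pow_mul_add _ hb,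
    Nat.testBit_two_pow_mul_add _ (lt_of_le_of_lt Nat.and_le_left ha)]
  split_ifs <;> simp [Nat.testBit_and]

theorem pk_and (w n : ℕ) : ∀ (c d : ℕ → ℕ), (∀ i, c i < 2^w) → (∀ i, d i < 2^w) →
    pk w c n &&& pk w d n = pk w (fun i => c i &&& d i) n := by
  induction n with
  | zero => intro c d _ _; simp [pk]
  | succ n ih =>
    intro c d hc hd
    simp only [pk]
    rw [and_split w _ _ _ _ (hc 0) (hd 0), ih _ _ (fun i => hc (i+1)) (fun i => hd (i+1))]

theorem pk_inj (w n : ℕ) : ∀ (c d : ℕ → ℕ), (∀ i, c i < 2^w) → (∀ i, d i < 2^w) →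
    pk w c n = pk w d n → ∀ i, i < n → c i = d i := by
  induction n with
  | zero => intro c d _ _ _ i hi; omega
  | succ n ih =>
    intro c d hc hd h
    simp only [pk] at h
    have h0 : c 0 = d 0 := by
      have := congrArg (· % 2^w) h
      simpa [Nat.add_mul_mod_self_left, Nat.mod_eq_of_lt (hc 0), Nat.mod_eq_of_lt (hd 0)] using this
    have h1 : pk w (fun i => c (i+1)) n = pk w (fun i => d (i+1)) n := by
      rw [h0] at h
      have := Nat.add_left_cancel h
      exact Nat.eq_of_mul_eq_mul_left (by positivity) this
    have := ih _ _ (fun i => hc (i+1)) (fun i => hd (i+1)) h1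
    intro i hi
    cases i with
    | zero => exact h0
    | succ i => exact this i (by omega)

/-! masks -/
theorem geo (B n : ℕ) (hB : 2 ≤ B) : (B^n - 1) / (B - 1) = ∑ k ∈ range n, B^k := (Nat.geomSum_eq hB n).symm

theorem pk_sum (w n : ℕ) : ∀ c : ℕ → ℕ, pk w c n = ∑ i ∈ range n, c i * (2^w)^i := by
  induction n with
  | zero => intro c; rfl
  | succ n ih =>
    intro c
    simp only [pk]; rw [ih, Finset.sum_range_succ', Finset.mul_sum]
    rw [add_comm]; congr 1
    · apply Finset.sum_congr rfl; intro i _; rw [pow_succ]; ring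
    · simp

def mcst (w K v : ℕ) : ℕ := Nat.mul v (Nat.div (Nat.sub (Nat.pow 2 (w*K)) 1) (Nat.sub (Nat.pow 2 w) 1))

theorem two_le_pow {w : ℕ} (hw : 0 < w) : 2 ≤ 2^w := by
  calc 2 = 2^1 := by norm_num
    _ ≤ 2^w := Nat.pow_le_pow_right (by norm_num) hw

theorem mcst_eq (w K v : ℕ) (hw : 0 < w) : mcst w K v = pk w (fun _ => v) K := by
  have : mcst w K v = v * (((2^w)^K - 1) / (2^w - 1)) := by rw [← pow_mul]; rfl
  rw [this, geo _ _ (two_le_pow hw), pk_sum, Finset.mul_sum]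

def msk (w n s o : ℕ) : ℕ := Nat.mul (Nat.sub (Nat.pow 2 (w*s)) 1) (Nat.div (Nat.sub (Nat.pow 2 (w*s*(n+1)*o)) 1) (Nat.sub (Nat.pow 2 (w*s*(n+1))) 1))

def axd (w n s i : ℕ) : ℕ := if (i/s) % (n+1) = 0 then 2^w - 1 else 0

theorem pk_period (w p : ℕ) (c : ℕ → ℕ) (hc : ∀ i, c (i+p) = c i) (o : ℕ) :
    pk w c (p*o) = pk w c p * ∑ k ∈ range o, (2^(w*p))^k := by
  induction o with
  | zero => simp [pk]
  | succ o ih =>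
    have e : pk w (fun i => c (i+p)) (p*o) = pk w c (p*o) := pk_congr _ _ _ _ (fun i _ => hc i)
    rw [show p*(o+1) = p + p*o by ring, pk_append, e, ih, Finset.sum_range_succ', mul_add, pow_zero, mul_one, add_comm]
    congr 1
    rw [Finset.mul_sum, Finset.mul_sum, Finset.mul_sum]
    apply Finset.sum_congr rfl; intro i _; rw [pow_succ]; ring

theorem msk_eq (w n s o : ℕ) (hw : 0 < w) (hs : 0 < s) : msk w n s o = pk w (axd w n s) (s*(n+1)*o) := by
  have h1 : msk w n s o = (2^(w*s) - 1) * (((2^(w*(s*(n+1))))^o - 1) / (2^(w*(s*(n+1))) - 1)) := by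
    rw [← pow_mul, ← mul_assoc]; rfl
  rw [h1, geo _ _ (two_le_pow (by positivity)), pk_period w (s*(n+1)) (axd w n s)]
  · congr 1
    rw [show s*(n+1) = s + s*n by ring, pk_append, pk_zero w (s*n)]
    · have : pk w (axd w n s) s = pk w (fun _ => 2^w-1) s := by
        apply pk_congr; intro i hi; simp [axd, Nat.div_eq_of_lt hi]
      rw [this, ← mcst_eq w s _ hw]
      have : mcst w s (2^w-1) = (2^w-1) * (((2^w)^s - 1) / (2^w - 1)) := by rw [← pow_mul]; rfl
      rw [this, Nat.mul_div_cancel' (by simpa using Nat.sub_dvd_pow_sub_pow (2^w) 1 s), ← pow_mul]; simp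
    · intro i hi
      have : ((i+s)/s) % (n+1) ≠ 0 := by
        rw [Nat.add_div_right _ hs]
        have h5 : i/s < n := Nat.div_lt_of_lt_mul hi
        rw [Nat.mod_eq_of_lt (Nat.succ_lt_succ h5)]; exact Nat.succ_ne_zero _
      simp [axd, this]
  · intro i
    simp only [axd]
    rw [Nat.add_mul_div_left _ _ hs, Nat.add_mod_right]

theorem and_full (w c : ℕ) (h : c < 2^w) : c &&& (2^w-1) = c := by
  rw [Nat.and_two_pow_sub_one_eq_mod, Nat.mod_eq_of_lt h]

/-! the split -/
def goL (sw m0 : ℕ) : ℕ → ℕ → ℕ → ℕ → ℕ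
  | 0, sh, X, acc => Nat.add acc (Nat.shiftLeft (Nat.land X m0) sh)
  | r+1, sh, X, acc => goL sw m0 r (Nat.add sh sw) (Nat.add X (Nat.shiftRight X sw))
      (Nat.add acc (Nat.shiftLeft (Nat.land X m0) (Nat.add sh (Nat.succ r))))

def goR (sw m0 : ℕ) : ℕ → ℕ → ℕ → ℕ
  | 0, X, acc => Nat.add acc (Nat.land X m0)
  | r+1, X, acc => goR sw m0 r (Nat.add X (Nat.shiftRight X sw))
      (Nat.add acc (Nat.shiftLeft (Nat.land (Nat.shiftRight X (Nat.mul sw (Nat.succ r))) m0) (Nat.add (Nat.mul sw (Nat.succ r)) (Nat.succ r))))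

def flr (n mh V : ℕ) : ℕ := Nat.shiftRight (Nat.land V mh) n

def tL (n s j : ℕ) (d : ℕ → ℕ) (i : ℕ) : ℕ := if s*j ≤ i then (if ((i - s*j)/s) % (n+1) = 0 then d (i - s*j) else 0) else 0

theorem axis0 (n s o i : ℕ) (hs : 0 < s) (hi : i < s*(n+1)*o) (h : (i/s) % (n+1) = 0) (j : ℕ) (hj : j ≤ n) : i + s*j < s*(n+1)*o := by
  have h1 : i/s < (n+1)*o := by
    apply Nat.div_lt_of_lt_mul; rwa [← mul_assoc]
  obtain ⟨q, hq⟩ := Nat.dvd_of_mod_eq_zero h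
  rw [hq] at h1
  have h2 : q < o := Nat.lt_of_mul_lt_mul_left h1
  have h3 : i < s * ((n+1)*q+1) := by
    rw [← hq]; exact Nat.lt_mul_div_succ i hs
  calc i + s*j < s * ((n+1)*q+1) + s*n := by nlinarith [Nat.mul_le_mul_left s hj]
    _ = s*(n+1)*(q+1) := by ring
    _ ≤ s*(n+1)*o := Nat.mul_le_mul_left _ h2

theorem term_spec (w n s o j : ℕ) (hw : 0 < w) (hs : 0 < s) (hj : j ≤ n) (d : ℕ → ℕ) (hd : ∀ i, d i < 2^w) (h0 : ∀ i, s*(n+1)*o ≤ i → d i = 0) :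
    (pk w d (s*(n+1)*o) &&& msk w n s o) <<< (w*(s*j)) = pk w (tL n s j d) (s*(n+1)*o) := by
  rw [msk_eq w n s o hw hs, pk_and]
  · have : (fun i => d i &&& axd w n s i) = fun i => if (i/s) % (n+1) = 0 then d i else 0 := by
      funext i; simp only [axd]; split_ifs
      · exact and_full w _ (hd i)
      · simp
    rw [this, pk_shl]
    · rfl
    · intro i hi
      split_ifs with h
      · by_contra hne
        have : i < s*(n+1)*o := by
          by_contra hh; exact hne (h0 i (by omega))
        have := axis0 n s o i hs this h j hj
        omega
      · rfl
  · exact hd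
  · intro i; simp only [axd]; have : 0 < 2^w := by positivity
    split_ifs <;> omega

theorem step_spec (w s K : ℕ) (d : ℕ → ℕ) (hd : ∀ i, d i < 2^w) (h0 : ∀ i, K ≤ i → d i = 0) :
    pk w d K + pk w d K >>> (w*s) = pk w (Df s d) K := by
  rw [pk_shr w s K d hd h0, pk_add]; rfl

theorem goL_spec (w n s o : ℕ) (hw : 0 < w) (hs : 0 < s) (r : ℕ) : ∀ (j : ℕ) (d e : ℕ → ℕ) (B : ℕ), j + r ≤ n →
    (∀ i, d i ≤ B) → B * 2^r < 2^w → (∀ i, s*(n+1)*o ≤ i → d i = 0) →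
    goL (w*s) (msk w n s o) r (w*(s*j)) (pk w d (s*(n+1)*o)) (pk w e (s*(n+1)*o)) =
      pk w (fun i => e i + ∑ t ∈ range (r+1), tL n s (j+t) ((Df s)^[t] d) i * 2^(r-t)) (s*(n+1)*o) := by
  induction r with
  | zero =>
    intro j d e B hj hd hB h0
    have hd' : ∀ i, d i < 2^w := fun i => lt_of_le_of_lt (hd i) (by simpa using hB)
    show pk w e _ + (pk w d _ &&& msk w n s o) <<< (w*(s*j)) = _
    rw [term_spec w n s o j hw hs (by omega) d hd' h0, pk_add]
    simp
  | succ r ih =>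
    intro j d e B hj hd hB h0
    have hB' : B < 2^w := lt_of_le_of_lt (Nat.le_mul_of_pos_right B (by positivity)) hB
    have hd' : ∀ i, d i < 2^w := fun i => lt_of_le_of_lt (hd i) hB'
    show goL (w*s) (msk w n s o) r (w*(s*j) + w*s) (pk w d _ + pk w d _ >>> (w*s)) (pk w e _ + (pk w d _ &&& msk w n s o) <<< (w*(s*j) + (r+1))) = _
    rw [step_spec w s _ d hd' h0, Nat.shiftLeft_add, term_spec w n s o j hw hs (by omega) d hd' h0, Nat.shiftLeft_eq, pk_mul, pk_add,
      show w*(s*j) + w*s = w*(s*(j+1)) by ring, ih (j+1) (Df s d) _ (2*B) (by omega)]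
    · apply pk_congr; intro i _
      rw [Finset.sum_range_succ' _ (r+1), add_assoc, add_comm (tL n s j d i * 2^(r+1))]
      congr 2
      apply Finset.sum_congr rfl; intro t ht
      rw [show j + (t+1) = j+1+t by ring, Function.iterate_succ_apply, show r+1-(t+1) = r - t by omega]
    · intro i; have := hd i; have := hd (i+s); simp only [Df]; omega
    · rw [pow_succ] at hB; linarith [hB, show B*(2^r*2) = 2*B*2^r by ring]
    · intro i hi; simp only [Df]; rw [h0 i hi, h0 (i+s) (by omega)]

theorem goR_spec (w n s o : ℕ) (hw : 0 < w) (hs : 0 < s) (r : ℕ) : ∀ (d e : ℕ → ℕ) (B : ℕ), r ≤ n →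
    (∀ i, d i ≤ B) → B * 2^r < 2^w → (∀ i, s*(n+1)*o ≤ i → d i = 0) →
    goR (w*s) (msk w n s o) r (pk w d (s*(n+1)*o)) (pk w e (s*(n+1)*o)) =
      pk w (fun i => e i + ∑ t ∈ range (r+1), tL n s (r-t) (fun i => ((Df s)^[t] d) (i+s*(r-t))) i * 2^(r-t)) (s*(n+1)*o) := by
  induction r with
  | zero =>
    intro d e B hj hd hB h0
    have hd' : ∀ i, d i < 2^w := fun i => lt_of_le_of_lt (hd i) (by simpa using hB)
    have := term_spec w n s o 0 hw hs (by omega) d hd' h0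
    simp only [mul_zero, Nat.shiftLeft_zero] at this
    show pk w e _ + (pk w d _ &&& msk w n s o) = _
    rw [this, pk_add]
    simp
  | succ r ih =>
    intro d e B hj hd hB h0
    have hB' : B < 2^w := lt_of_le_of_lt (Nat.le_mul_of_pos_right B (by positivity)) hB
    have hd' : ∀ i, d i < 2^w := fun i => lt_of_le_of_lt (hd i) hB'
    show goR (w*s) (msk w n s o) r (pk w d _ + pk w d _ >>> (w*s)) (pk w e _ + ((pk w d _ >>> (w*s*(r+1))) &&& msk w n s o) <<< (w*s*(r+1) + (r+1))) = _
    rw [step_spec w s _ d hd' h0, Nat.shiftLeft_add, show w*s*(r+1) = w*(s*(r+1)) by ring, pk_shr w _ _ d hd' h0,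
      term_spec w n s o (r+1) hw hs (by omega) _ (fun i => hd' _) (fun i hi => h0 _ (by omega)), Nat.shiftLeft_eq, pk_mul, pk_add,
      ih (Df s d) _ (2*B) (by omega)]
    · apply pk_congr; intro i _
      rw [Finset.sum_range_succ' _ (r+1), add_assoc, add_comm (tL n s (r+1) _ i * 2^(r+1))]
      congr 2
      apply Finset.sum_congr rfl; intro t ht
      rw [show r + 1 - (t+1) = r-t by omega, Function.iterate_succ_apply]
    · intro i; have := hd i; have := hd (i+s); simp only [Df]; omega
    · rw [pow_succ] at hB; linarith [hB, show B*(2^r*2) = 2*B*2^r by ring]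
    · intro i hi; simp only [Df]; rw [h0 i hi, h0 (i+s) (by omega)]

theorem tL_eq (n s j i : ℕ) (hs : 0 < s) (hj : j ≤ n) (d : ℕ → ℕ) : tL n s j d i = if (i/s) % (n+1) = j then d (i - s*j) else 0 := by
  unfold tL
  by_cases h : s*j ≤ i
  · have h1 : (i - s*j)/s = i/s - j := Nat.sub_mul_div_of_le i s j h
    have h2 : j ≤ i/s := (Nat.le_div_iff_mul_le hs).2 (by rwa [mul_comm])
    rw [if_pos h, h1]
    obtain ⟨q, hq⟩ := Nat.exists_eq_add_of_le h2
    have : ((i/s - j) % (n+1) = 0) ↔ (i/s) % (n+1) = j := by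
      rw [hq, Nat.add_sub_cancel_left]
      constructor
      · intro h; obtain ⟨k, hk⟩ := Nat.dvd_of_mod_eq_zero h
        rw [hk, Nat.add_mul_mod_self_left, Nat.mod_eq_of_lt (by omega)]
      · intro h
        have e := Nat.mod_add_div (j+q) (n+1)
        rw [h] at e
        have : q = (n+1) * ((j+q)/(n+1)) := by omega
        rw [this]; simp
    simp only [this]
  · rw [if_neg h]
    have h2 : i/s < j := by
      rw [Nat.div_lt_iff_lt_mul hs, mul_comm]; omega
    rw [if_neg]
    rw [Nat.mod_eq_of_lt (by omega)]; omega

def dL (n s : ℕ) (d : ℕ → ℕ) (i : ℕ) : ℕ := ((Df s)^[(i/s) % (n+1)] d) (i - s*((i/s) % (n+1))) * 2^(n - (i/s) % (n+1))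
def dR (n s : ℕ) (d : ℕ → ℕ) (i : ℕ) : ℕ := ((Df s)^[n - (i/s) % (n+1)] d) i * 2^((i/s) % (n+1))

def spL (w n s o V : ℕ) : ℕ := goL (Nat.mul w s) (msk w n s o) n 0 V 0
def spR (w n s o V : ℕ) : ℕ := goR (Nat.mul w s) (msk w n s o) n V 0

theorem pk_zero' (w n : ℕ) : pk w (fun _ => 0) n = 0 := pk_zero _ _ _ (fun _ _ => rfl)

theorem spL_spec (w n s o : ℕ) (hw : 0 < w) (hs : 0 < s) (d : ℕ → ℕ) (B : ℕ) (hd : ∀ i, d i ≤ B) (hB : B * 2^n < 2^w)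
    (h0 : ∀ i, s*(n+1)*o ≤ i → d i = 0) :
    spL w n s o (pk w d (s*(n+1)*o)) = pk w (dL n s d) (s*(n+1)*o) := by
  have := goL_spec w n s o hw hs n 0 d (fun _ => 0) B (by omega) hd hB h0
  rw [pk_zero'] at this
  unfold spL
  refine Eq.trans ?_ (this.trans ?_)
  · simp
  · apply pk_congr; intro i _
    have hm : (i/s) % (n+1) < n+1 := Nat.mod_lt _ (by omega)
    rw [Finset.sum_eq_single ((i/s) % (n+1))]
    · rw [tL_eq _ _ _ _ hs (by omega)]; simp [dL]
    · intro t ht hne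
      rw [tL_eq _ _ _ _ hs (by have := Finset.mem_range.1 ht; omega), if_neg (by omega)]; simp
    · intro h; exact absurd (Finset.mem_range.2 hm) h

theorem spR_spec (w n s o : ℕ) (hw : 0 < w) (hs : 0 < s) (d : ℕ → ℕ) (B : ℕ) (hd : ∀ i, d i ≤ B) (hB : B * 2^n < 2^w)
    (h0 : ∀ i, s*(n+1)*o ≤ i → d i = 0) :
    spR w n s o (pk w d (s*(n+1)*o)) = pk w (dR n s d) (s*(n+1)*o) := by
  have := goR_spec w n s o hw hs n d (fun _ => 0) B le_rfl hd hB h0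
  rw [pk_zero'] at this
  unfold spR
  refine Eq.trans ?_ (this.trans ?_)
  · rfl
  · apply pk_congr; intro i _
    have hm : (i/s) % (n+1) < n+1 := Nat.mod_lt _ (by omega)
    rw [Finset.sum_eq_single (n - (i/s) % (n+1))]
    · have e : n - (n - (i/s) % (n+1)) = (i/s) % (n+1) := by omega
      rw [tL_eq _ _ _ _ hs (by omega), e, if_pos rfl, zero_add]
      unfold dR
      rw [Nat.sub_add_cancel]
      calc s * ((i/s) % (n+1)) ≤ s * (i/s) := Nat.mul_le_mul_left _ (Nat.mod_le _ _)
        _ ≤ i := Nat.mul_div_le i s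
    · intro t ht hne
      have := Finset.mem_range.1 ht
      rw [tL_eq _ _ _ _ hs (by omega), if_neg (by omega)]; simp
    · intro h; exact absurd (Finset.mem_range.2 (by omega)) h

theorem and_hi (w n c : ℕ) (hn : n ≤ w) (h : c < 2^w) : c &&& (2^w - 2^n) = (c / 2^n) * 2^n := by
  have e : 2^w - 2^n = 0 + 2^n * (2^(w-n) - 1) := by
    rw [Nat.mul_sub, ← pow_add, Nat.add_sub_cancel' hn]; simp
  have e2 : c = c % 2^n + 2^n * (c / 2^n) := (Nat.mod_add_div c _).symm
  rw [e]
  nth_rewrite 1 [e2]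
  rw [and_split n _ _ _ _ (Nat.mod_lt _ (by positivity)) (by positivity), and_full]
  · simp [mul_comm]
  · apply Nat.div_lt_of_lt_mul; rw [← pow_add, Nat.add_sub_cancel' hn]; exact h

theorem flr_spec (w n K : ℕ) (hw : 0 < w) (hn : n ≤ w) (d : ℕ → ℕ) (hd : ∀ i, d i < 2^w) :
    flr n (mcst w K (2^w - 2^n)) (pk w d K) = pk w (fun i => d i / 2^n) K := by
  show (pk w d K &&& mcst w K (2^w - 2^n)) >>> n = _
  rw [mcst_eq _ _ _ hw, pk_and w K _ _ hd]
  · have : (fun i => d i &&& (2^w - 2^n)) = fun i => (d i / 2^n) * 2^n := by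
      funext i; exact and_hi w n _ hn (hd i)
    rw [this, ← pk_mul, Nat.shiftRight_eq_div_pow, Nat.mul_div_cancel _ (by positivity)]
  · intro i
    have := Nat.two_pow_pos n
    have := Nat.pow_le_pow_right (show 0 < 2 by norm_num) hn
    omega

/-- acceptance test -/
theorem acc_spec (w K h : ℕ) (hw : h < w) (d : ℕ → ℕ) (hd : ∀ i, d i < 2^w)
    (H : Nat.land (pk w d K) (mcst w K (2^h)) = mcst w K (2^h)) : ∀ i, i < K → 2^h ≤ d i := by
  have H : pk w d K &&& mcst w K (2^h) = mcst w K (2^h) := H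
  have h2 : 2^h < 2^w := Nat.pow_lt_pow_right (by norm_num) hw
  rw [mcst_eq _ _ _ (by omega), pk_and w K _ _ hd (fun _ => h2)] at H
  intro i hi
  have := pk_inj w K _ _ (fun i => lt_of_le_of_lt Nat.and_le_left (hd i)) (fun _ => h2) H i hi
  rw [← this]; exact Nat.and_le_left
end Kiss

namespace Kiss
open Finset

theorem Df_cast (s b : ℕ) (t : ℕ) : ∀ (c : ℕ → ℕ) (j : ℕ),
    (((Df s)^[t] c (b + s*j) : ℕ) : ℝ) = ((Df 1)^[t] (fun j => (c (b + s*j) : ℝ))) j := by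
  induction t with
  | zero => intro c j; rfl
  | succ t ih =>
    intro c j
    rw [Function.iterate_succ_apply, ih, Function.iterate_succ_apply]
    have e : (fun j => ((Df s c (b+s*j):ℕ):ℝ)) = Df 1 (fun j => (c (b+s*j):ℝ)) := by
      funext j; simp only [Df]; push_cast; rw [show b+s*(j+1)=b+s*j+s by ring]
    rw [e]

theorem Df_le (s : ℕ) (t : ℕ) : ∀ (B : ℕ) (c : ℕ → ℕ), (∀ i, c i ≤ B) → ∀ i, (Df s)^[t] c i ≤ B * 2^t := by
  induction t with
  | zero => intro B c h i; simpa using h i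
  | succ t ih =>
    intro B c h i
    rw [Function.iterate_succ_apply]
    have h2 : ∀ i, Df s c i ≤ 2*B := by intro i; have := h i; have := h (i+s); simp only [Df]; omega
    have := ih (2*B) _ h2 i
    rw [pow_succ]; linarith [this, show 2*B*2^t = B*(2^t*2) by ring]

theorem dL_le (n s B : ℕ) (c : ℕ → ℕ) (h : ∀ i, c i ≤ B) (i : ℕ) : dL n s c i ≤ B * 2^n := by
  unfold dL
  have hm : (i/s) % (n+1) < n+1 := Nat.mod_lt _ (by omega)
  generalize (i/s) % (n+1) = j at *
  calc _ ≤ (B * 2^j) * 2^(n-j) := Nat.mul_le_mul_right _ (Df_le s j B c h _)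
    _ = B * 2^n := by rw [mul_assoc, ← pow_add]; congr 2; omega

theorem dR_le (n s B : ℕ) (c : ℕ → ℕ) (h : ∀ i, c i ≤ B) (i : ℕ) : dR n s c i ≤ B * 2^n := by
  unfold dR
  have hm : (i/s) % (n+1) < n+1 := Nat.mod_lt _ (by omega)
  generalize (i/s) % (n+1) = j at *
  calc _ ≤ (B * 2^(n-j)) * 2^j := Nat.mul_le_mul_right _ (Df_le s (n-j) B c h _)
    _ = B * 2^n := by rw [mul_assoc, ← pow_add]; congr 2; omega

theorem idx (n s b j : ℕ) (hs : 0 < s) (hb : (b/s) % (n+1) = 0) (hj : j ≤ n) : ((b + s*j)/s) % (n+1) = j := by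
  rw [Nat.add_mul_div_left _ _ hs]
  obtain ⟨q, hq⟩ := Nat.dvd_of_mod_eq_zero hb
  rw [hq, Nat.mul_add_mod, Nat.mod_eq_of_lt (by omega)]

theorem dL_bz (n s b : ℕ) (hs : 0 < s) (hb : (b/s) % (n+1) = 0) (c : ℕ → ℕ) (a : ℝ) (h0 : 0 ≤ a) (h1 : a ≤ 1) :
    bz n (fun j => ((dL n s c (b + s*j) / 2^n : ℕ) : ℝ)) a ≤ bz n (fun j => (c (b + s*j) : ℝ)) (a/2) := by
  have h2 : (0:ℝ) < 2^n := by positivity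
  rw [← mul_le_mul_iff_right₀ h2, bz_left, ← bz_smul]
  apply bz_mono n _ _ a h0 h1
  intro j hj
  have e : ((dL n s c (b+s*j) : ℕ) : ℝ) = 2^(n-j) * ((Df 1)^[j] (fun j => (c (b + s*j) : ℝ))) 0 := by
    unfold dL
    rw [idx n s b j hs hb hj, Nat.add_sub_cancel, ← Df_cast]
    push_cast; simp [mul_comm]
  rw [← e]
  have := @Nat.cast_div_le ℝ _ _ _ (dL n s c (b+s*j)) (2^n)
  push_cast at this
  calc _ ≤ (2:ℝ)^n * ((dL n s c (b+s*j) : ℝ) / 2^n) := by gcongr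
    _ = _ := by field_simp

theorem dR_bz (n s b : ℕ) (hs : 0 < s) (hb : (b/s) % (n+1) = 0) (c : ℕ → ℕ) (a : ℝ) (h0 : 0 ≤ a) (h1 : a ≤ 1) :
    bz n (fun j => ((dR n s c (b + s*j) / 2^n : ℕ) : ℝ)) a ≤ bz n (fun j => (c (b + s*j) : ℝ)) ((1+a)/2) := by
  have h2 : (0:ℝ) < 2^n := by positivity
  rw [← mul_le_mul_iff_right₀ h2, bz_right, ← bz_smul]
  apply bz_mono n _ _ a h0 h1
  intro j hj
  have e : ((dR n s c (b+s*j) : ℕ) : ℝ) = 2^j * ((Df 1)^[n-j] (fun j => (c (b + s*j) : ℝ))) j := by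
    unfold dR
    rw [idx n s b j hs hb hj, ← Df_cast]
    push_cast; simp [mul_comm]
  rw [← e]
  have := @Nat.cast_div_le ℝ _ _ _ (dR n s c (b+s*j)) (2^n)
  push_cast at this
  calc _ ≤ (2:ℝ)^n * ((dR n s c (b+s*j) : ℝ) / 2^n) := by gcongr
    _ = _ := by field_simp

def cL (w n s o V : ℕ) : ℕ := flr n (mcst w (s*(n+1)*o) (Nat.sub (Nat.pow 2 w) (Nat.pow 2 n))) (spL w n s o V)
def cR (w n s o V : ℕ) : ℕ := flr n (mcst w (s*(n+1)*o) (Nat.sub (Nat.pow 2 w) (Nat.pow 2 n))) (spR w n s o V)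

structure Dig (w n K B V : ℕ) (c : ℕ → ℕ) : Prop where
  eq : V = pk w c K
  le : ∀ i, c i ≤ B
  z : ∀ i, K ≤ i → c i = 0

theorem dig_gen (w n s o B V V': ℕ) (hw : 0 < w) (hB : B * 2^n < 2^w) (hn : n ≤ w) (d : ℕ → ℕ) (hd : ∀ i, d i ≤ B * 2^n)
    (h : V = pk w d (s*(n+1)*o)) (h' : V' = flr n (mcst w (s*(n+1)*o) (Nat.sub (Nat.pow 2 w) (Nat.pow 2 n))) V) :
    Dig w n (s*(n+1)*o) B V' (fun i => if i < s*(n+1)*o then d i / 2^n else 0) := by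
  refine ⟨?_, ?_, ?_⟩
  · rw [h', h]
    refine (flr_spec w n _ hw hn _ (fun i => lt_of_le_of_lt (hd i) hB)).trans ?_
    apply pk_congr; intro i hi; simp [hi]
  · intro i; split_ifs
    · apply Nat.div_le_of_le_mul; rw [mul_comm]; exact hd i
    · exact Nat.zero_le _
  · intro i hi; rw [if_neg (by omega)]

theorem dig_L (w n s o B V : ℕ) (hw : 0 < w) (hs : 0 < s) (hB : B * 2^n < 2^w) (hn : n ≤ w) (c : ℕ → ℕ) (h : Dig w n (s*(n+1)*o) B V c) :
    Dig w n (s*(n+1)*o) B (cL w n s o V) (fun i => if i < s*(n+1)*o then dL n s c i / 2^n else 0) :=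
  dig_gen w n s o B (spL w n s o V) _ hw hB hn _ (dL_le n s B c h.le) (by rw [h.eq]; exact spL_spec w n s o hw hs c B h.le hB h.z) rfl

theorem dig_R (w n s o B V : ℕ) (hw : 0 < w) (hs : 0 < s) (hB : B * 2^n < 2^w) (hn : n ≤ w) (c : ℕ → ℕ) (h : Dig w n (s*(n+1)*o) B V c) :
    Dig w n (s*(n+1)*o) B (cR w n s o V) (fun i => if i < s*(n+1)*o then dR n s c i / 2^n else 0) :=
  dig_gen w n s o B (spR w n s o V) _ hw hB hn _ (dR_le n s B c h.le) (by rw [h.eq]; exact spR_spec w n s o hw hs c B h.le hB h.z) rfl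

/-! three variables -/
noncomputable def E3 (c : ℕ → ℕ) (x y z : ℝ) : ℝ :=
  bz 16 (fun k => bz 16 (fun j => bz 16 (fun i => (c (i+17*j+289*k) : ℝ)) x) y) z

theorem E3_y (c : ℕ → ℕ) (x y z : ℝ) :
    E3 c x y z = bz 16 (fun k => bz 16 (fun i => bz 16 (fun j => (c (i+289*k+17*j) : ℝ)) y) x) z := by
  unfold E3
  apply bz_congr; intro k _
  rw [bz_swap]
  apply bz_congr; intro i _
  apply bz_congr; intro j _
  rw [add_right_comm]

theorem E3_z (c : ℕ → ℕ) (x y z : ℝ) :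
    E3 c x y z = bz 16 (fun j => bz 16 (fun i => bz 16 (fun k => (c (i+17*j+289*k) : ℝ)) z) x) y := by
  unfold E3
  rw [bz_swap]
  apply bz_congr; intro j _
  rw [bz_swap]

theorem E3_x (c : ℕ → ℕ) (x y z : ℝ) :
    E3 c x y z = bz 16 (fun k => bz 16 (fun j => bz 16 (fun i => (c (17*j+289*k+1*i) : ℝ)) x) y) z := by
  unfold E3
  apply bz_congr; intro k _
  apply bz_congr; intro j _
  apply bz_congr; intro i _
  congr 2; ring

structure St where
  V : ℕ
  p : ℕ
  l : ℕ
  q : ℕ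
  m : ℕ
  r : ℕ
  k : ℕ

def stp (w : ℕ) : ℕ → St → St
  | 0, s => ⟨cL w 16 1 289 s.V, Nat.mul 2 s.p, Nat.succ s.l, s.q, s.m, s.r, s.k⟩
  | 1, s => ⟨cR w 16 1 289 s.V, Nat.succ (Nat.mul 2 s.p), Nat.succ s.l, s.q, s.m, s.r, s.k⟩
  | 2, s => ⟨cL w 16 17 17 s.V, s.p, s.l, Nat.mul 2 s.q, Nat.succ s.m, s.r, s.k⟩
  | 3, s => ⟨cR w 16 17 17 s.V, s.p, s.l, Nat.succ (Nat.mul 2 s.q), Nat.succ s.m, s.r, s.k⟩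
  | 4, s => ⟨cL w 16 289 1 s.V, s.p, s.l, s.q, s.m, Nat.mul 2 s.r, Nat.succ s.k⟩
  | _, s => ⟨cR w 16 289 1 s.V, s.p, s.l, s.q, s.m, Nat.succ (Nat.mul 2 s.r), Nat.succ s.k⟩

structure Val (w B : ℕ) (F : ℝ → ℝ → ℝ → ℝ) (s : St) : Prop where
  ex : ∃ c, Dig w 16 4913 B s.V c ∧ ∀ x y z : ℝ, 0 ≤ x → x ≤ 1 → 0 ≤ y → y ≤ 1 → 0 ≤ z → z ≤ 1 →
    E3 c x y z ≤ F ((s.p + x)/2^s.l) ((s.q + y)/2^s.m) ((s.r + z)/2^s.k)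

theorem halfL (p l : ℕ) (x : ℝ) : (((Nat.mul 2 p : ℕ) : ℝ) + x)/2^(Nat.succ l) = (p + x/2)/2^l := by
  have : ((Nat.mul 2 p : ℕ) : ℝ) = 2 * p := by show ((2*p:ℕ):ℝ) = _; push_cast; ring
  rw [this, pow_succ]; field_simp
theorem halfR (p l : ℕ) (x : ℝ) : (((Nat.succ (Nat.mul 2 p) : ℕ) : ℝ) + x)/2^(Nat.succ l) = (p + (1+x)/2)/2^l := by
  have : ((Nat.succ (Nat.mul 2 p) : ℕ) : ℝ) = 2 * p + 1 := by show ((2*p+1:ℕ):ℝ) = _; push_cast; ring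
  rw [this, pow_succ]; field_simp; ring

theorem bz_le (n : ℕ) (g h : ℕ → ℝ) (a b : ℝ) (h0 : 0 ≤ a) (h1 : a ≤ 1) (H : ∀ j, j ≤ n → g j ≤ h j) : bz n g a ≤ bz n h a :=
  bz_mono n g h a h0 h1 H

theorem Val.step {w B : ℕ} {F : ℝ → ℝ → ℝ → ℝ} {s : St} (hw : 16 ≤ w) (hB : B * 2^16 < 2^w) (h : Val w B F s) (d : ℕ) : Val w B F (stp w d s) := by
  obtain ⟨c, hc, hF⟩ := h.ex
  have hw0 : 0 < w := by omega
  match d with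
  | 0 =>
    refine ⟨_, dig_L w 16 1 289 B s.V hw0 (by norm_num) hB hw c hc, ?_⟩
    intro x y z hx hx1 hy hy1 hz hz1
    simp only [stp]
    rw [halfL]
    refine le_trans ?_ (hF (x/2) y z (by linarith) (by linarith) hy hy1 hz hz1)
    rw [E3_x, E3_x]
    refine bz_mono _ _ _ _ hz hz1 (fun k hk => bz_mono _ _ _ _ hy hy1 (fun j hj => ?_))
    refine le_trans (le_of_eq ?_) (dL_bz 16 1 (17*j+289*k) (by norm_num) (by omega) c x hx hx1)
    apply bz_congr; intro i hi; rw [if_pos (by omega)]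
  | 1 =>
    refine ⟨_, dig_R w 16 1 289 B s.V hw0 (by norm_num) hB hw c hc, ?_⟩
    intro x y z hx hx1 hy hy1 hz hz1
    simp only [stp]
    rw [halfR]
    refine le_trans ?_ (hF ((1+x)/2) y z (by linarith) (by linarith) hy hy1 hz hz1)
    rw [E3_x, E3_x]
    refine bz_mono _ _ _ _ hz hz1 (fun k hk => bz_mono _ _ _ _ hy hy1 (fun j hj => ?_))
    refine le_trans (le_of_eq ?_) (dR_bz 16 1 (17*j+289*k) (by norm_num) (by omega) c x hx hx1)
    apply bz_congr; intro i hi; rw [if_pos (by omega)]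
  | 2 =>
    refine ⟨_, dig_L w 16 17 17 B s.V hw0 (by norm_num) hB hw c hc, ?_⟩
    intro x y z hx hx1 hy hy1 hz hz1
    simp only [stp]
    rw [halfL]
    refine le_trans ?_ (hF x (y/2) z hx hx1 (by linarith) (by linarith) hz hz1)
    rw [E3_y, E3_y]
    refine bz_mono _ _ _ _ hz hz1 (fun k hk => bz_mono _ _ _ _ hx hx1 (fun j hj => ?_))
    refine le_trans (le_of_eq ?_) (dL_bz 16 17 (j+289*k) (by norm_num) (by omega) c y hy hy1)
    apply bz_congr; intro i hi; rw [if_pos (by omega)]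
  | 3 =>
    refine ⟨_, dig_R w 16 17 17 B s.V hw0 (by norm_num) hB hw c hc, ?_⟩
    intro x y z hx hx1 hy hy1 hz hz1
    simp only [stp]
    rw [halfR]
    refine le_trans ?_ (hF x ((1+y)/2) z hx hx1 (by linarith) (by linarith) hz hz1)
    rw [E3_y, E3_y]
    refine bz_mono _ _ _ _ hz hz1 (fun k hk => bz_mono _ _ _ _ hx hx1 (fun j hj => ?_))
    refine le_trans (le_of_eq ?_) (dR_bz 16 17 (j+289*k) (by norm_num) (by omega) c y hy hy1)
    apply bz_congr; intro i hi; rw [if_pos (by omega)]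
  | 4 =>
    refine ⟨_, dig_L w 16 289 1 B s.V hw0 (by norm_num) hB hw c hc, ?_⟩
    intro x y z hx hx1 hy hy1 hz hz1
    simp only [stp]
    rw [halfL]
    refine le_trans ?_ (hF x y (z/2) hx hx1 hy hy1 (by linarith) (by linarith))
    rw [E3_z, E3_z]
    refine bz_mono _ _ _ _ hy hy1 (fun k hk => bz_mono _ _ _ _ hx hx1 (fun j hj => ?_))
    refine le_trans (le_of_eq ?_) (dL_bz 16 289 (j+17*k) (by norm_num) (by omega) c z hz hz1)
    apply bz_congr; intro i hi; rw [if_pos (by omega)]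
  | (e+5) =>
    refine ⟨_, dig_R w 16 289 1 B s.V hw0 (by norm_num) hB hw c hc, ?_⟩
    intro x y z hx hx1 hy hy1 hz hz1
    simp only [stp]
    rw [halfR]
    refine le_trans ?_ (hF x y ((1+z)/2) hx hx1 hy hy1 (by linarith) (by linarith))
    rw [E3_z, E3_z]
    refine bz_mono _ _ _ _ hy hy1 (fun k hk => bz_mono _ _ _ _ hx hx1 (fun j hj => ?_))
    refine le_trans (le_of_eq ?_) (dR_bz 16 289 (j+17*k) (by norm_num) (by omega) c z hz hz1)
    apply bz_congr; intro i hi; rw [if_pos (by omega)]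

/-- interval membership, half open -/
def Inn (p l : ℕ) (a : ℝ) : Prop := (p = 0 ∨ (p:ℝ)/2^l < a) ∧ 0 ≤ a ∧ a ≤ (p+1)/2^l

theorem Inn.split {p l : ℕ} {a : ℝ} (h : Inn p l a) : Inn (Nat.mul 2 p) (Nat.succ l) a ∨ Inn (Nat.succ (Nat.mul 2 p)) (Nat.succ l) a := by
  obtain ⟨h1, h2, h3⟩ := h
  have e0 : ((Nat.mul 2 p : ℕ) : ℝ)/2^(Nat.succ l) = p/2^l := by have := halfL p l 0; simpa using this
  have e1 := halfL p l 1
  have e2 : ((Nat.succ (Nat.mul 2 p) : ℕ) : ℝ)/2^(Nat.succ l) = (p+1/2)/2^l := by have := halfR p l 0; simpa using this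
  have e3 : (((Nat.succ (Nat.mul 2 p) : ℕ) : ℝ)+1)/2^(Nat.succ l) = (p+1)/2^l := by have := halfR p l 1; rw [this]; norm_num
  by_cases h : a ≤ (p+1/2)/2^l
  · left
    refine ⟨?_, h2, ?_⟩
    · rcases h1 with h1 | h1
      · left; rw [h1]
      · right; rw [e0]; exact h1
    · rw [e1]; exact h
  · right
    refine ⟨Or.inr ?_, h2, ?_⟩
    · rw [e2]; exact not_le.1 h
    · rw [e3]; exact h3

theorem Inn.par {p l : ℕ} {a : ℝ} (h : Inn p l a) : ∃ x, 0 ≤ x ∧ x ≤ 1 ∧ a = (p+x)/2^l := by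
  obtain ⟨h1, h2, h3⟩ := h
  have hp : (0:ℝ) < 2^l := by positivity
  refine ⟨a*2^l - p, ?_, ?_, ?_⟩
  · rcases h1 with h1 | h1
    · rw [h1]; simp ; positivity
    · rw [div_lt_iff₀ hp] at h1; linarith
  · rw [le_div_iff₀ hp] at h3; linarith
  · field_simp; ring

noncomputable def cc (a : ℝ) : ℝ := -1 + 3*a/2
noncomputable def DD (u v t : ℝ) : ℝ := 1 + 2*u*v*t - u^2 - v^2 - t^2

def Cov (h : ℕ) (F : ℝ → ℝ → ℝ → ℝ) (s : St) : Prop :=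
  ∀ a b c, Inn s.p s.l a → Inn s.q s.m b → Inn s.r s.k c → a ≤ b → b ≤ c → 0 ≤ DD (cc a) (cc b) (cc c) → 2^h ≤ F a b c

theorem cov_x {w h : ℕ} {F : ℝ → ℝ → ℝ → ℝ} {s : St} (h0 : Cov h F (stp w 0 s)) (h1 : Cov h F (stp w 1 s)) : Cov h F s := by
  intro a b c ha hb hc h2 h3 h4
  rcases ha.split with ha | ha
  · exact h0 a b c ha hb hc h2 h3 h4
  · exact h1 a b c ha hb hc h2 h3 h4
theorem cov_y {w h : ℕ} {F : ℝ → ℝ → ℝ → ℝ} {s : St} (h0 : Cov h F (stp w 2 s)) (h1 : Cov h F (stp w 3 s)) : Cov h F s := by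
  intro a b c ha hb hc h2 h3 h4
  rcases hb.split with hb | hb
  · exact h0 a b c ha hb hc h2 h3 h4
  · exact h1 a b c ha hb hc h2 h3 h4
theorem cov_z {w h : ℕ} {F : ℝ → ℝ → ℝ → ℝ} {s : St} (h0 : Cov h F (stp w 4 s)) (h1 : Cov h F (stp w 5 s)) : Cov h F s := by
  intro a b c ha hb hc h2 h3 h4
  rcases hc.split with hc | hc
  · exact h0 a b c ha hb hc h2 h3 h4
  · exact h1 a b c ha hb hc h2 h3 h4

inductive T
  | P | S | D
  | X (l r : T) | Y (l r : T) | Z (l r : T)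

def sy (p l q m : ℕ) : Bool := Nat.ble (Nat.mul (Nat.succ q) (Nat.pow 2 l)) (Nat.mul p (Nat.pow 2 m))

theorem sy_spec {p l q m : ℕ} {a b : ℝ} (h : sy p l q m = true) (ha : Inn p l a) (hb : Inn q m b) : b < a := by
  have h : (q+1) * 2^l ≤ p * 2^m := Nat.le_of_ble_eq_true h
  obtain ⟨h1, -, -⟩ := ha
  obtain ⟨-, -, h2⟩ := hb
  rcases h1 with h1 | h1
  · rw [h1] at h
    have : 0 < (q+1) * 2^l := by positivity
    omega
  · have h' : ((q:ℝ)+1) * 2^l ≤ p * 2^m := by exact_mod_cast h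
    have : ((q:ℝ)+1)/2^m ≤ p/2^l := by
      rw [div_le_div_iff₀ (by positivity) (by positivity)]; exact h'
    linarith

def crn (Q R S m n o U V W : ℤ) : ℤ :=
  4*Q^2*R^2*S^2 + 8*U*V*W*Q*R*S + (m^2-4*U*m)*R^2*S^2 + (n^2-4*V*n)*Q^2*S^2 + (o^2-4*W*o)*Q^2*R^2

def ltz : ℤ → Bool
  | Int.ofNat _ => false
  | Int.negSucc _ => true

def dt (Q R S u v t : ℤ) : Bool :=
  let f := crn Q R S (2*u+3) (2*v+3) (2*t+3)
  ltz (f u v t) && ltz (f u v (t+3)) && ltz (f u (v+3) t) && ltz (f u (v+3) (t+3)) &&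
  ltz (f (u+3) v t) && ltz (f (u+3) v (t+3)) && ltz (f (u+3) (v+3) t) && ltz (f (u+3) (v+3) (t+3))

def dtt (p l q m r k : ℕ) : Bool :=
  dt (2^(l+1)) (2^(m+1)) (2^(k+1)) (3*p - 2^(l+1)) (3*q - 2^(m+1)) (3*r - 2^(k+1))

theorem ltz_spec {z : ℤ} (h : ltz z = true) : z < 0 := by
  cases z with
  | ofNat n => simp [ltz] at h
  | negSucc n => exact Int.negSucc_lt_zero n

theorem aff {A B lo hi x : ℝ} (h1 : A + B*lo < 0) (h2 : A + B*hi < 0) (hx : lo ≤ x) (hx' : x ≤ hi) : A + B*x < 0 := by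
  rcases le_total 0 B with h | h
  · nlinarith
  · nlinarith

noncomputable def crnR (Q R S m n o U V W : ℝ) : ℝ :=
  4*Q^2*R^2*S^2 + 8*U*V*W*Q*R*S + (m^2-4*U*m)*R^2*S^2 + (n^2-4*V*n)*Q^2*S^2 + (o^2-4*W*o)*Q^2*R^2

theorem crn_cast (Q R S m n o U V W : ℤ) : ((crn Q R S m n o U V W : ℤ) : ℝ) = crnR Q R S m n o U V W := by
  unfold crn crnR; push_cast; ring

theorem crn1 {Q R S m n o V W lo hi x : ℝ} (h1 : crnR Q R S m n o lo V W < 0) (h2 : crnR Q R S m n o hi V W < 0) (hx : lo ≤ x) (hx' : x ≤ hi) :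
    crnR Q R S m n o x V W < 0 := by
  have e : ∀ x, crnR Q R S m n o x V W = (4*Q^2*R^2*S^2 + m^2*R^2*S^2 + (n^2-4*V*n)*Q^2*S^2 + (o^2-4*W*o)*Q^2*R^2) + (8*V*W*Q*R*S - 4*m*R^2*S^2) * x := by
    intro x; unfold crnR; ring
  rw [e] at *
  exact aff h1 h2 hx hx'
theorem crn2 {Q R S m n o V W lo hi x : ℝ} (h1 : crnR Q R S m n o V lo W < 0) (h2 : crnR Q R S m n o V hi W < 0) (hx : lo ≤ x) (hx' : x ≤ hi) :
    crnR Q R S m n o V x W < 0 := by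
  have e : ∀ x, crnR Q R S m n o V x W = (4*Q^2*R^2*S^2 + n^2*Q^2*S^2 + (m^2-4*V*m)*R^2*S^2 + (o^2-4*W*o)*Q^2*R^2) + (8*V*W*Q*R*S - 4*n*Q^2*S^2) * x := by
    intro x; unfold crnR; ring
  rw [e] at *
  exact aff h1 h2 hx hx'
theorem crn3 {Q R S m n o V W lo hi x : ℝ} (h1 : crnR Q R S m n o V W lo < 0) (h2 : crnR Q R S m n o V W hi < 0) (hx : lo ≤ x) (hx' : x ≤ hi) :
    crnR Q R S m n o V W x < 0 := by
  have e : ∀ x, crnR Q R S m n o V W x = (4*Q^2*R^2*S^2 + o^2*Q^2*R^2 + (m^2-4*V*m)*R^2*S^2 + (n^2-4*W*n)*Q^2*S^2) + (8*V*W*Q*R*S - 4*o*Q^2*R^2) * x := by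
    intro x; unfold crnR; ring
  rw [e] at *
  exact aff h1 h2 hx hx'

theorem Inn.cc {p l : ℕ} {a : ℝ} (h : Inn p l a) : ∃ U : ℝ, ((3*p - 2^(l+1) : ℤ) : ℝ) ≤ U ∧ U ≤ (((3*p - 2^(l+1) : ℤ)+3 : ℤ) : ℝ) ∧ U = Kiss.cc a * ((2^(l+1) : ℤ) : ℝ) := by
  obtain ⟨x, h0, h1, rfl⟩ := h.par
  refine ⟨_, ?_, ?_, rfl⟩ <;>
  · unfold Kiss.cc; push_cast; rw [pow_succ]
    have : (2:ℝ)^l > 0 := by positivity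
    field_simp
    nlinarith

theorem dtt_spec {p l q m r k : ℕ} {a b c : ℝ} (h : dtt p l q m r k = true) (ha : Inn p l a) (hb : Inn q m b) (hc : Inn r k c) :
    DD (cc a) (cc b) (cc c) < 0 := by
  obtain ⟨U, hU1, hU2, hU⟩ := ha.cc
  obtain ⟨V, hV1, hV2, hV⟩ := hb.cc
  obtain ⟨W, hW1, hW2, hW⟩ := hc.cc
  unfold dtt at h
  have hQ : (0:ℝ) < ((2^(l+1) : ℤ) : ℝ) := by positivity
  have hR : (0:ℝ) < ((2^(m+1) : ℤ) : ℝ) := by positivity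
  have hS : (0:ℝ) < ((2^(k+1) : ℤ) : ℝ) := by positivity
  generalize (2^(l+1) : ℤ) = Q at *
  generalize (2^(m+1) : ℤ) = R at *
  generalize (2^(k+1) : ℤ) = S at *
  generalize (3*p - Q : ℤ) = u at *
  generalize (3*q - R : ℤ) = v at *
  generalize (3*r - S : ℤ) = t at *
  simp only [dt, Bool.and_eq_true] at h
  obtain ⟨⟨⟨⟨⟨⟨⟨g1, g2⟩, g3⟩, g4⟩, g5⟩, g6⟩, g7⟩, g8⟩ := h
  have key : ∀ {U V W : ℤ}, ltz (crn Q R S (2*u+3) (2*v+3) (2*t+3) U V W) = true → crnR Q R S ((2*u+3 : ℤ) : ℝ) ((2*v+3 : ℤ):ℝ) ((2*t+3 : ℤ):ℝ) U V W < 0 := by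
    intro U V W h
    rw [← crn_cast]; exact_mod_cast ltz_spec h
  have f := crn1 (crn2 (crn3 (key g1) (key g2) hW1 hW2) (crn3 (key g3) (key g4) hW1 hW2) hV1 hV2)
    (crn2 (crn3 (key g5) (key g6) hW1 hW2) (crn3 (key g7) (key g8) hW1 hW2) hV1 hV2) hU1 hU2
  generalize ((2*u+3 : ℤ) : ℝ) = m' at *
  generalize ((2*v+3 : ℤ) : ℝ) = n' at *
  generalize ((2*t+3 : ℤ) : ℝ) = o' at *
  generalize (Q:ℝ) = Q' at *
  generalize (R:ℝ) = R' at *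
  generalize (S:ℝ) = S' at *
  have i1 : 0 ≤ (2*U-m')^2 * (R'^2*S'^2) := by positivity
  have i2 : 0 ≤ (2*V-n')^2 * (Q'^2*S'^2) := by positivity
  have i3 : 0 ≤ (2*W-o')^2 * (Q'^2*R'^2) := by positivity
  have e : 4*Q'^2*R'^2*S'^2 * DD (cc a) (cc b) (cc c) = crnR Q' R' S' m' n' o' U V W - (2*U-m')^2 * (R'^2*S'^2) - (2*V-n')^2 * (Q'^2*S'^2) - (2*W-o')^2 * (Q'^2*R'^2) := by
    rw [hU, hV, hW]; unfold DD crnR; ring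
  have : 4*Q'^2*R'^2*S'^2 * DD (cc a) (cc b) (cc c) < 0 := by rw [e]; linarith
  by_contra hh
  have : 0 ≤ 4*Q'^2*R'^2*S'^2 * DD (cc a) (cc b) (cc c) := mul_nonneg (by positivity) (not_lt.1 hh)
  linarith

def ok (w mh : ℕ) : T → St → Bool
  | T.P, s => Nat.beq (Nat.land s.V mh) mh
  | T.S, s => or (sy s.p s.l s.q s.m) (sy s.q s.m s.r s.k)
  | T.D, s => dtt s.p s.l s.q s.m s.r s.k
  | T.X l r, s => and (ok w mh l (stp w 0 s)) (ok w mh r (stp w 1 s))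
  | T.Y l r, s => and (ok w mh l (stp w 2 s)) (ok w mh r (stp w 3 s))
  | T.Z l r, s => and (ok w mh l (stp w 4 s)) (ok w mh r (stp w 5 s))

theorem ok_spec {w h B : ℕ} {F : ℝ → ℝ → ℝ → ℝ} (hw : 16 ≤ w) (hh : h < w) (hB : B * 2^16 < 2^w) (t : T) :
    ∀ s : St, Val w B F s → ok w (mcst w 4913 (Nat.pow 2 h)) t s = true → Cov h F s := by
  have hB2 : B < 2^w := by omega
  induction t with
  | P =>
    intro s hv ho a b c ha hb hc _ _ _
    obtain ⟨d, hd, hF⟩ := hv.ex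
    obtain ⟨x, hx0, hx1, rfl⟩ := ha.par
    obtain ⟨y, hy0, hy1, rfl⟩ := hb.par
    obtain ⟨z, hz0, hz1, rfl⟩ := hc.par
    refine le_trans ?_ (hF x y z hx0 hx1 hy0 hy1 hz0 hz1)
    have H := Nat.eq_of_beq_eq_true ho
    rw [hd.eq] at H
    have := acc_spec w 4913 h hh d (fun i => lt_of_le_of_lt (hd.le i) hB2) H
    rw [← bz_const 16 (2^h) z]
    unfold E3
    refine bz_mono _ _ _ _ hz0 hz1 (fun k hk => ?_)
    rw [← bz_const 16 (2^h) y]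
    refine bz_mono _ _ _ _ hy0 hy1 (fun j hj => ?_)
    rw [← bz_const 16 (2^h) x]
    refine bz_mono _ _ _ _ hx0 hx1 (fun i hi => ?_)
    exact_mod_cast this (i+17*j+289*k) (by omega)
  | S =>
    intro s hv ho a b c ha hb hc h1 h2 _
    exfalso
    simp only [ok, Bool.or_eq_true] at ho
    rcases ho with ho | ho
    · have := sy_spec ho ha hb; linarith
    · have := sy_spec ho hb hc; linarith
  | D =>
    intro s hv ho a b c ha hb hc h1 h2 h3
    exfalso
    have := dtt_spec ho ha hb hc
    linarith
  | X l r ihl ihr =>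
    intro s hv ho
    simp only [ok, Bool.and_eq_true] at ho
    exact cov_x (ihl _ (hv.step hw hB 0) ho.1) (ihr _ (hv.step hw hB 1) ho.2)
  | Y l r ihl ihr =>
    intro s hv ho
    simp only [ok, Bool.and_eq_true] at ho
    exact cov_y (ihl _ (hv.step hw hB 2) ho.1) (ihr _ (hv.step hw hB 3) ho.2)
  | Z l r ihl ihr =>
    intro s hv ho
    simp only [ok, Bool.and_eq_true] at ho
    exact cov_z (ihl _ (hv.step hw hB 4) ho.1) (ihr _ (hv.step hw hB 5) ho.2)
end Kiss

namespace Kiss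
open Finset

/-! generic evaluation -/
def hor {α : Type} (ad mu : α → α → α) (C : ℤ → α) (X : α) : List ℤ → α
  | [] => C 0
  | c :: l => ad (C c) (mu X (hor ad mu C X l))
def sm {α : Type} (ad : α → α → α) (C : ℤ → α) (f : ℕ → α) : ℕ → α
  | 0 => C 0
  | n+1 => ad (sm ad C f n) (f n)
def pw {α : Type} (mu : α → α → α) (C : ℤ → α) (x : α) : ℕ → α
  | 0 => C 1
  | n+1 => mu (pw mu C x n) x
def gp {α : Type} (ad mu : α → α → α) (C : ℤ → α) (m : ℕ) (x w : α) : ℕ → α × α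
  | 0 => (C 1, mu (C m) x)
  | k+1 => ((gp ad mu C m x w k).2, ad (mu (C (2*k+m+2)) (mu x (gp ad mu C m x w k).2)) (mu (C (-((k+1)*(k+m)))) (mu w (gp ad mu C m x w k).1)))

structure Dat where
  row : ℕ → ℕ → List ℤ
  tau : ℕ → ℕ
  A : ℕ → ℕ
  ep : ℕ → ℤ

def Yg (D : Dat) {α : Type} (ad mu : α → α → α) (C : ℤ → α) (X Y Z : α) : α :=
  sm ad C (fun k => mu (mu (C (D.tau k)) (mu (pw mu C (ad (C 1) Z) (16-k))
      (sm ad C (fun r => mu (hor ad mu C X (D.row k r)) (hor ad mu C Y (D.row k r))) 17)))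
    (gp ad mu C 17
      (ad (mu (mu (C 2) (ad Z (C (-2)))) (mu (ad (C 1) X) (ad (C 1) Y)))
        (mu (C (-1)) (mu (mu (ad X (C (-2))) (ad Y (C (-2)))) (ad (C 1) Z))))
      (mu (mu (C 9) (mu (mu X (ad X (C 4))) (mu Y (ad Y (C 4))))) (mu (ad (C 1) Z) (ad (C 1) Z))) k).1) 17

def Wg (D : Dat) (OF : ℤ) {α : Type} (ad mu : α → α → α) (C : ℤ → α) (X Y Z : α) : α :=
  ad (mu (C OF) (mu (pw mu C (ad (C 1) X) 16) (mu (pw mu C (ad (C 1) Y) 16) (pw mu C (ad (C 1) Z) 16))))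
    (mu (C (-1)) (ad (Yg D ad mu C X Y Z) (ad (Yg D ad mu C X Z Y) (Yg D ad mu C Y Z X))))

def Pg (D : Dat) (OF : ℤ) {α : Type} (ad mu : α → α → α) (C : ℤ → α) (X : α) : α :=
  ad (mu (C OF) (pw mu C (ad (C 1) X) 32)) (mu (C (-1))
   (ad (sm ad C (fun k => mu (mu (C (D.A k)) (pw mu C (mu (C 2) (ad (C 1) X)) (32-k)))
      (gp ad mu C 18 (ad X (C (-2))) (mu (C 4) (mu (ad (C 1) X) (ad (C 1) X))) k).1) 33)
   (ad (sm ad C (fun k => mu (mu (C (D.tau k * Nat.ascFactorial 17 k)) (pw mu C (mu (C 3) (mu X (ad X (C 4)))) k))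
      (sm ad C (fun r => mu (hor ad mu C X (D.row k r)) (hor ad mu C X (D.row k r))) 17)) 17)
    (mu (mu (C (2 * D.tau 0)) (pw mu C (ad (C 1) X) 16)) (sm ad C (fun r => mu (C (D.ep r)) (hor ad mu C X (D.row 0 r))) 17)))))

structure Par {α β : Type} (ad mu : α → α → α) (C : ℤ → α) (ad' mu' : β → β → β) (C' : ℤ → β) (Q : α → β → Prop) : Prop where
  a : ∀ {x y x' y'}, Q x x' → Q y y' → Q (ad x y) (ad' x' y')
  m : ∀ {x y x' y'}, Q x x' → Q y y' → Q (mu x y) (mu' x' y')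
  c : ∀ z, Q (C z) (C' z)

section
variable {α β : Type} {ad mu : α → α → α} {C : ℤ → α} {ad' mu' : β → β → β} {C' : ℤ → β} {Q : α → β → Prop}
  (P : Par ad mu C ad' mu' C' Q)
theorem Par.hor {P : Par ad mu C ad' mu' C' Q} {X : α} {X' : β} (h : Q X X') (l : List ℤ) : Q (hor ad mu C X l) (Kiss.hor ad' mu' C' X' l) := by
  induction l with
  | nil => exact P.c 0
  | cons c l ih => exact P.a (P.c c) (P.m h ih)
theorem Par.sm {P : Par ad mu C ad' mu' C' Q} {f : ℕ → α} {f' : ℕ → β} (h : ∀ i, Q (f i) (f' i)) (n : ℕ) : Q (sm ad C f n) (Kiss.sm ad' C' f' n) := by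
  induction n with
  | zero => exact P.c 0
  | succ n ih => exact P.a ih (h n)
theorem Par.pw {P : Par ad mu C ad' mu' C' Q} {x : α} {x' : β} (h : Q x x') (n : ℕ) : Q (pw mu C x n) (Kiss.pw mu' C' x' n) := by
  induction n with
  | zero => exact P.c 1
  | succ n ih => exact P.m ih h
theorem Par.gp {P : Par ad mu C ad' mu' C' Q} (m : ℕ) {x w : α} {x' w' : β} (h : Q x x') (hw : Q w w') (n : ℕ) :
    Q (gp ad mu C m x w n).1 (Kiss.gp ad' mu' C' m x' w' n).1 ∧ Q (Kiss.gp ad mu C m x w n).2 (Kiss.gp ad' mu' C' m x' w' n).2 := by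
  induction n with
  | zero => exact ⟨P.c 1, P.m (P.c _) h⟩
  | succ n ih => exact ⟨ih.2, P.a (P.m (P.c _) (P.m h ih.2)) (P.m (P.c _) (P.m hw ih.1))⟩
theorem Par.Yg (P : Par ad mu C ad' mu' C' Q) (D : Dat) {X Y Z : α} {X' Y' Z' : β} (hX : Q X X') (hY : Q Y Y') (hZ : Q Z Z') :
    Q (Yg D ad mu C X Y Z) (Kiss.Yg D ad' mu' C' X' Y' Z') := by
  refine Par.sm (P := P) (fun k => ?_) 17
  refine P.m (P.m (P.c _) (P.m (Par.pw (P := P) (P.a (P.c 1) hZ) _) (Par.sm (P := P) (fun r => P.m (Par.hor (P := P) hX _) (Par.hor (P := P) hY _)) _))) (Par.gp (P := P) 17 ?_ ?_ k).1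
  · exact P.a (P.m (P.m (P.c _) (P.a hZ (P.c _))) (P.m (P.a (P.c _) hX) (P.a (P.c _) hY))) (P.m (P.c _) (P.m (P.m (P.a hX (P.c _)) (P.a hY (P.c _))) (P.a (P.c _) hZ)))
  · exact P.m (P.m (P.c _) (P.m (P.m hX (P.a hX (P.c _))) (P.m hY (P.a hY (P.c _))))) (P.m (P.a (P.c _) hZ) (P.a (P.c _) hZ))
theorem Par.Wg (P : Par ad mu C ad' mu' C' Q) (D : Dat) (OF : ℤ) {X Y Z : α} {X' Y' Z' : β} (hX : Q X X') (hY : Q Y Y') (hZ : Q Z Z') :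
    Q (Wg D OF ad mu C X Y Z) (Kiss.Wg D OF ad' mu' C' X' Y' Z') := by
  refine P.a (P.m (P.c _) (P.m (Par.pw (P := P) (P.a (P.c _) hX) _) (P.m (Par.pw (P := P) (P.a (P.c _) hY) _) (Par.pw (P := P) (P.a (P.c _) hZ) _)))) (P.m (P.c _) ?_)
  exact P.a (P.Yg D hX hY hZ) (P.a (P.Yg D hX hZ hY) (P.Yg D hY hZ hX))
theorem Par.Pg (P : Par ad mu C ad' mu' C' Q) (D : Dat) (OF : ℤ) {X : α} {X' : β} (hX : Q X X') :
    Q (Pg D OF ad mu C X) (Kiss.Pg D OF ad' mu' C' X') := by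
  have h1 := P.a (P.c 1) hX
  refine P.a (P.m (P.c _) (Par.pw (P := P) h1 _)) (P.m (P.c _) (P.a ?_ (P.a ?_ ?_)))
  · refine Par.sm (P := P) (fun k => P.m (P.m (P.c _) (Par.pw (P := P) (P.m (P.c _) h1) _)) (Par.gp (P := P) 18 ?_ ?_ k).1) _
    · exact P.a hX (P.c _)
    · exact P.m (P.c _) (P.m h1 h1)
  · exact Par.sm (P := P) (fun k => P.m (P.m (P.c _) (Par.pw (P := P) (P.m (P.c _) (P.m hX (P.a hX (P.c _)))) _)) (Par.sm (P := P) (fun r => P.m (Par.hor (P := P) hX _) (Par.hor (P := P) hX _)) _)) _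
  · exact P.m (P.m (P.c _) (Par.pw (P := P) h1 _)) (Par.sm (P := P) (fun r => P.m (P.c _) (Par.hor (P := P) hX _)) _)
end

/-! polynomial decoding -/
abbrev PZ := MvPolynomial (Fin 3) ℤ
abbrev PN := MvPolynomial (Fin 3) ℕ
open MvPolynomial

theorem par_hom {R : Type} [CommRing R] (v : Fin 3 → R) :
    Par (α := PZ) (β := R) (· + ·) (· * ·) (fun z => C z) (· + ·) (· * ·) (fun z => (z : R)) (fun p x => eval₂ (Int.castRingHom R) v p = x) where
  a := by rintro x y _ _ rfl rfl; simp
  m := by rintro x y _ _ rfl rfl; simp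
  c := by intro z; exact (eval₂_C _ _ _)

theorem par_nat (v : Fin 3 → ℕ) :
    Par (α := PN) (β := ℕ) (· + ·) (· * ·) (fun z => C z.natAbs) Nat.add Nat.mul Int.natAbs (fun p x => eval v p = x) where
  a := by rintro x y _ _ rfl rfl; simp
  m := by rintro x y _ _ rfl rfl; simp
  c := by intro z; simp

def Maj (p : PZ) (q : PN) : Prop := ∀ m, (coeff m p).natAbs ≤ coeff m q

theorem par_maj : Par (α := PZ) (β := PN) (· + ·) (· * ·) (fun z => C z) (· + ·) (· * ·) (fun z => C z.natAbs) Maj where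
  a := by
    intro x y x' y' h h' m
    simp only [coeff_add]
    exact (Int.natAbs_add_le _ _).trans (add_le_add (h m) (h' m))
  m := by
    intro x y x' y' h h' m
    simp only [coeff_mul]
    refine (Int.natAbs_sum_le _ _).trans (sum_le_sum fun i _ => ?_)
    rw [Int.natAbs_mul]
    exact Nat.mul_le_mul (h _) (h' _)
  c := by
    intro z m
    simp only [coeff_C]; split_ifs <;> simp

theorem maj_X (i : Fin 3) : Maj (X i) (X i) := by
  intro m; rw [coeff_X, coeff_X]; split_ifs <;> simp

theorem coeff_le_eval (q : PN) (v : Fin 3 → ℕ) (m : Fin 3 →₀ ℕ) : coeff m q * ∏ i, v i ^ m i ≤ eval v q := by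
  rw [eval_eq']
  by_cases h : m ∈ q.support
  · exact Finset.single_le_sum (f := fun d => coeff d q * ∏ i, v i ^ d i) (fun _ _ => Nat.zero_le _) h
  · rw [notMem_support_iff.1 h]; simp

noncomputable def mon (i j k : ℕ) : Fin 3 →₀ ℕ := Finsupp.equivFunOnFinite.symm ![i,j,k]

theorem mon_eq (m : Fin 3 →₀ ℕ) : mon (m 0) (m 1) (m 2) = m := by
  ext i; fin_cases i <;> simp [mon]

theorem eval_box {R : Type} [CommRing R] (p : PZ) (a b c : ℕ) (h : ∀ m, coeff m p ≠ 0 → m 0 < a ∧ m 1 < b ∧ m 2 < c) (v : Fin 3 → R) :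
    eval₂ (Int.castRingHom R) v p = ∑ k ∈ range c, ∑ j ∈ range b, ∑ i ∈ range a, ((coeff (mon i j k) p : ℤ) : R) * (v 0 ^ i * v 1 ^ j * v 2 ^ k) := by
  rw [eval₂_eq']
  have : ∑ k ∈ range c, ∑ j ∈ range b, ∑ i ∈ range a, ((coeff (mon i j k) p : ℤ) : R) * (v 0 ^ i * v 1 ^ j * v 2 ^ k)
     = ∑ t ∈ range c ×ˢ (range b ×ˢ range a), ((coeff (mon t.2.2 t.2.1 t.1) p : ℤ) : R) * (v 0 ^ t.2.2 * v 1 ^ t.2.1 * v 2 ^ t.1) := by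
    rw [sum_product]; apply sum_congr rfl; intro k _; rw [sum_product]
  rw [this]
  symm
  have inj : ∀ t : ℕ × ℕ × ℕ, (mon t.2.2 t.2.1 t.1 0, mon t.2.2 t.2.1 t.1 1, mon t.2.2 t.2.1 t.1 2) = (t.2.2, t.2.1, t.1) := by
    intro t; simp [mon]
  rw [← Finset.sum_subset (s₁ := (range c ×ˢ (range b ×ˢ range a)).filter (fun t => coeff (mon t.2.2 t.2.1 t.1) p ≠ 0)) (Finset.filter_subset _ _)]
  · refine Finset.sum_bij (fun t _ => mon t.2.2 t.2.1 t.1) ?_ ?_ ?_ ?_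
    · intro t ht; rw [mem_support_iff]; exact (Finset.mem_filter.1 ht).2
    · intro t _ t' _ e
      have h1 := inj t; have h2 := inj t'
      rw [e] at h1; rw [h1] at h2
      simp only [Prod.mk.injEq] at h2
      obtain ⟨x, y, z⟩ := h2
      exact Prod.ext z (Prod.ext y x)
    · intro m hm
      have := h m (mem_support_iff.1 hm)
      refine ⟨(m 2, m 1, m 0), ?_, mon_eq m⟩
      rw [Finset.mem_filter]
      refine ⟨by simp [this.1, this.2.1, this.2.2], ?_⟩
      simp only [mon_eq]; exact mem_support_iff.1 hm
    · intro t ht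
      simp only [Fin.prod_univ_three]
      have := inj t; simp only [Prod.mk.injEq] at this
      rw [this.1, this.2.1, this.2.2]; simp
  · intro t ht h2
    have : coeff (mon t.2.2 t.2.1 t.1) p = 0 := by
      by_contra hc; exact h2 (Finset.mem_filter.2 ⟨ht, hc⟩)
    rw [this]; simp

/-- degree and size control through the majorant -/
theorem maj_box (p : PZ) (q : PN) (hq : Maj p q) (T a b c M : ℕ) (hT : 1 < T) (h0 : eval ![T,1,1] q < T^a) (h1 : eval ![1,T,1] q < T^b)
    (h2 : eval ![1,1,T] q < T^c) (hM : eval ![1,1,1] q ≤ M) :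
    (∀ m, coeff m p ≠ 0 → m 0 < a ∧ m 1 < b ∧ m 2 < c) ∧ ∀ m, (coeff m p).natAbs ≤ M := by
  constructor
  · intro m hm
    have hq1 : 1 ≤ coeff m q := le_trans (Int.natAbs_pos.2 hm) (hq m)
    have key : ∀ v, ∏ i, v i ^ m i ≤ eval v q := fun v =>
      le_trans (by simpa using Nat.mul_le_mul_right (∏ i, v i ^ m i) hq1) (coeff_le_eval q v m)
    refine ⟨?_, ?_, ?_⟩
    · have := key ![T,1,1]; simp [Fin.prod_univ_three] at this
      exact (Nat.pow_lt_pow_iff_right hT).1 (lt_of_le_of_lt this h0)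
    · have := key ![1,T,1]; simp [Fin.prod_univ_three] at this
      exact (Nat.pow_lt_pow_iff_right hT).1 (lt_of_le_of_lt this h1)
    · have := key ![1,1,T]; simp [Fin.prod_univ_three] at this
      exact (Nat.pow_lt_pow_iff_right hT).1 (lt_of_le_of_lt this h2)
  · intro m
    have := coeff_le_eval q ![1,1,1] m
    simp [Fin.prod_univ_three] at this
    exact (hq m).trans (this.trans (by simpa using hM))
end Kiss

namespace Kiss
open Finset

theorem pk_nest (w a : ℕ) (c : ℕ → ℕ) (b : ℕ) : pk w c (a*b) = pk (w*a) (fun j => pk w (fun i => c (i+a*j)) a) b := by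
  induction b generalizing c with
  | zero => rfl
  | succ b ih =>
    rw [show a*(b+1) = a + a*b by ring, pk_append, ih]
    show _ = pk w (fun i => c (i + a*0)) a + 2^(w*a) * pk (w*a) _ b
    congr 2
    apply pk_congr; intro j _
    apply pk_congr; intro i _
    congr 1; ring

def nst (w a b c : ℕ) (f : ℕ → ℕ → ℕ → ℕ) : ℕ :=
  pk (w*a*b) (fun k => pk (w*a) (fun j => pk w (fun i => f i j k) a) b) c

theorem nst_sum (w a b c : ℕ) (f : ℕ → ℕ → ℕ → ℕ) : nst w a b c f =
    ∑ k ∈ range c, ∑ j ∈ range b, ∑ i ∈ range a, f i j k * ((2^w)^i * (2^(w*a))^j * (2^(w*a*b))^k) := by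
  unfold nst
  rw [pk_sum]
  refine sum_congr rfl fun k _ => ?_
  rw [pk_sum, sum_mul]
  refine sum_congr rfl fun j _ => ?_
  rw [pk_sum, sum_mul, sum_mul]
  refine sum_congr rfl fun i _ => ?_
  ring

theorem nst_flat (w a b c : ℕ) (d : ℕ → ℕ) : pk w d (a*b*c) = nst w a b c (fun i j k => d (i + a*j + a*b*k)) := by
  unfold nst
  rw [pk_nest]
  rw [mul_assoc]
  apply pk_congr; intro k _
  rw [pk_nest]

def rp (W W' : ℕ) (f : ℕ → ℕ → ℕ) : ℕ → ℕ → ℕ → ℕ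
  | 0, _, _ => 0
  | n+1, i, V => Nat.add (f i (Nat.mod V (Nat.pow 2 W))) (Nat.mul (Nat.pow 2 W') (rp W W' f n (Nat.succ i) (Nat.div V (Nat.pow 2 W))))

theorem rp_spec (W W' : ℕ) (f : ℕ → ℕ → ℕ) (n : ℕ) : ∀ (i : ℕ) (C : ℕ → ℕ), (∀ j, j < n → C j < 2^W) →
    rp W W' f n i (pk W C n) = pk W' (fun j => f (i+j) (C j)) n := by
  induction n with
  | zero => intro i C h; rfl
  | succ n ih =>
    intro i C h
    have h0 := h 0 (by omega)
    have e1 : Nat.mod (pk W C (n+1)) (Nat.pow 2 W) = C 0 := by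
      show (C 0 + 2^W * _) % 2^W = _
      rw [Nat.add_mul_mod_self_left, Nat.mod_eq_of_lt h0]
    have e2 : Nat.div (pk W C (n+1)) (Nat.pow 2 W) = pk W (fun i => C (i+1)) n := by
      show (C 0 + 2^W * _) / 2^W = _
      rw [Nat.add_mul_div_left _ _ (by positivity), Nat.div_eq_of_lt h0, zero_add]
    show Nat.add (f i (Nat.mod (pk W C (n+1)) (Nat.pow 2 W))) (Nat.mul (Nat.pow 2 W') (rp W W' f n (Nat.succ i) (Nat.div (pk W C (n+1)) (Nat.pow 2 W)))) = _
    rw [e1, e2, ih _ _ (fun j hj => h (j+1) (by omega))]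
    show f i (C 0) + 2^W' * _ = f (i+0) (C 0) + 2^W' * _
    rw [add_zero]
    congr 2
    apply pk_congr; intro j _
    congr 1
    show i+1+j = i+(j+1)
    omega

def el (w s M wt v : ℕ) : ℕ := bif Nat.ble M v then Nat.mod (Nat.shiftRight (Nat.mul (Nat.sub v M) wt) s) (Nat.pow 2 w) else Nat.sub (Nat.pow 2 w) 1

def rp3 (w0 w s M a b c : ℕ) (la lb lc : ℕ → ℕ) (V : ℕ) : ℕ :=
  rp (w0*a*b) (w*a*b) (fun k => rp (w0*a) (w*a) (fun j => rp w0 w (fun i => el w s M (Nat.mul (Nat.mul (la i) (lb j)) (lc k))) a 0) b 0) c 0 V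

theorem rp3_spec (w0 w s M a b c : ℕ) (la lb lc : ℕ → ℕ) (f : ℕ → ℕ → ℕ → ℕ) (hf : ∀ i j k, f i j k < 2^w0) :
    rp3 w0 w s M a b c la lb lc (nst w0 a b c f) = nst w a b c (fun i j k => el w s M (la i * lb j * lc k) (f i j k)) := by
  have h1 : ∀ j k, pk w0 (fun i => f i j k) a < 2^(w0*a) := fun j k => pk_lt _ _ _ (fun i _ => hf i j k)
  have h2 : ∀ k, pk (w0*a) (fun j => pk w0 (fun i => f i j k) a) b < 2^(w0*a*b) := fun k => pk_lt _ _ _ (fun j _ => h1 j k)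
  unfold rp3 nst
  rw [rp_spec _ _ _ _ _ _ (fun k _ => h2 k)]
  apply pk_congr; intro k _
  rw [rp_spec _ _ _ _ _ _ (fun j _ => h1 j k)]
  apply pk_congr; intro j _
  rw [rp_spec _ _ _ _ _ _ (fun i _ => hf i j k)]
  apply pk_congr; intro i _
  simp only [zero_add]; rfl

theorem hi_zero (w n c : ℕ) (hn : n ≤ w) (hc : c < 2^w) (h : c &&& (2^w - 2^n) = 0) : c < 2^n := by
  rw [and_hi w n c hn hc] at h
  have h2 := Nat.two_pow_pos n
  rcases Nat.mul_eq_zero.1 h with h | h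
  · exact (Nat.div_eq_zero_iff.1 h).resolve_left (by omega)
  · omega

/-- all the slots are below `2^n` -/
theorem chk_spec (w n K : ℕ) (hw : 0 < w) (hn : n ≤ w) (d : ℕ → ℕ) (hd : ∀ i, d i < 2^w)
    (H : Nat.land (pk w d K) (mcst w K (2^w - 2^n)) = 0) : ∀ i, i < K → d i < 2^n := by
  have H : pk w d K &&& mcst w K (2^w - 2^n) = 0 := H
  have h2 : 2^w - 2^n < 2^w := by
    have := Nat.two_pow_pos n; have := Nat.two_pow_pos w; omega
  rw [mcst_eq _ _ _ hw, pk_and w K _ _ hd (fun _ => h2), ← pk_zero' w K] at H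
  intro i hi
  have := pk_inj w K _ _ (fun i => lt_of_le_of_lt Nat.and_le_left (hd i)) (fun _ => by positivity) H i hi
  exact hi_zero w n _ hn (hd i) this

theorem el_real (w s M wt : ℕ) (x : ℤ) (n : ℕ) (hn : n < w) (hx : x.natAbs ≤ M) (h : el w s M wt (x + M).toNat < 2^n) :
    (el w s M wt (x+M).toNat : ℝ) ≤ x * wt / 2^s := by
  unfold el at *
  by_cases hb : Nat.ble M (x+M).toNat = true
  · have hb' := Nat.le_of_ble_eq_true hb
    rw [hb]
    simp only [cond_true]
    have hx0 : 0 ≤ x := by omega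
    obtain ⟨y, rfl⟩ := Int.eq_ofNat_of_zero_le hx0
    have e : (((y:ℤ) + M).toNat) - M = y := by omega
    show (((((((y:ℤ) + M).toNat) - M) * wt) >>> s % 2^w : ℕ) : ℝ) ≤ _
    rw [e, Nat.shiftRight_eq_div_pow]
    refine le_trans (Nat.cast_le.2 (Nat.mod_le _ _)) ?_
    have := @Nat.cast_div_le ℝ _ _ _ (y*wt) (2^s)
    push_cast at this
    push_cast; exact this
  · simp only [Bool.not_eq_true] at hb
    rw [hb] at h
    simp only [cond_false] at h
    exfalso
    have : 2^n < 2^w := Nat.pow_lt_pow_right (by norm_num) hn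
    have h : 2^w - 1 < 2^n := h
    omega

noncomputable def H3 (f : ℕ → ℕ → ℕ → ℤ) (n : ℕ) (x y z : ℝ) : ℝ :=
  ∑ k ∈ range (n+1), ∑ j ∈ range (n+1), ∑ i ∈ range (n+1), (f i j k : ℝ) * ((x^i*(1-x)^(n-i)) * (y^j*(1-y)^(n-j)) * (z^k*(1-z)^(n-k)))

theorem int_nst (w0 a b c M : ℕ) (f : ℕ → ℕ → ℕ → ℤ) (hf : ∀ i j k, (f i j k).natAbs ≤ M) :
    (∑ k ∈ range c, ∑ j ∈ range b, ∑ i ∈ range a, f i j k * (((2:ℤ)^w0)^i * (2^(w0*a))^j * (2^(w0*a*b))^k)) + (nst w0 a b c (fun _ _ _ => M) : ℕ)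
      = ((nst w0 a b c (fun i j k => (f i j k + M).toNat) : ℕ) : ℤ) := by
  rw [nst_sum, nst_sum]
  push_cast
  simp only [← sum_add_distrib, ← add_mul]
  refine sum_congr rfl fun k _ => sum_congr rfl fun j _ => sum_congr rfl fun i _ => ?_
  congr 1
  have := hf i j k
  omega

def VV (w0 a b c M : ℕ) (z : ℤ) : ℕ := Int.toNat (Int.add z (Int.ofNat (mcst w0 (a*b*c) M)))

theorem VV_spec (w0 a b c M : ℕ) (hw : 0 < w0) (f : ℕ → ℕ → ℕ → ℤ) (hf : ∀ i j k, (f i j k).natAbs ≤ M) (z : ℤ)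
    (hz : z = ∑ k ∈ range c, ∑ j ∈ range b, ∑ i ∈ range a, f i j k * (((2:ℤ)^w0)^i * (2^(w0*a))^j * (2^(w0*a*b))^k)) :
    VV w0 a b c M z = nst w0 a b c (fun i j k => (f i j k + M).toNat) := by
  have e : ((mcst w0 (a*b*c) M : ℕ) : ℤ) = (nst w0 a b c (fun _ _ _ => M) : ℕ) := by
    rw [mcst_eq _ _ _ hw, nst_flat]
  have := int_nst w0 a b c M f hf
  rw [← hz, ← e] at this
  show Int.toNat (z + ((mcst w0 (a*b*c) M : ℕ) : ℤ)) = _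
  rw [this]; simp

def chk (w K n V : ℕ) : Bool := Nat.beq (Nat.land V (mcst w K (Nat.sub (Nat.pow 2 w) (Nat.pow 2 n)))) 0

/-- the abstract unpacking statement -/
theorem unpack (w0 w s a b c M n : ℕ) (hw0 : 0 < w0) (hM : 2*M < 2^w0) (hn : n < w) (la lb lc : ℕ → ℕ) (f : ℕ → ℕ → ℕ → ℤ) (hf : ∀ i j k, (f i j k).natAbs ≤ M) (z : ℤ)
    (hz : z = ∑ k ∈ range c, ∑ j ∈ range b, ∑ i ∈ range a, f i j k * (((2:ℤ)^w0)^i * (2^(w0*a))^j * (2^(w0*a*b))^k))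
    (ha : 0 < a) (hb : 0 < b)
    (hc : chk w (a*b*c) n (rp3 w0 w s M a b c la lb lc (VV w0 a b c M z)) = true) :
    ∃ d : ℕ → ℕ, Dig w (a*b*c) (a*b*c) (2^n) (rp3 w0 w s M a b c la lb lc (VV w0 a b c M z)) d ∧
      ∀ i j k, i < a → j < b → k < c → (d (i+a*j+a*b*k) : ℝ) ≤ f i j k * (la i * lb j * lc k : ℕ) / 2^s := by
  have hv : ∀ i j k, (f i j k + M).toNat ≤ 2*M := by intro i j k; have := hf i j k; omega
  rw [VV_spec w0 a b c M hw0 f hf z hz, rp3_spec _ _ _ _ _ _ _ _ _ _ _ (fun i j k => lt_of_le_of_lt (hv i j k) hM)] at *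
  have hab : 0 < a*b := Nat.mul_pos ha hb
  set d : ℕ → ℕ := fun m => if m < a*b*c then el w s M (la (m%a) * lb (m/a%b) * lc (m/(a*b))) (f (m%a) (m/a%b) (m/(a*b)) + M).toNat else 0 with hd
  have hdl : ∀ m, d m < 2^w := by
    intro m
    simp only [hd]
    split_ifs with hm
    · unfold el
      cases Nat.ble M (f (m % a) (m / a % b) (m / (a * b)) + M).toNat with
      | true =>
        simp only [cond_true]
        exact Nat.mod_lt _ (Nat.two_pow_pos w)
      | false =>
        simp only [cond_false]
        have := Nat.two_pow_pos w
        show 2^w - 1 < 2^w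
        omega
    · positivity
  have hidx : ∀ i j k, i < a → j < b → k < c → (i+a*j+a*b*k) < a*b*c ∧ (i+a*j+a*b*k)%a = i ∧ (i+a*j+a*b*k)/a%b = j ∧ (i+a*j+a*b*k)/(a*b) = k := by
    intro i j k hi hj hk
    have e1 : (i+a*j+a*b*k) / a = j + b*k := by
      rw [show i+a*j+a*b*k = i + a*(j+b*k) by ring, Nat.add_mul_div_left _ _ ha, Nat.div_eq_of_lt hi, zero_add]
    have h4 : (i+a*j+a*b*k)/(a*b) = k := by
      rw [← Nat.div_div_eq_div_mul, e1, Nat.add_mul_div_left _ _ hb, Nat.div_eq_of_lt hj, zero_add]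
    refine ⟨?_, ?_, ?_, h4⟩
    · have : i + a*j < a*b := by
        calc i + a*j < a + a*j := by omega
          _ = a*(j+1) := by ring
          _ ≤ a*b := Nat.mul_le_mul_left _ hj
      calc i+a*j+a*b*k < a*b + a*b*k := by omega
        _ = a*b*(k+1) := by ring
        _ ≤ a*b*c := Nat.mul_le_mul_left _ hk
    · rw [show i+a*j+a*b*k = i + a*(j+b*k) by ring, Nat.add_mul_mod_self_left, Nat.mod_eq_of_lt hi]
    · rw [e1, Nat.add_mul_mod_self_left, Nat.mod_eq_of_lt hj]
  have hdv : ∀ i j k, i < a → j < b → k < c → d (i+a*j+a*b*k) = el w s M (la i * lb j * lc k) (f i j k + M).toNat := by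
    intro i j k hi hj hk
    obtain ⟨h1, h2, h3, h4⟩ := hidx i j k hi hj hk
    simp only [hd]
    rw [if_pos h1, h2, h3, h4]
  have heq : nst w a b c (fun i j k => el w s M (la i * lb j * lc k) (f i j k + M).toNat) = pk w d (a*b*c) := by
    rw [nst_flat]
    unfold nst
    apply pk_congr; intro k hk
    apply pk_congr; intro j hj
    apply pk_congr; intro i hi
    exact (hdv i j k hi hj hk).symm
  rw [heq] at hc ⊢
  have hchk := chk_spec w n (a*b*c) (by omega) hn.le d hdl (Nat.eq_of_beq_eq_true hc)
  refine ⟨d, ⟨rfl, ?_, ?_⟩, ?_⟩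
  · intro m
    by_cases hm : m < a*b*c
    · exact (hchk m hm).le
    · simp only [hd]; rw [if_neg hm]; positivity
  · intro m hm; simp only [hd]; rw [if_neg (by omega)]
  · intro i j k hi hj hk
    have h1 := hchk _ (hidx i j k hi hj hk).1
    rw [hdv i j k hi hj hk] at h1 ⊢
    exact el_real w s M _ _ n hn (hf i j k) h1
end Kiss

namespace Kiss
open Finset

abbrev cst (R : Type) [CommRing R] : ℤ → R := fun z => (z : R)

theorem sm_eq {R : Type} [CommRing R] (f : ℕ → R) (n : ℕ) : sm (· + ·) (cst R) f n = ∑ i ∈ range n, f i := by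
  induction n with
  | zero => simp [sm, cst]
  | succ n ih => rw [sum_range_succ, ← ih]; rfl
theorem pw_eq {R : Type} [CommRing R] (x : R) (n : ℕ) : pw (· * ·) (cst R) x n = x^n := by
  induction n with
  | zero => simp [pw, cst]
  | succ n ih => rw [pow_succ, ← ih]; rfl

theorem gp_eq (m : ℕ) (hm : 0 < m) (x w : ℝ) (k : ℕ) :
    (gp (· + ·) (· * ·) (cst ℝ) m x w k).1 = (m.ascFactorial k : ℝ) * geg m x w k ∧
    (gp (· + ·) (· * ·) (cst ℝ) m x w k).2 = (m.ascFactorial (k+1) : ℝ) * geg m x w (k+1) := by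
  induction k with
  | zero => simp [gp, geg, cst, Nat.ascFactorial]
  | succ k ih =>
    refine ⟨ih.2, ?_⟩
    simp only [gp]
    rw [ih.1, ih.2, geg]
    rw [Nat.ascFactorial_succ (k := k+1), Nat.ascFactorial_succ (k := k)]
    simp only [cst]
    push_cast
    have : (k:ℝ) + m + 1 ≠ 0 := by positivity
    field_simp
    ring

theorem geg_hom (m : ℕ) (l s q : ℝ) : ∀ k, geg m (l*s) (l^2*q) k = l^k * geg m s q k
  | 0 => by simp [geg]
  | 1 => by simp [geg]
  | k+2 => by rw [geg, geg, geg_hom m l s q k, geg_hom m l s q (k+1)]; ring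

theorem geg_one (m : ℕ) : ∀ k, geg m 1 1 k = 1
  | 0 => by simp [geg]
  | 1 => by simp [geg]
  | k+2 => by
    rw [geg, geg_one m k, geg_one m (k+1)]
    have : (k:ℝ) + m + 1 ≠ 0 := by positivity
    field_simp; ring

theorem geg_cont (m : ℕ) {f g : ℝ → ℝ} (hf : Continuous f) (hg : Continuous g) : ∀ k, Continuous (fun x => geg m (f x) (g x) k)
  | 0 => by simp only [geg]; exact continuous_const
  | 1 => by simp only [geg]; exact hf
  | k+2 => by
    simp only [geg]
    have h1 := geg_cont m hf hg k
    have h2 := geg_cont m hf hg (k+1)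
    fun_prop

noncomputable def hG (a : ℝ) : ℕ → List ℤ → ℝ
  | _, [] => 0
  | D, c :: l => c * (1-a)^D + a * hG a (D-1) l

theorem hG_eq (a : ℝ) (ha : 1 - a ≠ 0) (l : List ℤ) : ∀ D, l.length ≤ D + 1 → hG a D l = (1-a)^D * hor (· + ·) (· * ·) (cst ℝ) (a/(1-a)) l := by
  induction l with
  | nil => intro D _; simp [hG, hor, cst]
  | cons c l ih =>
    intro D hD
    simp only [hG, hor]
    cases D with
    | zero =>
      have : l = [] := by simp at hD; exact hD
      subst this
      simp [hG, hor, cst]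
    | succ D =>
      rw [Nat.add_sub_cancel, ih D (by simp at hD; omega)]
      simp only [cst]
      field_simp
      ring

theorem hG_cont {f : ℝ → ℝ} (hf : Continuous f) (l : List ℤ) : ∀ D, Continuous (fun x => hG (f x) D l) := by
  induction l with
  | nil => intro D; simp only [hG]; exact continuous_const
  | cons c l ih => intro D; simp only [hG]; have := ih (D-1); fun_prop

section
variable (D : Dat) (S2 : ℕ)

noncomputable def sk (k : ℕ) : ℝ := D.tau k * (Nat.ascFactorial 17 k) / (4^(16-k) * S2)
noncomputable def inv (u : ℝ) : ℝ := (2*u+2)/3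
theorem inv_cc (a : ℝ) : inv (cc a) = a := by unfold inv cc; ring
noncomputable def gg (k : ℕ) (r : ℕ) (u : ℝ) : ℝ := √(sk D S2 k) * hG (inv u) (16-k) (D.row k r)
noncomputable def g0 (r : Fin 17) (u : ℝ) : ℝ := gg D S2 0 r u
noncomputable def g1 (j : Fin 16 × Fin 17) (u : ℝ) : ℝ := gg D S2 (j.1+1) j.2 u
def kap (j : Fin 16 × Fin 17) : ℕ := j.1
noncomputable def ee (r : Fin 17) : ℝ := √(sk D S2 0) * D.ep r

noncomputable abbrev YY (u v t : ℝ) : ℝ := Yf (g0 D S2) kap (g1 D S2) u v t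

theorem sk_nonneg (k : ℕ) : 0 ≤ sk D S2 k := by unfold sk; positivity

theorem gg_mul (k r : ℕ) (u v : ℝ) : gg D S2 k r u * gg D S2 k r v = sk D S2 k * (hG (inv u) (16-k) (D.row k r) * hG (inv v) (16-k) (D.row k r)) := by
  unfold gg
  have := Real.mul_self_sqrt (sk_nonneg D S2 k)
  linear_combination (hG (inv u) (16-k) (D.row k r) * hG (inv v) (16-k) (D.row k r)) * this

theorem YY_eq (u v t : ℝ) : YY D S2 u v t = ∑ k ∈ range 17, (∑ r ∈ range 17, sk D S2 k * (hG (inv u) (16-k) (D.row k r) * hG (inv v) (16-k) (D.row k r)))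
     * geg 17 (t-u*v) ((1-u^2)*(1-v^2)) k := by
  unfold YY Yf
  rw [sum_range_succ', add_comm, Fintype.sum_prod_type]
  congr 1
  · simp only [g1, kap, gg_mul]
    rw [← Fin.sum_univ_eq_sum_range (n := 16) (fun k => (∑ r ∈ range 17, sk D S2 (k+1) * (hG (inv u) (16-(k+1)) (D.row (k+1) r) * hG (inv v) (16-(k+1)) (D.row (k+1) r)))
     * geg 17 (t-u*v) ((1-u^2)*(1-v^2)) (k+1))]
    apply sum_congr rfl; intro k _
    rw [sum_mul, ← Fin.sum_univ_eq_sum_range (n := 17) (fun r => sk D S2 (k+1) * (hG (inv u) (16-(k+1)) (D.row (k+1) r) * hG (inv v) (16-(k+1)) (D.row (k+1) r))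
     * geg 17 (t-u*v) ((1-u^2)*(1-v^2)) (k+1))]
  · simp only [g0, gg_mul, geg, mul_one]
    rw [← Fin.sum_univ_eq_sum_range (n := 17) (fun r => sk D S2 0 * (hG (inv u) (16-0) (D.row 0 r) * hG (inv v) (16-0) (D.row 0 r)))]

theorem Yg_eq (hS : 0 < S2) (hlen : ∀ k r, k < 17 → (D.row k r).length ≤ 17 - k) (a b c : ℝ) (ha : 1 - a ≠ 0) (hb : 1 - b ≠ 0) (hc : 1 - c ≠ 0) :
    ((1-a)*(1-b)*(1-c))^16 * Yg D (· + ·) (· * ·) (cst ℝ) (a/(1-a)) (b/(1-b)) (c/(1-c)) = 4^16 * S2 * YY D S2 (cc a) (cc b) (cc c) := by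
  unfold Yg
  rw [YY_eq, sm_eq, mul_sum, mul_sum]
  apply sum_congr rfl
  intro k hk
  rw [mem_range] at hk
  simp only [inv_cc]
  have hk' : (16-k)+1 = 17-k := by omega
  have e1 : ∀ r, hG a (16-k) (D.row k r) = _ := fun r => hG_eq a ha _ _ (by rw [hk']; exact hlen k r hk)
  have e2 : ∀ r, hG b (16-k) (D.row k r) = _ := fun r => hG_eq b hb _ _ (by rw [hk']; exact hlen k r hk)
  simp only [e1, e2]
  rw [pw_eq, sm_eq, (gp_eq 17 (by norm_num) _ _ k).1]
  simp only [cst]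
  have hx : (((2:ℤ):ℝ) * (c/(1-c) + ((-2:ℤ):ℝ))) * ((((1:ℤ):ℝ) + a/(1-a)) * (((1:ℤ):ℝ) + b/(1-b))) + ((-1:ℤ):ℝ) * (((a/(1-a)+((-2:ℤ):ℝ)) * (b/(1-b) + ((-2:ℤ):ℝ))) * (((1:ℤ):ℝ) + c/(1-c)))
      = (4/((1-a)*(1-b)*(1-c))) * (cc c - cc a * cc b) := by
    unfold cc; push_cast; field_simp; ring
  have hw : (((9:ℤ):ℝ) * ((a/(1-a)*(a/(1-a)+((4:ℤ):ℝ))) * (b/(1-b) * (b/(1-b)+((4:ℤ):ℝ))))) * ((((1:ℤ):ℝ)+c/(1-c))*(((1:ℤ):ℝ)+c/(1-c)))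
      = (4/((1-a)*(1-b)*(1-c)))^2 * ((1-cc a^2)*(1-cc b^2)) := by
    unfold cc; push_cast; field_simp; ring
  rw [hx, hw, geg_hom]
  have hz : ((1:ℤ):ℝ) + c/(1-c) = 1/(1-c) := by push_cast; field_simp; ring
  rw [hz]
  have e3 : ∀ r, sk D S2 k * ((1-a)^(16-k) * hor (· + ·) (· * ·) (cst ℝ) (a/(1-a)) (D.row k r) * ((1-b)^(16-k) * hor (· + ·) (· * ·) (cst ℝ) (b/(1-b)) (D.row k r)))
      = (sk D S2 k * ((1-a)^(16-k) * (1-b)^(16-k))) * (hor (· + ·) (· * ·) (cst ℝ) (a/(1-a)) (D.row k r) * hor (· + ·) (· * ·) (cst ℝ) (b/(1-b)) (D.row k r)) := by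
    intro r; ring
  simp only [e3]
  rw [← mul_sum]
  generalize (∑ i ∈ range 17, _ : ℝ) = Sg
  generalize geg 17 _ _ k = gk
  unfold sk
  have hS' : (S2:ℝ) ≠ 0 := by positivity
  obtain ⟨j, hj⟩ : ∃ j, 16 - k = j := ⟨_, rfl⟩
  have hj2 : 16 = j + k := by omega
  rw [hj]
  have hp : ∀ x : ℝ, x^16 = x^j * x^k := fun x => by rw [← pow_add, ← hj2]
  rw [hp ((1-a)*(1-b)*(1-c)), hp 4]
  push_cast
  simp only [mul_pow, div_pow, one_div, inv_pow]
  field_simp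

noncomputable def fW (OF : ℤ) (i j k : ℕ) : ℤ :=
  MvPolynomial.coeff (mon i j k) (Wg D OF (α := PZ) (· + ·) (· * ·) (fun z => MvPolynomial.C z) (MvPolynomial.X 0) (MvPolynomial.X 1) (MvPolynomial.X 2))
noncomputable def fP (OF : ℤ) (i j k : ℕ) : ℤ :=
  MvPolynomial.coeff (mon i j k) (Pg D OF (α := PZ) (· + ·) (· * ·) (fun z => MvPolynomial.C z) (MvPolynomial.X 0))

def bW (OF : ℤ) (T M w0 : ℕ) : Bool :=
  Nat.blt 1 T &&
  Nat.blt (Wg D OF Nat.add Nat.mul Int.natAbs T 1 1) (Nat.pow T 17) && Nat.blt (Wg D OF Nat.add Nat.mul Int.natAbs 1 T 1) (Nat.pow T 17) &&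
  Nat.blt (Wg D OF Nat.add Nat.mul Int.natAbs 1 1 T) (Nat.pow T 17) && Nat.ble (Wg D OF Nat.add Nat.mul Int.natAbs 1 1 1) M && Nat.blt (Nat.mul 2 M) (Nat.pow 2 w0)
def bP (OF : ℤ) (T M w0 : ℕ) : Bool :=
  Nat.blt 1 T &&
  Nat.blt (Pg D OF Nat.add Nat.mul Int.natAbs T) (Nat.pow T 33) && 
  Nat.blt (Pg D OF Nat.add Nat.mul Int.natAbs 1) T && Nat.ble (Pg D OF Nat.add Nat.mul Int.natAbs 1) M && Nat.blt (Nat.mul 2 M) (Nat.pow 2 w0)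

theorem blt_lt {a b : ℕ} (h : Nat.blt a b = true) : a < b := Nat.le_of_ble_eq_true h

theorem fW_spec (OF : ℤ) (T M w0 : ℕ) (h : bW D OF T M w0 = true) :
    2*M < 2^w0 ∧ (∀ i j k, (fW D OF i j k).natAbs ≤ M) ∧ ∀ {R : Type} [CommRing R] (x y z : R),
      Wg D OF (· + ·) (· * ·) (cst R) x y z = ∑ k ∈ range 17, ∑ j ∈ range 17, ∑ i ∈ range 17, (fW D OF i j k : R) * (x^i*y^j*z^k) := by
  simp only [bW, Bool.and_eq_true] at h
  obtain ⟨⟨⟨⟨⟨h1, h2⟩, h3⟩, h4⟩, h5⟩, h6⟩ := h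
  have hq : ∀ a b c : ℕ, MvPolynomial.eval ![a,b,c] (Wg D OF (α := PN) (· + ·) (· * ·) (fun z => MvPolynomial.C z.natAbs) (MvPolynomial.X 0) (MvPolynomial.X 1) (MvPolynomial.X 2))
     = Wg D OF Nat.add Nat.mul Int.natAbs a b c := by
    intro a b c
    exact (par_nat ![a,b,c]).Wg D OF (by simp) (by simp) (by simp)
  obtain ⟨m1, m2⟩ := maj_box _ _ (par_maj.Wg D OF (maj_X 0) (maj_X 1) (maj_X 2)) T 17 17 17 M (blt_lt h1) (by rw [hq]; exact blt_lt h2)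
    (by rw [hq]; exact blt_lt h3) (by rw [hq]; exact blt_lt h4) (by rw [hq]; exact Nat.le_of_ble_eq_true h5)
  refine ⟨blt_lt h6, fun i j k => m2 _, ?_⟩
  intro R _ x y z
  have e := eval_box (R := R) _ 17 17 17 m1 ![x,y,z]
  rw [(par_hom ![x,y,z]).Wg D OF (X' := x) (Y' := y) (Z' := z) (by simp) (by simp) (by simp)] at e
  exact e

theorem fP_spec (OF : ℤ) (T M w0 : ℕ) (h : bP D OF T M w0 = true) :
    2*M < 2^w0 ∧ (∀ i j k, (fP D OF i j k).natAbs ≤ M) ∧ ∀ {R : Type} [CommRing R] (x : R),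
      Pg D OF (· + ·) (· * ·) (cst R) x = ∑ i ∈ range 33, (fP D OF i 0 0 : R) * x^i := by
  simp only [bP, Bool.and_eq_true] at h
  obtain ⟨⟨⟨⟨h1, h2⟩, h3⟩, h5⟩, h6⟩ := h
  have hq : ∀ a b c : ℕ, MvPolynomial.eval ![a,b,c] (Pg D OF (α := PN) (· + ·) (· * ·) (fun z => MvPolynomial.C z.natAbs) (MvPolynomial.X 0))
     = Pg D OF Nat.add Nat.mul Int.natAbs a := by
    intro a b c
    exact (par_nat ![a,b,c]).Pg D OF (by simp)
  obtain ⟨m1, m2⟩ := maj_box _ _ (par_maj.Pg D OF (maj_X 0)) T 33 1 1 M (blt_lt h1) (by rw [hq]; exact blt_lt h2)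
    (by rw [hq, pow_one]; exact blt_lt h3) (by rw [hq, pow_one]; exact blt_lt h3) (by rw [hq]; exact Nat.le_of_ble_eq_true h5)
  refine ⟨blt_lt h6, fun i j k => m2 _, ?_⟩
  intro R _ x
  have e := eval_box (R := R) _ 33 1 1 m1 ![x,0,0]
  rw [(par_hom ![x,0,0]).Pg D OF (X' := x) (by simp)] at e
  simp only [range_one, sum_singleton, pow_zero, mul_one] at e
  exact e
end
end Kiss

namespace Kiss
open Finset

theorem cont0 {φ : ℝ → ℝ} (hc : Continuous φ) (h : ∀ x, 0 < x → φ x = 0) : φ 0 = 0 := by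
  have h1 : Filter.Tendsto φ (nhdsWithin 0 (Set.Ioi 0)) (nhds (φ 0)) := hc.continuousAt.tendsto.mono_left nhdsWithin_le_nhds
  have h2 : Filter.Tendsto φ (nhdsWithin 0 (Set.Ioi 0)) (nhds 0) := by
    refine Filter.Tendsto.congr' ?_ tendsto_const_nhds
    filter_upwards [self_mem_nhdsWithin] with x hx
    exact (h x hx).symm
  exact tendsto_nhds_unique h1 h2

theorem tm (n i : ℕ) (hi : i ≤ n) (a : ℝ) (ha : 1 - a ≠ 0) : (1-a)^n * (a/(1-a))^i = a^i*(1-a)^(n-i) := by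
  obtain ⟨j, rfl⟩ := Nat.exists_eq_add_of_le hi
  rw [Nat.add_sub_cancel_left, pow_add, div_pow]; field_simp

section
variable (D : Dat) (S2 : ℕ)

theorem YY_cont {f g h : ℝ → ℝ} (hf : Continuous f) (hg : Continuous g) (hh : Continuous h) : Continuous (fun x => YY D S2 (f x) (g x) (h x)) := by
  simp only [YY_eq]
  refine continuous_finsetSum _ fun k _ => Continuous.mul (continuous_finsetSum _ fun r _ => ?_) ?_
  · have h1 := hG_cont (f := fun x => inv (f x)) (by unfold inv; fun_prop) (D.row k r) (16-k)
    have h2 := hG_cont (f := fun x => inv (g x)) (by unfold inv; fun_prop) (D.row k r) (16-k)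
    fun_prop
  · exact geg_cont 17 (by fun_prop) (by fun_prop) k

theorem cc_cont : Continuous cc := by unfold cc; fun_prop

noncomputable def W3 (u v t : ℝ) : ℝ := YY D S2 u v t + YY D S2 u t v + YY D S2 v t u

theorem W_id (hS : 0 < S2) (hlen : ∀ k r, k < 17 → (D.row k r).length ≤ 17 - k) (OF : ℤ) (T M w0 : ℕ) (h : bW D OF T M w0 = true)
    (a b c : ℝ) (ha : a ≤ 1) (hb : b ≤ 1) (hc : c ≤ 1) :
    H3 (fW D OF) 16 a b c = OF - 4^16 * S2 * W3 D S2 (cc a) (cc b) (cc c) := by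
  have key : ∀ a b c : ℝ, 1 - a ≠ 0 → 1 - b ≠ 0 → 1 - c ≠ 0 → H3 (fW D OF) 16 a b c = OF - 4^16 * S2 * W3 D S2 (cc a) (cc b) (cc c) := by
    intro a b c ha hb hc
    have e1 : ((1-a)*(1-b)*(1-c))^16 * Wg D OF (· + ·) (· * ·) (cst ℝ) (a/(1-a)) (b/(1-b)) (c/(1-c)) = H3 (fW D OF) 16 a b c := by
      rw [(fW_spec D OF T M w0 h).2.2]
      unfold H3
      simp only [mul_sum]
      refine sum_congr rfl fun k hk => sum_congr rfl fun j hj => sum_congr rfl fun i hi => ?_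
      rw [mem_range] at hi hj hk
      rw [← tm 16 i (by omega) a ha, ← tm 16 j (by omega) b hb, ← tm 16 k (by omega) c hc, mul_pow, mul_pow]
      generalize (1-a)^16 = A, (1-b)^16 = B, (1-c)^16 = C, (a/(1-a))^i = p, (b/(1-b))^j = q, (c/(1-c))^k = r
      ring
    rw [← e1]
    unfold Wg
    simp only [pw_eq]
    have f1 := Yg_eq D S2 hS hlen a b c ha hb hc
    have f2 := Yg_eq D S2 hS hlen a c b ha hc hb
    have f3 := Yg_eq D S2 hS hlen b c a hb hc ha
    have ga : ((1:ℤ):ℝ) + a/(1-a) = 1/(1-a) := by push_cast; field_simp; ring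
    have gb : ((1:ℤ):ℝ) + b/(1-b) = 1/(1-b) := by push_cast; field_simp; ring
    have gc : ((1:ℤ):ℝ) + c/(1-c) = 1/(1-c) := by push_cast; field_simp; ring
    simp only [cst] at *
    rw [ga, gb, gc]
    unfold W3
    have h0 : ((1-a)*(1-b)*(1-c))^16 * ((OF:ℝ) * ((1/(1-a))^16 * ((1/(1-b))^16 * (1/(1-c))^16))) = OF := by
      field_simp
    push_cast
    rw [mul_add, h0]
    rw [show (1-a)*(1-c)*(1-b) = (1-a)*(1-b)*(1-c) by ring] at f2
    rw [show (1-b)*(1-c)*(1-a) = (1-a)*(1-b)*(1-c) by ring] at f3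
    generalize ((1-a)*(1-b)*(1-c))^16 = Q at *
    generalize YY D S2 (cc a) (cc b) (cc c) = y1 at *
    generalize YY D S2 (cc a) (cc c) (cc b) = y2 at *
    generalize YY D S2 (cc b) (cc c) (cc a) = y3 at *
    linear_combination -f1 - f2 - f3
  have := cont0 (φ := fun e => H3 (fW D OF) 16 (a-e) (b-e) (c-e) - (OF - 4^16 * S2 * W3 D S2 (cc (a-e)) (cc (b-e)) (cc (c-e)))) ?_ ?_
  · simp only [sub_zero] at this; linarith
  · have hy : ∀ {f g h : ℝ → ℝ}, Continuous f → Continuous g → Continuous h → Continuous (fun x => YY D S2 (cc (f x)) (cc (g x)) (cc (h x))) :=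
      fun hf hg hh => YY_cont D S2 (cc_cont.comp hf) (cc_cont.comp hg) (cc_cont.comp hh)
    have ca : Continuous (fun e : ℝ => a - e) := by fun_prop
    have cb : Continuous (fun e : ℝ => b - e) := by fun_prop
    have cd : Continuous (fun e : ℝ => c - e) := by fun_prop
    have y1 := hy ca cb cd
    have y2 := hy ca cd cb
    have y3 := hy cb cd ca
    unfold H3 W3
    fun_prop
  · intro x hx
    rw [key _ _ _ (by linarith) (by linarith) (by linarith)]; ring

noncomputable def P1 (u : ℝ) : ℝ := ∑ k ∈ range 33, (D.A k * Nat.ascFactorial 18 k / S2 : ℝ) * geg 18 u 1 k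
      + YY D S2 u u 1 + 2 * ∑ r, ee D S2 r * g0 D S2 r u

noncomputable def H1 (f : ℕ → ℤ) (n : ℕ) (x : ℝ) : ℝ := ∑ i ∈ range (n+1), (f i : ℝ) * (x^i*(1-x)^(n-i))

theorem P1_eq (u : ℝ) : P1 D S2 u = ∑ k ∈ range 33, (D.A k * Nat.ascFactorial 18 k / S2 : ℝ) * geg 18 u 1 k
   + ∑ k ∈ range 17, (∑ r ∈ range 17, sk D S2 k * (hG (inv u) (16-k) (D.row k r) * hG (inv u) (16-k) (D.row k r))) * (1-u^2)^k
   + 2 * ∑ r ∈ range 17, sk D S2 0 * (D.ep r * hG (inv u) 16 (D.row 0 r)) := by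
  unfold P1
  congr 1
  · congr 1
    rw [YY_eq]
    apply sum_congr rfl; intro k _
    congr 1
    have := geg_hom 17 (1-u^2) 1 1 k
    rw [geg_one, mul_one, mul_one, mul_one] at this
    rw [← this]; congr 1 <;> ring
  · congr 1
    rw [← Fin.sum_univ_eq_sum_range (n := 17) (fun r => sk D S2 0 * (D.ep r * hG (inv u) 16 (D.row 0 r)))]
    apply sum_congr rfl; intro r _
    unfold ee g0 gg
    have := Real.mul_self_sqrt (sk_nonneg D S2 0)
    linear_combination (D.ep r * hG (inv u) 16 (D.row 0 r)) * this

theorem P_id (hS : 0 < S2) (hlen : ∀ k r, k < 17 → (D.row k r).length ≤ 17 - k) (OF : ℤ) (T M w0 : ℕ) (h : bP D OF T M w0 = true)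
    (a : ℝ) (ha : a ≤ 1) :
    H1 (fun i => fP D OF i 0 0) 32 a = OF - 4^16 * S2 * P1 D S2 (cc a) := by
  have key : ∀ a : ℝ, 1 - a ≠ 0 → H1 (fun i => fP D OF i 0 0) 32 a = OF - 4^16 * S2 * P1 D S2 (cc a) := by
    intro a ha
    have e1 : (1-a)^32 * Pg D OF (· + ·) (· * ·) (cst ℝ) (a/(1-a)) = H1 (fun i => fP D OF i 0 0) 32 a := by
      rw [(fP_spec D OF T M w0 h).2.2]
      unfold H1
      simp only [mul_sum]
      refine sum_congr rfl fun i hi => ?_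
      rw [mem_range] at hi
      rw [← tm 32 i (by omega) a ha]
      ring
    rw [← e1, P1_eq]
    unfold Pg
    have hS' : (S2:ℝ) ≠ 0 := by positivity
    simp only [pw_eq, sm_eq, (gp_eq 18 (by norm_num) _ _ _).1, inv_cc]
    have ga : ((1:ℤ):ℝ) + a/(1-a) = 1/(1-a) := by push_cast; field_simp; ring
    simp only [cst]
    rw [ga]
    have h0 : (1-a)^32 * ((OF:ℝ) * (1/(1-a))^32) = OF := by field_simp
    have h1 : (1-a)^32 * ∑ k ∈ range 33, (((D.A k : ℤ) : ℝ) * (((2:ℤ):ℝ) * (1/(1-a)))^(32-k)) * ((Nat.ascFactorial 18 k : ℝ) * geg 18 (a/(1-a) + ((-2:ℤ):ℝ)) (((4:ℤ):ℝ) * (1/(1-a) * (1/(1-a)))) k)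
       = 4^16 * S2 * ∑ k ∈ range 33, (D.A k * Nat.ascFactorial 18 k / S2 : ℝ) * geg 18 (cc a) 1 k := by
      rw [mul_sum, mul_sum]
      refine sum_congr rfl fun k hk => ?_
      rw [mem_range] at hk
      have hx : a/(1-a) + ((-2:ℤ):ℝ) = (2/(1-a)) * cc a := by unfold cc; push_cast; field_simp; ring
      have hw : ((4:ℤ):ℝ) * (1/(1-a) * (1/(1-a))) = (2/(1-a))^2 * 1 := by push_cast; field_simp; norm_num
      rw [hx, hw, geg_hom]
      obtain ⟨j, hj⟩ : ∃ j, 32 - k = j := ⟨_, rfl⟩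
      have hj2 : 32 = j + k := by omega
      rw [hj]
      have hp : ∀ x : ℝ, x^32 = x^j * x^k := fun x => by rw [← pow_add, ← hj2]
      rw [hp (1-a), show (4:ℝ)^16 = 2^32 by norm_num, hp 2]
      push_cast
      simp only [mul_pow, div_pow, one_div, inv_pow]
      field_simp
    have h2 : (1-a)^32 * ∑ k ∈ range 17, (((((D.tau k : ℤ) * (Nat.ascFactorial 17 k : ℤ)) : ℤ) : ℝ) * (((3:ℤ):ℝ) * (a/(1-a) * (a/(1-a) + ((4:ℤ):ℝ))))^k) *
          ∑ r ∈ range 17, hor (· + ·) (· * ·) (cst ℝ) (a/(1-a)) (D.row k r) * hor (· + ·) (· * ·) (cst ℝ) (a/(1-a)) (D.row k r)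
       = 4^16 * S2 * ∑ k ∈ range 17, (∑ r ∈ range 17, sk D S2 k * (hG a (16-k) (D.row k r) * hG a (16-k) (D.row k r))) * (1-cc a^2)^k := by
      rw [mul_sum, mul_sum]
      refine sum_congr rfl fun k hk => ?_
      rw [mem_range] at hk
      have hk' : (16-k)+1 = 17-k := by omega
      have e1 : ∀ r, hG a (16-k) (D.row k r) = _ := fun r => hG_eq a ha _ _ (by rw [hk']; exact hlen k r hk)
      simp only [e1]
      have e3 : ∀ r, sk D S2 k * ((1-a)^(16-k) * hor (· + ·) (· * ·) (cst ℝ) (a/(1-a)) (D.row k r) * ((1-a)^(16-k) * hor (· + ·) (· * ·) (cst ℝ) (a/(1-a)) (D.row k r)))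
        = (sk D S2 k * ((1-a)^(16-k) * (1-a)^(16-k))) * (hor (· + ·) (· * ·) (cst ℝ) (a/(1-a)) (D.row k r) * hor (· + ·) (· * ·) (cst ℝ) (a/(1-a)) (D.row k r)) := by
        intro r; ring
      simp only [e3]
      rw [← mul_sum]
      generalize (∑ i ∈ range 17, _ : ℝ) = Sg
      have hx : ((3:ℤ):ℝ) * (a/(1-a) * (a/(1-a) + ((4:ℤ):ℝ))) = 4/((1-a)*(1-a)) * (1-cc a^2) := by
        unfold cc; push_cast; field_simp; ring
      rw [hx]
      unfold sk
      obtain ⟨j, hj⟩ : ∃ j, 16 - k = j := ⟨_, rfl⟩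
      have hj2 : 16 = j + k := by omega
      rw [hj]
      have hp : ∀ x : ℝ, x^16 = x^j * x^k := fun x => by rw [← pow_add, ← hj2]
      rw [show (1-a)^32 = ((1-a)^16) * (1-a)^16 by ring, hp (1-a), hp 4]
      push_cast
      simp only [mul_pow, div_pow]
      field_simp
    have h3 : (1-a)^32 * ((((2 * (D.tau 0 : ℤ) : ℤ) : ℝ) * (1/(1-a))^16) * ∑ r ∈ range 17, ((D.ep r : ℤ):ℝ) * hor (· + ·) (· * ·) (cst ℝ) (a/(1-a)) (D.row 0 r))
       = 4^16 * S2 * (2 * ∑ r ∈ range 17, sk D S2 0 * (D.ep r * hG a 16 (D.row 0 r))) := by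
      rw [mul_sum, mul_sum, mul_sum, mul_sum]
      refine sum_congr rfl fun r _ => ?_
      rw [hG_eq a ha _ 16 (hlen 0 r (by norm_num))]
      unfold sk
      rw [show (1-a)^32 = ((1-a)^16) * (1-a)^16 by ring]
      push_cast
      simp only [Nat.ascFactorial]
      push_cast
      simp only [div_pow, one_div, inv_pow]
      field_simp
      try norm_num
    simp only [cst] at h2 h3
    rw [mul_add, h0]
    have e : (((-1:ℤ):ℤ):ℝ) = -1 := by norm_num
    rw [e]
    linear_combination -h1 - h2 - h3
  have := cont0 (φ := fun e => H1 (fun i => fP D OF i 0 0) 32 (a-e) - (OF - 4^16 * S2 * P1 D S2 (cc (a-e)))) ?_ ?_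
  · simp only [sub_zero] at this; linarith
  · have ca : Continuous (fun e : ℝ => cc (a - e)) := cc_cont.comp (by fun_prop)
    have c1 : Continuous (fun e : ℝ => ∑ k ∈ range 33, (D.A k * Nat.ascFactorial 18 k / S2 : ℝ) * geg 18 (cc (a-e)) 1 k) :=
      continuous_finsetSum _ fun k _ => continuous_const.mul (geg_cont 18 ca continuous_const k)
    have c2 := YY_cont D S2 ca ca (continuous_const (y := (1:ℝ)))
    have c3 : Continuous (fun e : ℝ => 2 * ∑ r, ee D S2 r * g0 D S2 r (cc (a-e))) := by
      refine continuous_const.mul (continuous_finsetSum _ fun r _ => continuous_const.mul ?_)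
      unfold g0 gg
      exact continuous_const.mul (hG_cont (f := fun e => inv (cc (a-e))) (by unfold inv; fun_prop) _ _)
    unfold H1 P1
    fun_prop
  · intro x hx
    rw [key _ (by linarith)]; ring
end
end Kiss

namespace Kiss
open Finset

theorem bzH (n : ℕ) (g : ℕ → ℝ) (a L : ℝ) (la : ℕ → ℕ) (h : ∀ i, i ≤ n → (n.choose i : ℝ) * la i = L) :
    bz n (fun i => g i * la i) a = L * ∑ i ∈ range (n+1), g i * (a^i*(1-a)^(n-i)) := by
  rw [bz_sum, mul_sum]
  refine sum_congr rfl fun i hi => ?_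
  rw [mem_range] at hi
  rw [← h i (by omega)]; ring

def l16 : List ℕ := [720720, 45045, 6006, 1287, 396, 165, 90, 63, 56, 63, 90, 165, 396, 1287, 6006, 45045, 720720]
def a16 (i : ℕ) : ℕ := l16.getD i 0
theorem a16_spec (i : ℕ) (hi : i ≤ 16) : ((Nat.choose 16 i : ℕ) : ℝ) * a16 i = 720720 := by
  have : ∀ i, i < 17 → Nat.choose 16 i * a16 i = 720720 := by decide
  exact_mod_cast this i (by omega)

theorem E3_H3 (d : ℕ → ℕ) (f : ℕ → ℕ → ℕ → ℤ) (s : ℕ)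
    (h : ∀ i j k, i < 17 → j < 17 → k < 17 → (d (i+17*j+17*17*k) : ℝ) ≤ f i j k * (a16 i * a16 j * a16 k : ℕ) / 2^s)
    (x y z : ℝ) (hx : 0 ≤ x) (hx1 : x ≤ 1) (hy : 0 ≤ y) (hy1 : y ≤ 1) (hz : 0 ≤ z) (hz1 : z ≤ 1) :
    E3 d x y z ≤ 720720^3/2^s * H3 f 16 x y z := by
  have h1 : E3 d x y z ≤ bz 16 (fun k => bz 16 (fun j => bz 16 (fun i => (f i j k * (a16 i * a16 j * a16 k : ℕ) / 2^s : ℝ)) x) y) z := by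
    unfold E3
    refine bz_mono _ _ _ _ hz hz1 (fun k hk => ?_)
    refine bz_mono _ _ _ _ hy hy1 (fun j hj => ?_)
    refine bz_mono _ _ _ _ hx hx1 (fun i hi => ?_)
    exact h i j k (by omega) (by omega) (by omega)
  refine h1.trans (le_of_eq ?_)
  have e1 : ∀ k j, bz 16 (fun i => (f i j k * (a16 i * a16 j * a16 k : ℕ) / 2^s : ℝ)) x
      = (720720 / 2^s * ∑ i ∈ range 17, (f i j k : ℝ) * (x^i*(1-x)^(16-i))) * a16 k * a16 j := by
    intro k j
    have := bzH 16 (fun i => (f i j k * (a16 j * a16 k) / 2^s : ℝ)) x 720720 a16 a16_spec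
    calc _ = bz 16 (fun i => (f i j k * (a16 j * a16 k) / 2^s : ℝ) * a16 i) x := bz_congr _ _ _ _ (fun i _ => by push_cast; ring)
      _ = _ := by
        rw [this, mul_sum, mul_sum, sum_mul, sum_mul]
        refine sum_congr rfl fun i _ => ?_
        ring
  simp only [e1]
  simp only [bzH 16 _ _ 720720 a16 a16_spec]
  have e2 : ∀ k, (720720 * ∑ i ∈ range (16+1), (720720 / 2^s * ∑ i_1 ∈ range 17, (f i_1 i k : ℝ) * (x^i_1*(1-x)^(16-i_1))) * a16 k * (y^i*(1-y)^(16-i)))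
     = (720720 * ∑ i ∈ range (16+1), (720720 / 2^s * ∑ i_1 ∈ range 17, (f i_1 i k : ℝ) * (x^i_1*(1-x)^(16-i_1))) * (y^i*(1-y)^(16-i))) * a16 k := by
    intro k
    rw [mul_assoc, sum_mul]
    congr 1
    refine sum_congr rfl fun i _ => ?_
    ring
  simp only [e2]
  rw [bzH 16 _ _ 720720 a16 a16_spec]
  unfold H3
  simp only [mul_sum, sum_mul]
  refine sum_congr rfl fun k _ => sum_congr rfl fun j _ => sum_congr rfl fun i _ => ?_
  generalize x^i*(1-x)^(16-i) = p, y^j*(1-y)^(16-j) = q, z^k*(1-z)^(16-k) = r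
  ring

section
variable (D : Dat) (S2 : ℕ)

def zW (OF : ℤ) (w0 : ℕ) : ℤ :=
  Wg D OF Int.add Int.mul (fun z => z) (Int.ofNat (Nat.pow 2 w0)) (Int.ofNat (Nat.pow 2 (Nat.mul w0 17))) (Int.ofNat (Nat.pow 2 (Nat.mul w0 289)))
def zP (OF : ℤ) (w0 : ℕ) : ℤ :=
  Pg D OF Int.add Int.mul (fun z => z) (Int.ofNat (Nat.pow 2 w0))

/-- root box -/
def rV (OF : ℤ) (w0 w s M : ℕ) : ℕ := rp3 w0 w s M 17 17 17 a16 a16 a16 (VV w0 17 17 17 M (zW D OF w0))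

theorem ofN (w : ℕ) : Int.ofNat (Nat.pow 2 w) = 2^w := by
  show ((2^w : ℕ) : ℤ) = _
  push_cast; rfl

theorem root_val (OF : ℤ) (T M w0 w s n : ℕ) (h : bW D OF T M w0 = true) (hw0 : 0 < w0) (hn : n < w) (V : ℕ)
    (hV : Nat.beq (rV D OF w0 w s M) V = true) (hc : chk w 4913 n V = true) :
    Val w (2^n) (fun a b c => 720720^3/2^s * H3 (fW D OF) 16 a b c) ⟨V, 0,0,0,0,0,0⟩ := by
  obtain ⟨h1, h2, h3⟩ := fW_spec D OF T M w0 h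
  have hV := Nat.eq_of_beq_eq_true hV
  have hz : zW D OF w0 = ∑ k ∈ range 17, ∑ j ∈ range 17, ∑ i ∈ range 17, fW D OF i j k * (((2:ℤ)^w0)^i * (2^(w0*17))^j * (2^(w0*17*17))^k) := by
    have := h3 (R := ℤ) (2^w0) (2^(w0*17)) (2^(w0*289))
    simp only [Int.cast_id] at this
    rw [mul_assoc w0 17 17]
    refine Eq.trans ?_ this
    unfold zW
    rw [ofN, ofN, ofN]
    rfl
  have U := unpack w0 w s 17 17 17 M n hw0 h1 hn a16 a16 a16 (fW D OF) h2 (zW D OF w0) hz (by norm_num) (by norm_num)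
  have e17 : 17*17*17 = 4913 := by norm_num
  change chk w _ n (rV D OF w0 w s M) = true → ∃ d : ℕ → ℕ, Dig w _ _ (2^n) (rV D OF w0 w s M) d ∧ _ at U
  rw [e17, hV] at U
  obtain ⟨d, hd, hd2⟩ := U hc
  refine ⟨d, ⟨hd.eq, hd.le, hd.z⟩, ?_⟩
  intro x y z hx hx1 hy hy1 hz hz1
  simpa using E3_H3 d (fW D OF) s hd2 x y z hx hx1 hy hy1 hz hz1

/-! one variable -/
def ok1 (w mh : ℕ) : ℕ → ℕ → Bool
  | 0, _ => false
  | n+1, V => or (Nat.beq (Nat.land V mh) mh) (and (ok1 w mh n (cL w 32 1 1 V)) (ok1 w mh n (cR w 32 1 1 V)))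

theorem ok1_spec {w h B : ℕ} (hw : 32 ≤ w) (hh : h < w) (hB : B * 2^32 < 2^w) (n : ℕ) :
    ∀ (V : ℕ) (F : ℝ → ℝ), (∃ c, Dig w 32 33 B V c ∧ ∀ x, 0 ≤ x → x ≤ 1 → bz 32 (fun i => (c i : ℝ)) x ≤ F x) →
      ok1 w (mcst w 33 (Nat.pow 2 h)) n V = true → ∀ x, 0 ≤ x → x ≤ 1 → 2^h ≤ F x := by
  induction n with
  | zero => intro V F _ ho; simp [ok1] at ho
  | succ n ih =>
    intro V F ⟨c, hc, hF⟩ ho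
    have hw0 : 0 < w := by omega
    have hB2 : B < 2^w := by
      have : 0 < 2^32 := by norm_num
      nlinarith
    simp only [ok1, Bool.or_eq_true, Bool.and_eq_true] at ho
    rcases ho with ho | ⟨hl, hr⟩
    · intro x hx hx1
      have H := Nat.eq_of_beq_eq_true ho
      rw [hc.eq] at H
      have := acc_spec w 33 h hh c (fun i => lt_of_le_of_lt (hc.le i) hB2) H
      refine le_trans ?_ (hF x hx hx1)
      rw [← bz_const 32 (2^h) x]
      refine bz_mono _ _ _ _ hx hx1 (fun i hi => ?_)
      exact_mod_cast this i (by omega)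
    · have hL := ih (cL w 32 1 1 V) (fun x => F (x/2)) ⟨_, dig_L w 32 1 1 B V hw0 (by norm_num) hB hw c hc, ?_⟩ hl
      have hR := ih (cR w 32 1 1 V) (fun x => F ((1+x)/2)) ⟨_, dig_R w 32 1 1 B V hw0 (by norm_num) hB hw c hc, ?_⟩ hr
      · intro x hx hx1
        rcases le_total x (1/2) with h2 | h2
        · have := hL (2*x) (by linarith) (by linarith)
          simpa using this
        · have := hR (2*x-1) (by linarith) (by linarith)
          simpa using this
      · intro x hx hx1
        refine le_trans ?_ (hF ((1+x)/2) (by linarith) (by linarith))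
        have e := dR_bz 32 1 0 (by norm_num) (by norm_num) c x hx hx1
        simp only [zero_add, one_mul] at e
        refine le_trans ?_ e
        refine bz_mono _ _ _ _ hx hx1 (fun i hi => ?_)
        rw [if_pos (by omega)]
        
      · intro x hx hx1
        refine le_trans ?_ (hF (x/2) (by linarith) (by linarith))
        have e := dL_bz 32 1 0 (by norm_num) (by norm_num) c x hx hx1
        simp only [zero_add, one_mul] at e
        refine le_trans ?_ e
        refine bz_mono _ _ _ _ hx hx1 (fun i hi => ?_)
        rw [if_pos (by omega)]
        

def l32 : List ℕ := [4375865239200, 136745788725, 8822308950, 882230895, 121687020, 21729825, 4828850, 1300075, 416024, 156009, 67830, 33915, 19380, 12597, 9282, 7735, 7280, 7735, 9282, 12597, 19380, 33915, 67830, 156009, 416024, 1300075, 4828850, 21729825, 121687020, 882230895, 8822308950, 136745788725, 4375865239200]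
def a32 (i : ℕ) : ℕ := l32.getD i 0
theorem a32_spec (i : ℕ) (hi : i ≤ 32) : ((Nat.choose 32 i : ℕ) : ℝ) * a32 i = 4375865239200 := by
  have : ∀ i, i < 33 → Nat.choose 32 i * a32 i = 4375865239200 := by decide +kernel
  exact_mod_cast this i (by omega)

def rP (OF : ℤ) (w0 w s M : ℕ) : ℕ := rp3 w0 w s M 33 1 1 a32 (fun _ => 1) (fun _ => 1) (VV w0 33 1 1 M (zP D OF w0))

theorem pair_ok (OF : ℤ) (T M w0 w s n h m : ℕ) (hb : bP D OF T M w0 = true) (hw0 : 0 < w0) (hw : 32 ≤ w) (hn : n < w) (hh : h < w) (hB : 2^n * 2^32 < 2^w)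
    (hc : chk w 33 n (rP D OF w0 w s M) = true) (ho : ok1 w (mcst w 33 (Nat.pow 2 h)) m (rP D OF w0 w s M) = true) (x : ℝ) (hx : 0 ≤ x) (hx1 : x ≤ 1) :
    2^h ≤ 4375865239200/2^s * H1 (fun i => fP D OF i 0 0) 32 x := by
  obtain ⟨h1, h2, h3⟩ := fP_spec D OF T M w0 hb
  have hz : zP D OF w0 = ∑ k ∈ range 1, ∑ j ∈ range 1, ∑ i ∈ range 33, fP D OF i j k * (((2:ℤ)^w0)^i * (2^(w0*33))^j * (2^(w0*33*1))^k) := by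
    have := h3 (R := ℤ) (2^w0)
    simp only [Int.cast_id] at this
    simp only [range_one, sum_singleton, pow_zero, mul_one]
    refine Eq.trans ?_ this
    unfold zP
    rw [ofN]
    rfl
  have U := unpack w0 w s 33 1 1 M n hw0 h1 hn a32 (fun _ => 1) (fun _ => 1) (fP D OF) h2 (zP D OF w0) hz (by norm_num) (by norm_num)
  have e17 : 33*1*1 = 33 := by norm_num
  change chk w _ n (rP D OF w0 w s M) = true → ∃ d : ℕ → ℕ, Dig w _ _ (2^n) (rP D OF w0 w s M) d ∧ _ at U
  rw [e17] at U
  obtain ⟨d, hd, hd2⟩ := U hc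
  refine ok1_spec hw hh hB m (rP D OF w0 w s M) (fun x => 4375865239200/2^s * H1 (fun i => fP D OF i 0 0) 32 x) ⟨d, ⟨hd.eq, hd.le, hd.z⟩, ?_⟩ ho x hx hx1
  intro x hx hx1
  have e := bzH 32 (fun i => (fP D OF i 0 0 : ℝ) / 2^s) x 4375865239200 a32 a32_spec
  have e2 : bz 32 (fun i => (d i : ℝ)) x ≤ bz 32 (fun i => (fP D OF i 0 0 : ℝ) / 2^s * a32 i) x := by
    refine bz_mono _ _ _ _ hx hx1 (fun i hi => ?_)
    have := hd2 i 0 0 (by omega) (by norm_num) (by norm_num)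
    simp only [mul_zero, add_zero, mul_one] at this
    refine this.trans (le_of_eq ?_)
    ring
  refine e2.trans (le_of_eq ?_)
  rw [e]
  unfold H1
  rw [mul_sum, mul_sum]
  refine sum_congr rfl fun i _ => ?_
  generalize x^i*(1-x)^(32-i) = p
  ring
end
end Kiss

namespace Kiss
open Finset

section
variable (D : Dat) (S2 : ℕ)

def ptL (OF OF' : ℤ) : ℤ :=
  Int.add (Int.mul (3*4375865239200*720720^3) (Int.add (Int.mul (4^16) (sm Int.add (fun z => z) (fun k => Int.mul (D.A k) (Nat.ascFactorial 18 k)) 33))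
      (Int.mul (D.tau 0) (sm Int.add (fun z => z) (fun r => Int.mul (D.ep r) (D.ep r)) 17))))
    (Int.add (Int.mul (36764*3*720720^3*4375865239200) OF') (Int.mul (36764*36763*4375865239200*720720^3) OF))
def ptR (e e' : ℕ) : ℤ := Int.add (Int.mul (36764*3*720720^3) (2^e')) (Int.mul (36764*36763*4375865239200) (2^e))

theorem W3_12 (u v t : ℝ) : W3 D S2 u v t = W3 D S2 v u t := by
  unfold W3
  rw [show YY D S2 u v t = YY D S2 v u t from Yf_symm _ _ _ u v t]; ring
theorem W3_23 (u v t : ℝ) : W3 D S2 u v t = W3 D S2 u t v := by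
  unfold W3
  rw [show YY D S2 v t u = YY D S2 t v u from Yf_symm _ _ _ v t u]; ring

theorem W3_sort (B : ℝ) (h : ∀ u v t, -1 ≤ u → u ≤ v → v ≤ t → t ≤ 1/2 → 0 ≤ DD u v t → W3 D S2 u v t ≤ B) (u v t : ℝ)
    (hu : -1 ≤ u) (hu' : u ≤ 1/2) (hv : -1 ≤ v) (hv' : v ≤ 1/2) (ht : -1 ≤ t) (ht' : t ≤ 1/2) (hd : 0 ≤ DD u v t) : W3 D S2 u v t ≤ B := by
  have d1 : DD u v t = DD v u t := by unfold DD; ring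
  have d2 : DD u v t = DD u t v := by unfold DD; ring
  have d3 : DD u v t = DD v t u := by unfold DD; ring
  have d4 : DD u v t = DD t u v := by unfold DD; ring
  have d5 : DD u v t = DD t v u := by unfold DD; ring
  rcases le_total u v with h1 | h1 <;> rcases le_total v t with h2 | h2 <;> rcases le_total u t with h3 | h3
  · exact h u v t hu h1 h2 ht' hd
  · exact h u v t hu h1 h2 ht' hd
  · rw [W3_23]; exact h u t v hu h3 h2 hv' (d2 ▸ hd)
  · rw [W3_23, W3_12]; exact h t u v ht h3 h1 hv' (d4 ▸ hd)
  · rw [W3_12]; exact h v u t hv h1 h3 ht' (d1 ▸ hd)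
  · rw [W3_12, W3_23]; exact h v t u hv h2 h3 hu' (d3 ▸ hd)
  · rw [W3_12, W3_23, W3_12]; exact h t v u ht h2 h1 hu' (d5 ▸ hd)
  · rw [W3_12, W3_23, W3_12]; exact h t v u ht h2 h1 hu' (d5 ▸ hd)

theorem cc_inv (u : ℝ) : cc (inv u) = u := by unfold inv cc; ring

theorem fin_asm (hS : 0 < S2) (hlen : ∀ k r, k < 17 → (D.row k r).length ≤ 17 - k)
    (OF OF' : ℤ) (T M w0 T' M' w0' h s h' s' : ℕ)
    (hbW : bW D OF T M w0 = true) (hbP : bP D OF' T' M' w0' = true)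
    (hW : Cov h (fun a b c => 720720^3/2^s * H3 (fW D OF) 16 a b c) ⟨0, 0,0,0,0,0,0⟩)
    (hP : ∀ x : ℝ, 0 ≤ x → x ≤ 1 → 2^h' ≤ 4375865239200/2^s' * H1 (fun i => fP D OF' i 0 0) 32 x)
    (hpt : ptL D OF OF' < ptR (h+s) (h'+s'))
    (S : Finset (EuclideanSpace ℝ (Fin 20))) (hnorm : ∀ x ∈ S, ‖x‖ = 1)
    (hdist : ∀ x ∈ S, ∀ y ∈ S, x ≠ y → 1 ≤ dist x y) : S.card ≤ 36764 := by
  by_contra hcard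
  obtain ⟨S', hsub, hc⟩ := exists_subset_card_eq (s := S) (n := 36765) (by omega)
  have hS2 : (0:ℝ) < S2 := by exact_mod_cast hS
  have hin : ∀ x ∈ S', ∀ y ∈ S', x ≠ y → (inner ℝ x y : ℝ) ≤ 1 / 2 := by
    intro x hx y hy hxy
    have h1 := hdist x (hsub hx) y (hsub hy) hxy
    rw [dist_eq_norm] at h1
    have h2 := norm_sub_sq_real x y
    rw [hnorm x (hsub hx), hnorm y (hsub hy)] at h2
    nlinarith
  set α : ℝ := (2^(h'+s')/4375865239200 - OF')/(4^16*S2) with hα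
  set β : ℝ := (2^(h+s)/720720^3 - OF)/(3*(4^16*S2)) with hβ
  have hinv : ∀ u : ℝ, -1 ≤ u → u ≤ 1/2 → 0 ≤ inv u ∧ inv u ≤ 1 := by
    intro u h1 h2; unfold inv; constructor <;> linarith
  have hα' : 4^16*S2*α = 2^(h'+s')/4375865239200 - OF' := by rw [hα]; field_simp
  have hβ' : 4^16*S2*(3*β) = 2^(h+s)/720720^3 - OF := by rw [hβ]; field_simp
  have hpos : (0:ℝ) < 4^16*S2 := by positivity
  refine sum_arg (ee D S2) (g0 D S2) kap (g1 D S2) S' (fun x hx => hnorm x (hsub hx)) hin 33 (fun k => (D.A k * Nat.ascFactorial 18 k / S2 : ℝ)) (fun k => by positivity)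
    α β ?_ ?_ (by omega) ?_
  · intro u hu hu'
    obtain ⟨i1, i2⟩ := hinv u hu hu'
    have := hP (inv u) i1 i2
    rw [P_id D S2 hS hlen OF' T' M' w0' hbP _ i2, cc_inv] at this
    change P1 D S2 u ≤ -α
    have h3 : (2:ℝ)^(h'+s')/4375865239200 ≤ OF' - 4^16*S2*P1 D S2 u := by
      rw [pow_add, div_le_iff₀ (by norm_num)]
      calc (2:ℝ)^h' * 2^s' ≤ (4375865239200/2^s' * (OF' - 4^16*S2*P1 D S2 u)) * 2^s' := by gcongr
        _ = _ := by field_simp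
    have h4 : 4^16*S2*P1 D S2 u ≤ 4^16*S2*(-α) := by linarith
    exact le_of_mul_le_mul_left h4 hpos
  · intro u v t hu hu' hv hv' ht ht' hd
    change W3 D S2 u v t ≤ -(3*β)
    refine W3_sort D S2 _ ?_ u v t hu hu' hv hv' ht ht' hd
    clear hu hu' hv hv' ht ht' hd u v t
    intro u v t hu huv hvt ht hd
    obtain ⟨i1, i2⟩ := hinv u hu (by linarith)
    obtain ⟨j1, j2⟩ := hinv v (by linarith) (by linarith)
    obtain ⟨k1, k2⟩ := hinv t (by linarith) ht
    have inn : ∀ a : ℝ, 0 ≤ a → a ≤ 1 → Inn 0 0 a := fun a h0 h1 => ⟨Or.inl rfl, h0, by simpa using h1⟩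
    have := hW (inv u) (inv v) (inv t) (inn _ i1 i2) (inn _ j1 j2) (inn _ k1 k2) (by unfold inv; linarith) (by unfold inv; linarith)
      (by simpa only [cc_inv] using hd)
    simp only [W_id D S2 hS hlen OF T M w0 hbW _ _ _ i2 j2 k2, cc_inv] at this
    have h3 : (2:ℝ)^(h+s)/720720^3 ≤ OF - 4^16*S2*W3 D S2 u v t := by
      rw [pow_add, div_le_iff₀ (by norm_num)]
      calc (2:ℝ)^h * 2^s ≤ (720720^3/2^s * (OF - 4^16*S2*W3 D S2 u v t)) * 2^s := by gcongr
        _ = _ := by field_simp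
    have h4 : 4^16*S2*W3 D S2 u v t ≤ 4^16*S2*(-(3*β)) := by linarith
    exact le_of_mul_le_mul_left h4 hpos
  · rw [hc]
    simp only [geg_one, mul_one]
    have e0 : ∑ r, ee D S2 r * ee D S2 r = ∑ r ∈ range 17, (D.tau 0 : ℝ) / (4^16*S2) * (D.ep r * D.ep r) := by
      rw [← Fin.sum_univ_eq_sum_range (n := 17) (fun r => (D.tau 0 : ℝ) / (4^16*S2) * (D.ep r * D.ep r))]
      apply sum_congr rfl; intro r _
      unfold ee
      have := Real.mul_self_sqrt (sk_nonneg D S2 0)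
      have h2 : sk D S2 0 = (D.tau 0 : ℝ) / (4^16*S2) := by unfold sk; simp [Nat.ascFactorial]
      rw [← h2]
      linear_combination (D.ep r * D.ep r : ℝ) * this
    rw [e0, ← mul_sum]
    have s1 : sm Int.add (fun z => z) (fun k => Int.mul (D.A k) (Nat.ascFactorial 18 k)) 33 = ∑ k ∈ range 33, (D.A k : ℤ) * (Nat.ascFactorial 18 k : ℤ) := by
      rw [← sm_eq]; rfl
    have s2 : sm Int.add (fun z => z) (fun r => Int.mul (D.ep r) (D.ep r)) 17 = ∑ r ∈ range 17, D.ep r * D.ep r := by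
      rw [← sm_eq]; rfl
    unfold ptL ptR at hpt
    rw [s1, s2] at hpt
    have hpt2 : ((3*4375865239200*720720^3) * ((4^16) * (∑ k ∈ range 33, (D.A k : ℤ) * (Nat.ascFactorial 18 k : ℤ)) + D.tau 0 * ∑ r ∈ range 17, D.ep r * D.ep r)
       + ((36764*3*720720^3*4375865239200) * OF' + (36764*36763*4375865239200*720720^3) * OF) : ℤ) < ((36764*3*720720^3) * (2^(h'+s')) + (36764*36763*4375865239200) * (2^(h+s)) : ℤ) := hpt
    have hpt' := (Int.cast_lt (R := ℝ)).mpr hpt2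
    clear hpt hpt2
    rw [← sum_div]
    push_cast at hpt' ⊢
    generalize (∑ k ∈ range 33, (D.A k : ℝ) * (Nat.ascFactorial 18 k : ℝ)) = SA at *
    generalize (∑ r ∈ range 17, (D.ep r : ℝ) * D.ep r) = SE at *
    have key : 4^16*S2*(SA/S2 + D.tau 0/(4^16*S2)*SE) < 4^16*S2*((36765-1)*α+(36765-1)*(36765-2)*β) := by
      have l1 : 4^16*S2*(SA/S2 + D.tau 0/(4^16*S2)*SE) = 4^16*SA + D.tau 0*SE := by field_simp
      have l2 : 4^16*S2*((36765-1)*α+(36765-1)*(36765-2)*β) = 36764 * (4^16*S2*α) + 36764*36763/3*(4^16*S2*(3*β)) := by ring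
      rw [l1, l2, hα', hβ']
      generalize (2:ℝ)^(h+s) = p at *
      generalize (2:ℝ)^(h'+s') = q at *
      linarith
    exact lt_of_mul_lt_mul_left key hpos.le
end
end Kiss

namespace Kiss

def cr : List (List (List ℕ)) := [
 [[36887554659843554187, 37001690420928441500, 36102977676592121556, 40029687927948703934, 29429891428895976236,
  47909118128935379213, 25450550528673148907, 45837297432871884156, 32405996986674387607, 37578336750764180865,
  37424755892654051127, 36500794736421661691, 37025596331687954452, 36870478021534251931, 36894982515261262904,
  36893519862743707684, 36893485128063059400],
 [36887818030563945000, 36874746004187842749, 37196688570401058226, 35225243333780880638, 41161176315960589338,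
  31677467851132998534, 37432467329539083145, 43284309078572511344, 28999583896685981191, 41291943996176745641,
  35844245174696647472, 36809701673982756757, 36976532336107283188, 36886805352543824624, 36892250531277822801,
  36893531808707184689, 36893502096833011080],
 [36906606956911490100, 36811373856609385607, 37453148007195414775, 34726081682665709533, 41337377613068731788,
  31354555462977996686, 40759016868377874753, 36728958703989849374, 35253194678560403179, 37818703591238693427,
  36680910238346383340, 36890571234410337076, 36902468913829828140, 36893814611831314966, 36893031605822289520,
  36893403357648460213, 36893496743520660429],
 [36901152367074293191, 36847201124736306892, 37177454291120566327, 35054041061678846916, 42496755315344685272,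
  27602172787884619776, 45866469889880887080, 33464700474818343103, 35257137428362938617, 38707306679351399614,
  36551218326926873367, 36835389694238985129, 36918861742203538584, 36891381799436942463, 36893023855585875773,
  36893396174613582082, 36893489793243997034],
 [36905806435754576291, 36827277428951876946, 37438093166119920858, 33840108351451425582, 45522303020937537510,
  23095875709715686150, 48111987006103527559, 35290004432182834850, 32653293546398029603, 39820520277735383882,
  36541706655465252627, 36669514188898242160, 36946858123977964323, 36894707303492112443, 36893581100259482426,
  36893421050030351983, 36893481630639791882],
 [36892069928770724869, 36847845371757040747, 37371848964197109034, 34453498338166494390, 43774009086382468046,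
  26381775142099907760, 45699975339711887600, 34289489633185813141, 35035850669365582029, 38507214778734048943,
  36543120820053154964, 36785275705692510093, 36950124626974524515, 36894951191122685790, 36893231710663554307,
  36893409628202456710, 36893481785611778434],
 [36894156779105139852, 36906488749348352891, 36717484860755303086, 37953377862662676272, 33412725667575242806,
  43177173601439291533, 30066424983118474377, 41246547776315573591, 36099751278287529374, 36320534720857363818,
  37164927371747252891, 36833355500782619787, 36894305102810307884, 36897303329838334852, 36893593673688060715,
  36893448048244035405, 36893486326169061455],
 [36894016130300391705, 36847091976957250511, 37439861238761149339, 33900562937204608259, 45724798073843030244,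
  22532414318994048910, 49766301090234503616, 31844251905136495952, 35086923418394550716, 39465171403182560059,
  36279205596379830383, 36849000407850862630, 36921626204036522890, 36885655487959979223, 36893533857772553892,
  36893640035243712073, 36893488995897065040],
 [36896737620454105377, 36911674584445107589, 36461332897155406654, 39271636292412001373, 29406617470498968655,
  51964617260439458395, 18446744073709551616, 50619140144007026510, 30411822015903216136, 38398818855510550205,
  37058623621613490052, 36806894874702867098, 36888126625613922284, 36892023423016220087, 36893720973305468542,
  36893539384129593870, 36893488244764775495],
 [36893314980477979982, 36866244695032272644, 37303887958740709741, 34494732484184128791, 44434638675456529806,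
  22676443062085237634, 53254011643110452457, 25905875680076358133, 40587436549940722813, 36762425282823908772,
  36583227159386051444, 36958877302084128996, 36902788670161413431, 36891139782994531087, 36893317920850830393,
  36893503390221183017, 36893488732991901903],
 [36893139814285396684, 36919616664939570033, 36545682807578773646, 38885250209372794919, 30734658080787978266,
  48183171860271765200, 24375852233657847295, 44804318639530034614, 34722012373806638953, 36611702568721155333,
  37208404466317834092, 36844838607986875253, 36886242958282540724, 36895493268149966345, 36893528798520066478,
  36893472842013358446, 36893488022367879754],
 [36893656410248972546, 36886317323185695757, 36980886694726796680, 36401967135643303686, 38420181110150979951,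
  34027247555080961356, 40273949335531214305, 34418977195973630329, 37933107992906283798, 36696373933362624437,
  36886573474176447945, 36903524257523976698, 36891618342958977245, 36893487025401400469, 36893524339109649065,
  36893487434426229914, 36893488060037700972],
 [36893747004180260297, 36888605830867634318, 36928703318764830181, 36762956349480073423, 37176534743070583425,
  36509142134978857466, 37220724588828275992, 36736556432109743344, 36924417672144527389, 36891055983687288542,
  36896749413728759942, 36892881322478350028, 36893200402858323492, 36893524050789643634, 36893493686968683816,
  36893487937310899508, 36893488133729765619],
 [36893524092795883921, 36890978214874074695, 36933437901894722306, 36614673532915731278, 37929195476704885898,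
  34668785351274581993, 39742346092212846043, 34753561705028828400, 37739012637966607778, 36803814068237602586,
  36845953166029273443, 36906579487412203835, 36893968025493588547, 36893182976341639900, 36893487309703518421,
  36893489741559668467, 36893488155148890409],
 [36893665730769973939, 36889509595630995066, 36927835649102059946, 36740781491959707903, 37289614423725013524,
  36244657634429047075, 37601142522908855545, 36379417443432514967, 37113655775122793529, 36863034436014301904,
  36880802184006817861, 36897538987692877836, 36893649013112153433, 36893390789607233670, 36893486845339385860,
  36893488648373880222, 36893488152604862343],
 [36893372065303842127, 36896419336726035990, 36865082639590790435, 37032589885063856435, 36515057517003113749,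
  37478723101080786175, 36401156112924664810, 37074505507735845405, 36906006870435339775, 36868309792002664812,
  36896053645661837330, 36894610914557877760, 36893377301834162983, 36893467040636419437, 36893489002155432250,
  36893488253501190902, 36893488147296436434],
 [36893537831749303125, 36892149285468453484, 36907452059170020521, 36819027594708545088, 37117937848108896187,
  36497585940969608381, 37296403912004679729, 36678183729793177943, 36931238212168468034, 36906589584938450182,
  36888276667937971376, 36893357033084141115, 36893653030071041495, 36893488133254763545, 36893486577074407773,
  36893488134114741312, 36893488149328759743]],
 [[36921855490893746019, 36674329364445406184, 38453558459357546998, 31093656388490788186, 48816465172014883970,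
  22617954151263998344, 46863161500017077024, 33751797767308886953, 36597549368650860592, 37096325589828109673,
  37149570327434409464, 36812609427923565372, 36874418172348225113, 36898958350415302507, 36893334459720566542,
  36893499707751030615],
 [36899648093531270109, 36723111664918142472, 38389826082840882492, 30621451862431145428, 50624897099139063289,
  18446744073709551616, 51249046635096725383, 32674292935157517868, 35673495874971627755, 37744245694661697398,
  36779679297016290926, 36909268725133982960, 36891268304067818138, 36890964538670357624, 36894268937065006406,
  36893509123507977955],
 [36897974112140187989, 36929910352079175391, 36759242956383122976, 37655606675944405935, 36015784665649403394,
  35171835371255804923, 41507169361897184362, 32520688184448360246, 38943585699492896257, 36498722052810863494,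
  36776394422853432734, 36920128008521859096, 36896196786143083509, 36895611573171247456, 36892937130105241985,
  36893507224660308075],
 [36867618960711180435, 36989591554892081986, 35970472002447010449, 41835159955205664878, 24741455903541117705,
  53313672408444908580, 23306689836456486850, 43374791102404542812, 36079721877958381534, 36544273853984906509,
  37085239331249573547, 36832422942740446125, 36882262435101760419, 36895297234185962944, 36893476108251061319,
  36893501850404791874],
 [36906055152378574666, 36846295472089392118, 37526646529258609831, 34540486849267697312, 40713509020074236680,
  33113594155105023054, 37413490692240619576, 39322947723056720670, 35173962321500361618, 37189558105475518933,
  37064699541355443016, 36829957808657904452, 36896731844048301074, 36896366298659972313, 36892862571767308862,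
  36893473932293473646],
 [36880906565791940065, 36796942432551180948, 37378087605404351541, 37121057396992215980, 32492943140963637238,
  48696592714592286010, 21632793099358844691, 47658985120685612810, 32811604901167863333, 36908564961366814235,
  37361604229940406385, 36834521203328134276, 36880303374357781233, 36898323515165362068, 36893265517278669569,
  36893457954792383810],
 [36905079087822220080, 36822393384989219906, 37282917082737361379, 36033748967639174533, 36058453889062469547,
  41878655362538861573, 28745590356163477538, 45019305861609990550, 32792862708240457408, 37408326308472267112,
  37185344570716870741, 36771747262955521251, 36888071219490026631, 36899769755126415278, 36893522660946785813,
  36893459555716069294],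
 [36894486176436487726, 36713211429863910301, 38367979390407384870, 32096190760250075759, 44649080644747138269,
  32228967036489749973, 33786884223349741456, 41874012168515494657, 35425469899942592171, 36730831614394134685,
  37075592532869140738, 36848398216047187747, 36883292578578637379, 36896105045025830047, 36893656807452427871,
  36893479098680784608],
 [36897671199307539696, 36840293110432605037, 37339437407503917988, 35146972830747779564, 39387552339554277433,
  36964436436259078315, 33478308499423238230, 41087266190713634977, 34266722038075761501, 37174658348018019611,
  37288001435473699284, 36832243684919690805, 36872116674534911639, 36894942863043121044, 36893743571888288208,
  36893487027786440519],
 [36888793239871199752, 36943762882751097959, 36578369610580970791, 38574069017855971564, 31027038919248447603,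
  48588216203065099883, 23866970573431938815, 44379479530889123899, 35590036419460390435, 36291136252560947163,
  37092489154437863813, 36919734564138574991, 36885750107254884303, 36892916947095862678, 36893544804334608424,
  36893490137711535896],
 [36893539443029468862, 36904123743310691095, 36785217371941977391, 37246228240380260645, 36510912917570640115,
  36672755019663676184, 37882460174125521725, 35719542296033866791, 37549398168977458717, 36828161037754031470,
  36816108488942702130, 36910984153165833011, 36895496692606388794, 36893106016638693044, 36893471004935298811,
  36893488917618934371],
 [36893353872007593579, 36885463204901581575, 37021735175607400601, 36188054950902044963, 38790614171684438591,
  34101411986690150045, 39213819464488515339, 35887810084796840675, 36988114489984732808, 36997494334151722772,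
  36858746621126426736, 36892532217787791591, 36894648834946112869, 36893478767304568862, 36893480056910893364,
  36893488128623382822],
 [36894297223660389713, 36882279823843463261, 36960447468800205810, 36610488217794683921, 37833643857675198117,
  34872458073849305722, 39258173501429147558, 35677472158600548529, 36895612862317062041, 37094776897321578649,
  36856106029276120287, 36886345674319468496, 36894812426319176235, 36893582256758877426, 36893480447398946347,
  36893487928440597701],
 [36892110716879709308, 36921323961265147961, 36672975153249576458, 37802936811547177022, 34715718011278378337,
  40066997395636413726, 34067715234875297008, 38346211986422230405, 36556367286740563279, 36870349531897288566,
  36918177209511717967, 36891554458614911361, 36893047635370246564, 36893521129917684493, 36893490347854353274,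
  36893488100259919534],
 [36894462201495441891, 36876559156090898235, 36995145976499134482, 36661370595178545853, 36863968651775448226,
  37961155776262528642, 34955594678566418268, 38376138255458304132, 36447553246424443492, 36872573445533779815,
  36925638387598649553, 36891546011643734420, 36892849884554559103, 36893516820347083729, 36893491447876015288,
  36893488120506826962],
 [36893214111014214234, 36899653966529105683, 36839693609676763010, 37133103196928783011, 36293366292651647315,
  37763241425935409846, 36182485884484220537, 37181128573880559000, 36869846553497577271, 36875017325706677041,
  36897318654713521333, 36893826441961493043, 36893403423028362112, 36893485329457571602, 36893488525135287366,
  36893488153051712995]],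
 [[36868414886304923965, 37300233112777490474, 34662953479668753594, 43616009546847545733, 25037017703777364779,
  50928447319571453652, 25791984770871790865, 41927269544732783860, 36118056310211761162, 36855900298428145505,
  36885497320145949511, 36891032912974403178, 36896448211013310872, 36893005984120675959, 36893603276065210635],
 [36862749853789226380, 37019200685617285690, 35724382848347376256, 40360456125321238519, 31811733577525240892,
  40935954894881265670, 35851929418626207863, 35379791315513436960, 38536937475607550586, 36469236617389412428,
  36845100328676231060, 36922192605818267660, 36890288881468938226, 36894123521931818094, 36893494918602797827],
 [36890209617773647173, 37283570775778482176, 35851149547737854775, 36898661847540455304, 39602670186724809211,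
  34053610095430327579, 37925019523877965327, 35850473117267244076, 37368572888609261508, 37106862145464431925,
  36760031951486181203, 36887262269207397411, 36903534182667421411, 36893043472372880532, 36893459083446902266],
 [36871849048928992278, 37375417681709669428, 34080340003567806477, 44712529788932263239, 22469613959655023206,
  53224941766717992603, 27148361533375142037, 39382385910203303906, 37492411664673765108, 36492930167272823837,
  36853512996836178319, 36921303566312731546, 36892972285440144331, 36892186767552946587, 36893548556262583813],
 [36897889097111907103, 37104182312889401710, 36449498040432177293, 36126786153095689051, 39836318132393785327,
  31982547398576297513, 41254280374735391062, 35356007591696093916, 36993716670684715657, 37061053910551480714,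
  36823853241884398234, 36885374454570319249, 36897263217056331923, 36893320372195862527, 36893481956085528885],
 [36869108223561763295, 37166866888370374665, 34726640739122206983, 44467870240725942489, 22696703965263775307,
  53855814069482681495, 25982893159099457876, 38763127029070638158, 37797711930496458599, 36473882317792000338,
  36894844793112543302, 36936426991819239624, 36894157124099117744, 36892224004394132951, 36893474884904405334],
 [36894986708773838199, 37011550367430077363, 36336784794688388083, 37733352084961251838, 36527068026717461377,
  35316078904135035648, 39852252978885027426, 36001464303297342189, 36336199829546164979, 37048365361723183553,
  36896528638972110117, 36897925786417067827, 36895386182559804227, 36893227448652703027, 36893474102687932518],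
 [36875755989472949511, 37125214167459878664, 35180733276945204683, 43230874503373442193, 25270388436783832487,
  48218587696729654436, 31203018871685755859, 36860508103797592160, 38402701577817644360, 36636329045801620543,
  36749972835424556830, 36902853241998640524, 36899174773073728789, 36893464208106217404, 36893466535515575983],
 [36860086905251159255, 37440405261116593092, 33808844537906789339, 45034357032598544668, 25609819428551942107,
  45100045472374103525, 35000399011534825334, 35338759456280051253, 37891240026588907016, 36894501417028460581,
  36823532214505227613, 36892866762572234063, 36895115129677229914, 36893529960574083778, 36893484016214597353],
 [36902826474958416355, 36738502370327506173, 37823621389385158549, 34184210582340181621, 41187919002913096301,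
  33087508397490610725, 38485661164318926598, 37032306994050758132, 36530712354733385148, 36944621328848789012,
  36921616123221603476, 36888925160025474299, 36892964352080093543, 36893531676621034009, 36893489662786600692],
 [36858784152746697440, 37503240021695273424, 32971606866734945635, 48869332056633144725, 18446744073709551616,
  50235217174440150945, 34357885674385721465, 35330832888734384253, 37429587467666673564, 36964450240675309839,
  36872441858552785680, 36890903857043768655, 36893679288698315642, 36893512536699387039, 36893488183763820389],
 [36896377447672351851, 36840757788296422116, 37234813633481588452, 35893935902521610899, 38213073813215022522,
  36421063120647090322, 36395375146228970151, 37288725587665195633, 36908972926667742559, 36831406301042624850,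
  36900349545456404516, 36895289517315969535, 36893339046247487343, 36893475450857679636, 36893488393157648205],
 [36901011842676383657, 36774528647952379607, 37602256053810398468, 34831498598990937568, 40027365071890926079,
  34499127691572387259, 37589398751250366855, 36988070210108404177, 36831825898494069608, 36885688882370202034,
  36896638491167578293, 36893788492140122702, 36893441180726703120, 36893485382926136646, 36893488214474901831],
 [36891590194875748364, 36922618048694040698, 36732353356224944106, 37284011064840003689, 36566422484113035549,
  36607251443875503121, 37655373728147407178, 36357408571360085921, 37020158613450711451, 36905000962915233370,
  36886431664943306127, 36893616565083602308, 36893575546241298840, 36893487096351771466, 36893488002815757548],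
 [36894247361204846216, 36879162113375083446, 36998262290595237614, 36503709110190456517, 37702477696332726565,
  35935746481455972066, 37515000559953185500, 36709509009338736667, 36893433015654374640, 36904505812935227975,
  36892348089350897445, 36893313062299601523, 36893504219163851385, 36893488954476171986, 36893488125755605936]],
 [[36811422143313042306, 38324683521398644843, 31423696452230854655, 47101984548324315953, 23745649713723435951,
  45175272974796938146, 36759222779016187398, 35726377053573999967, 37256190054038678519, 36831625157095321986,
  36882321231408085049, 36903339310719966909, 36893289362452742703, 36893545764292463310],
 [36915088705686381417, 36571804980855393301, 36061841287788089325, 43004606970831604207, 23836236502475164688,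
  51272592907221748727, 27793808038050106973, 40835372505528893460, 35155498809184371541, 37122508422049164975,
  37034971417850347351, 36858802845826909512, 36894925584881499307, 36894013624404446459],
 [36941001962316765970, 36580914188249409344, 41635916660298853579, 21799974885819151163, 55340232221128654848,
  28914613389798437563, 35116522031769295264, 38588631058264305840, 37266755990688425750, 36486607305310822455,
  36901796868784349456, 36931566270647429295, 36886857034585776509, 36893686608480545394],
 [37006107418154929104, 35304323229236325276, 42709120032840168972, 26498484309825494550, 46435359432153672294,
  33635798286886723495, 33794653752050086692, 41741727803721764370, 35496191727457678814, 36487677974402928732,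
  37075155116977938554, 36886114005767583886, 36888185377953512191, 36893817682417644976],
 [36917257673567520156, 36998900879547673841, 35854898109416906020, 40629673666122473406, 32109991357560312691,
  36614110750817730340, 40224488091982179936, 35790111991304829207, 36523598259512328198, 37013936171236862688,
  36954319188744393582, 36890650539053933643, 36889887426373480156, 36893571469029462291],
 [37013303776266163436, 35549836299900011668, 41147195621521231432, 31144454094666617590, 41710103353375291508,
  33456393118788430905, 37472380761592503297, 38839703037991912860, 35831725871604405682, 36673678876747023529,
  36995419460219074947, 36919520031436283672, 36889350983766930837, 36893372979157514345],
 [36894873289459374533, 36898491478646012309, 37191772618636226890, 35682813755751677932, 37966938704967049691,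
  37231583840128407664, 36083064814415743846, 37306124309950266838, 36970349107594609553, 36766851293667572636,
  36887209958418294999, 36905237393263045688, 36893066379239550530, 36893435201790959440],
 [36976006284193218100, 36213648663859722763, 38068161705673359657, 37911560013812655060, 35292457442159933592,
  32859225709855899279, 42045563551422449775, 36292015310846023185, 36279090894571020376, 36897710102405014613,
  36927743125013453035, 36896318235140275172, 36893033825506869652, 36893470320895674893],
 [36875013563724582297, 36836591955755701663, 38508653487653585581, 30792744878314967689, 44683346964440027227,
  35418953050383377478, 33753425913884565286, 38013653291742622784, 37299676331125830118, 36791414238555745482,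
  36862000676640332276, 36897304292848205654, 36893853899285571297, 36893477866167122725],
 [36891976369741243844, 36872707360406998060, 37162713553531729927, 35964880175367921503, 38157347262050565250,
  36370356225282873872, 36646543638116905896, 37104070767096735946, 36884052074411775039, 36880909942380332862,
  36893986660467460833, 36893722458553599845, 36893487729497937925, 36893487602380407292],
 [36891586884797473475, 36951772807516753742, 36469529985795745536, 38111286847959314253, 35446967161944079681,
  37266411275622343597, 37386958500094816674, 36636428695132081495, 36843874666696989141, 36931509930308017608,
  36891966394685294259, 36892761227587439666, 36893508460268981568, 36893489829620102936],
 [36891064811282749686, 36923613997913461671, 36750461675876858074, 37241451115841651689, 36388204999519092994,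
  37392312396805833608, 36537992726279613960, 37057017509832605383, 36858918015686310184, 36892253900016490662,
  36894758598241688610, 36893437137504566853, 36893480325902648977, 36893488275240860282],
 [36899015734403556986, 36818302455636935021, 37272887427097987465, 35992421411165769236, 37905527220213624899,
  36532680992019250551, 36650598152536311173, 37130922544781457014, 36841738917848141142, 36889298435221005078,
  36895334369453193661, 36893484122776961605, 36893476745165218984, 36893488157238153805],
 [36890948258552962535, 36933770784836094691, 36646509354075581827, 37659222601020670104, 35582721286979855626,
  38150327149473470954, 36256358579228550669, 37024519290628186849, 36903614082552734904, 36886720996355005896,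
  36893756262495184158, 36893561236323404745, 36893485943733546402, 36893488034409587497]],
 [[36975284713312379529, 36368806623656485568, 37785855212737906546, 39332677721650595595, 29923502245291450066,
  42570965348515486268, 35435929256839039823, 36429803050897290736, 37204701391643751676, 36880172613545298613,
  36889550038083599771, 36892016818662286816, 36894279610068247772],
 [36989955724519671821, 36584549817172249714, 35540543900393515697, 42647329569863137723, 31334099995416708593,
  37291657273015770416, 37542846894586186882, 37062033012827304009, 36873388785272661198, 36812311035159837718,
  36889866777860794179, 36900365175288224773, 36893643038255168521],
 [36782129556182978702, 37726082376647508180, 36900919476412578245, 33041420335574480578, 41683003068594890061,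
  37268250961857973468, 33297532446586386646, 38295029132978955840, 37080932308866214477, 36732722676169988367,
  36918436082385225365, 36889274170826642816, 36893960292434379527],
 [37113975284031920957, 34917969583574393374, 41401947267797478960, 29955431323681973717, 50829681442733068471,
  18446744073709551616, 47749281256581227846, 35408052066368509188, 36186787165347915190, 37061520622301531854,
  36905451204037278764, 36886645026174865443, 36893859796873380084],
 [36953219835052924358, 36831907231996771579, 35710551947619610191, 41525060503667583516, 31843030345790993387,
  37031000707787302722, 38189095554307983051, 36995916898084987886, 36792547254222438617, 36848136501636020674,
  36908530070888789671, 36891192010127358902, 36893552392481786773],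
 [36908505590693633011, 36151106480527411380, 40737996184579509832, 27510781178630015009, 49121531892147324404,
  29589067148705350943, 38818421699011635703, 36285086235024138272, 36829766796013856509, 37049762450940892202,
  36891802240205216853, 36888190760649909828, 36893564101943094426],
 [36848362594490355648, 37105991016085313839, 37111258305072923562, 35072627126182892229, 38610264929810953838,
  37458483297919316540, 35911603925033222087, 37021944728964326760, 36940338854964967882, 36893969480125499216,
  36893505771894335199, 36893226110669178428, 36893487564975925475],
 [36913673575906973464, 36815584230727545540, 36742121003476040957, 37637833088382788828, 36585318432713928944,
  36013789918735823580, 37580406935877728721, 36919046687665321809, 36819325185843972033, 36885689669747784831,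
  36897863047367091323, 36893490961622427487, 36893472009204452151],
 [36889995805451455507, 36914595467383002627, 36921673049933959383, 36530314606102738843, 37613360176892431572,
  36433214703375919770, 36869553162630235906, 36987661133259129381, 36888317162466857111, 36886086495180545102,
  36894175481854602158, 36893555685744643041, 36893485809281239496],
 [36890660341566826771, 36911261285509846528, 36855927040090745120, 36961583744452796900, 36714008160696201625,
  37153869184035460117, 36758429922234566708, 36882931193078241428, 36918385427854886597, 36889356971055162409,
  36893225612768443177, 36893534702820595331, 36893488524923163238],
 [36896554579524085883, 36872229949357312089, 36918217752557170803, 36997211005093427128, 36602289101024989817,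
  37128418252217176291, 36875768324655664473, 36838740348178088554, 36912683244761252067, 36892972943804433634,
  36893143459229024479, 36893500590809775010, 36893488858060431645],
 [36891532757017317840, 36911977072202784017, 36840271078095541354, 36913110409606857592, 37053069508702363256,
  36595173961075304837, 37108203326950770368, 36829950189237976248, 36896395050360459268, 36895096767691439116,
  36893346816168450048, 36893480726915276857, 36893488456983799441],
 [36896423284436559834, 36854352987186348535, 37094258266854554270, 36376927974880810210, 37617494053210080810,
  36337803697618086868, 37108799767862693918, 36865251252202613056, 36889022085359276329, 36894679391436048911,
  36893488132712386973, 36893481235262461695, 36893488176832535749]],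
 [[36997774185885064615, 37505230548758613615, 31074421515362850629, 52636303886135380263, 20692723541500248550,
  42458306255572159381, 37410834482300763598, 36750159921616261418, 36648969053289730205, 37017454100665073690,
  36876626912747115383, 36892492073013505834],
 [36836645453683134738, 37171471186083270849, 35538280498230212841, 38721672793770160842, 35517122842785322929,
  37594606117692678475, 37077326415025342322, 36552702775692953945, 37094848143627426128, 36803489640324430336,
  36904106516105315358, 36894311826405189219],
 [36579146991326412246, 37471279680627539601, 41717799104983619551, 22300794070276313478, 50919084325443978375,
  30190467642045730095, 41577786769764245781, 34517208427545704793, 36853789156662448622, 37095627061660918661,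
  36861987107998601289, 36895250573315030893],
 [36642983636505030665, 39128282137076154641, 30060569069356146129, 45860746257980082197, 30702866483504470804,
  37936275905389863826, 39244845662461523413, 35345652349411104702, 37185846861749281482, 36923863725659016792,
  36870848027701923688, 36895004866700357657],
 [36649538187068324724, 37514116087217549730, 41629874004911955392, 19973158153137361939, 55340232221128654848,
  29141035605726663472, 38227203918327703638, 36360191507942824596, 36971093520110474805, 37017845962437550056,
  36864271994977363719, 36894041826904513157],
 [36852475728860348314, 36262676700141553972, 40862635144280625775, 30097008559272031138, 40804713784226857026,
  35784456850181370615, 38348517641764625655, 36196555998729596837, 36720372823094597563, 37004427567369525820,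
  36885762724100668556, 36893200635879405244],
 [36894641496846912041, 36789007266214049937, 37481139315545010210, 35745825346015077200, 37816530213748131789,
  36593292724973774906, 36946798195187281861, 36883857282292831768, 36885341639659646122, 36896883247433901817,
  36893338179864220356, 36893476679982024614],
 [36899546558349998288, 36880032422493787314, 36762772584222609467, 37412965385658070376, 36277069339755040150,
  37088242824042239629, 36958848484813588212, 36872834106518984894, 36882739859834332858, 36896176594002222375,
  36893497023605025491, 36893478600819256603],
 [36901877208655231170, 36932395925895368802, 36381267890219694338, 38269985267199788298, 35474587496131322525,
  37392426969788886219, 36930586771198571267, 36868661507695179960, 36884079450756960295, 36895667045039365323,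
  36893533026148891741, 36893480432150315966],
 [36892909202637923940, 36873074716535617338, 37064301906730457507, 36435796044005234168, 37396272805529084867,
  36721997162842192692, 36823090314905191509, 36950817281835350541, 36884610490595388325, 36893080100441749944,
  36893583372438749035, 36893488126113855346],
 [36897524964668900433, 36859201961516753655, 36990062522453850461, 36805612296590500526, 36840320265024293339,
  37041738566472835817, 36798885662536065471, 36915066717331415980, 36893230265752022917, 36893119275327232339,
  36893503057152908777, 36893488791731810451],
 [36887067646493170018, 36965331338814459367, 36586318242163944688, 37544983303944067201, 36153452211996189296,
  37340909989594934373, 36764871595034258857, 36902593974649987379, 36895956420142260222, 36893179553009238345,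
  36893481584660738631, 36893488774741593966]],
 [[36167742912140095635, 40762949363070010676, 32060809090203884336, 32393023505293760031, 46922046367884062402,
  33473777694370798250, 36566219443095810590, 36587563119346357854, 37277416431913847907, 36841589901146331091,
  36896679593320081674],
 [37510124663866744613, 36570250744794514214, 29215700292580520337, 50322580857979973272, 33427383198742272627,
  33416095798058154224, 37360341925129564196, 37202668091445698688, 37109603833844302679, 36822427697929143495,
  36896302169999235684],
 [37631296377943502943, 36395157501624942351, 28344141465167263791, 55340232221128654848, 30635567761736764146,
  30388931119830572028, 40767235108072440754, 36009794855401301155, 37117647562177965323, 36848773870370854667,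
  36897767870456621422],
 [37184683433882004459, 36716436744056604987, 33326835352228492253, 43436963680969395229, 34897123456002176215,
  35448576409672945353, 37174773587874884234, 37002180719761259175, 36985371713901834904, 36861311034711130869,
  36894702393555876904],
 [37131230549070339259, 36546725873981681538, 34908123942854705634, 41180848276730582516, 35446948725523294804,
  35819680117948640092, 37145373235376050037, 36992147257541442933, 36940368306973834031, 36874878155675019510,
  36894095762277541870],
 [36864747720188519257, 36961376975218889666, 37091564976259866370, 36232349560133823286, 37403390517315038099,
  36857826724540894903, 36844977630489719582, 36880265411769013413, 36902914619003116910, 36892750321711124441,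
  36893469642559530552],
 [36835486076873278018, 37086652928861918908, 37025420160169083221, 35989566135355754966, 37676701406797244418,
  36806497427683948187, 36843616653371199065, 36865380397966543686, 36907776142124746429, 36892621803397099705,
  36893451354154418027],
 [36878401371194595342, 36926899607626199023, 36984900808582599067, 36629884985635932126, 37045316008732912114,
  36903759949539197036, 36897297335008810113, 36873194243935764622, 36898807815214107446, 36893336033435233773,
  36893471863768477405],
 [36908009698998141970, 36835821256181944441, 36884516091480129057, 37142434043767679101, 36624222152510937318,
  36908100208675925169, 36982675142979762475, 36858628577767038467, 36896354736117748013, 36893685576315597426,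
  36893476245173422166],
 [36883759903046532509, 36951897913897118635, 36811285849756942805, 36796192642393940880, 37235633096354934043,
  36581236088107555665, 37010454463791089623, 36878732250157823363, 36892852703869170122, 36893644547759310090,
  36893487165234560339],
 [36909159998897192842, 36746880504559555265, 37412589503562863196, 35994539716593787172, 37709413153278459908,
  36513295667313282597, 36971240198316826209, 36891653628983175390, 36892368087920917601, 36893548820294458137,
  36893489628410548903]],
 [[35761775342315210814, 40544036108570133602, 29714176281580779272, 49380429253310304788, 24983041432116729534,
  37111990104824234435, 40596129179782819937, 35899460091215718660, 36985646288352175392, 36894273984283059072],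
 [37100126112309743897, 38231782792214834585, 28289001893611624900, 50644534469899920479, 29811345839243411596,
  36991674639394855176, 36771853013472428548, 37269310714154905527, 36832711573435357629, 36896784715671019677],
 [37892169825429790353, 37365187156641334397, 25032964662653433833, 55340232221128654848, 30418044672219364849,
  37127605899874119555, 34559147347691329483, 38175854636061471993, 36728938412757884911, 36899230004874906229],
 [36876167307741428857, 36725951150007768651, 37930059773918910531, 35112455131687708316, 37946069429125106009,
  36726850500676334030, 36999933284199926875, 36805183291805478557, 36908121876296475194, 36893305484411920362],
 [36924339117309599380, 36812912116752494714, 36973387407051648039, 36685580564908538914, 37186209577306200371,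
  36862197890398554730, 36762651284127277110, 36953103378803661438, 36886776006924034715, 36893535303584345549],
 [36896088773116106560, 36949055621332454131, 36599017595552376998, 37330172207439295678, 36695647279594778287,
  36881125432237533856, 36903664268092885525, 36899284111872113567, 36892083610351721276, 36893517136698673985],
 [36914609723390150524, 36867206139615282150, 36874843821415878338, 36689180041058484774, 37393923641257025843,
  36576121896858403469, 36933411920245176476, 36906844621237819354, 36891220574383652182, 36893501967865001132],
 [36884479295512843415, 36892831898478530890, 37056036430704081781, 36520106783887468443, 37186289109799882279,
  36829033985326454761, 36877840658190776859, 36899829876134385919, 36893161611721352772, 36893474834586093788],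
 [36902867649477695505, 36864740788054205410, 36837829390593906879, 37188495163983718452, 36500582744461126480,
  37115609004887391775, 36840893052455179057, 36896771405770981237, 36893750841956494333, 36893473453344116185],
 [36857264885947763034, 37175041679764520223, 36075501042920839132, 38034707785115434481, 36081847473346832775,
  37176212380522713225, 36854813945179148445, 36893075321362266752, 36893820872897747559, 36893482670456491803]],
 [[36560256805578651755, 41868327234079176942, 22554386574544932822, 49878085831157835991, 36895596511297787272,
  31842241325649607289, 39317557163069307618, 36658855427517368851, 36899113627468618037],
 [36589869260970006351, 41790855674057150581, 20709994328931400130, 55340232221128654848, 29284833219109364220,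
  35831301196283771447, 38168849702136791757, 36742360576936193803, 36898323114581826716],
 [37437001602031725299, 31485042755182986234, 51646699087662979017, 22560361004661332333, 39239266519525452995,
  40863056325087998763, 34831831947029820107, 37152893624284500919, 36893024381429160016],
 [37328142373536535563, 33999805770392050112, 45637186813362440304, 22707195969726853669, 48693237658314698780,
  32272671612171295012, 37621072776572194022, 36865258745405919226, 36893003343270305702],
 [37435741270572367931, 33863617524886697814, 46005911069140606621, 21313134506810115357, 50670095187272882404,
  30967755453617627302, 38014877144847918659, 36824495261705458052, 36893167595198675325],
 [37127798384245922104, 33772987518134021647, 45528963255941891516, 27797243979843104673, 41468827917618979571,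
  35316343866933994494, 37353616104895308507, 36828313465864169936, 36895207884205879232],
 [37012985843743409405, 36731041547252809617, 37126031518619867323, 34948123582381565011, 40398535939629950179,
  34644879471569658990, 37441701121125884747, 36855176512495280612, 36893078627947395543],
 [36474610144879103729, 38466611405476445622, 36034078454902005475, 34301323713466348107, 40610060858609724392,
  35166421973137523311, 37184684422066046561, 36884104839640911925, 36892898970653667293],
 [37824227264499989210, 30936757798101432975, 50909916148431796928, 21430447747384225841, 45275898031494618641,
  34805566716474506322, 37066798840880105691, 36898830658856330365, 36892902925318205560]],
 [[37288210614711351859, 39829288238163474864, 23494002304716018542, 55340232221128654848, 25410830396247035049,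
  40496957023685392003, 36419118601262812840, 36908529000112334633],
 [36886441297224141684, 36650913774562954477, 37805789563457449840, 35700200842971963886, 37620368281307944180,
  36674537839243244678, 36921663444917724856, 36892758424913409102],
 [36887704738007424868, 36889369644843873632, 36966067465251248575, 36758555334479782953, 37001311131680043785,
  36854622266620947483, 36898393691623333729, 36893441385150737892],
 [36914536698503845103, 36853236310698257924, 36874675873358928600, 36964374870985723243, 36838916425891187901,
  36918182614773346049, 36887571903943569925, 36893909921008979370],
 [36919682167872235675, 36819133629121088546, 36975909755636262056, 36844018833037991104, 36898870933043457107,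
  36904005799727645036, 36889722677368622003, 36893743845832537326],
 [36871014172118792461, 36993792606000072637, 36716586677405482850, 37057727159068552470, 36808385984654292823,
  36916072109574971549, 36891080120828484111, 36893535521618439870],
 [36891901563602335033, 36932614255957675156, 36756929618926194908, 37070814180072866242, 36793293646042287424,
  36917376106981730310, 36891627048716227772, 36893489324858473084],
 [36858662855529279945, 37074673787656697359, 36554430264009451564, 37181506255386760961, 36779238904376567757,
  36912465821249890637, 36892684663426918779, 36893462100410565384]],
 [[33426203551158813458, 55340232221128654871, 20684755303309687937, 33751372781800038599, 40906571276352446492,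
  36990613821241261613, 36760449557255122530],
 [36371013645597053484, 39583637902518662672, 33779966285491465318, 37727207472283238965, 36922182729739330229,
  36938594051134589326, 36881083361278908828],
 [36801488501227763801, 37250656678981179726, 35739049438363723361, 38338220640765980509, 36302983600727911290,
  36938998146113255019, 36898799488298906099],
 [37038879273469707288, 36005843447669458873, 37763420227277114749, 36880696996441281832, 36811581703815696987,
  36863192735577982622, 36901484025505714912],
 [36956711564962210556, 36807448533601000011, 36880400841170546846, 36887790659399280999, 36942885923750123985,
  36874021722992647087, 36895042965277445361],
 [36845860107485012442, 36920272328035876834, 37128157880748229482, 36547949508902090031, 37054984337119055129,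
  36867476840161094327, 36894445215650626169],
 [37148186323291657555, 35835511109179262197, 38427411495544618012, 35929104548561375400, 37155782038777014285,
  36867850523974014754, 36893860431938136810]],
 [[33491778962326629013, 48565027442507847994, 23745084180909681160, 42595420637048391492, 36117337443658385415,
  36907659323843100795],
 [35167513839128959835, 43041887090903203156, 29239347261909556293, 40455422075861210242, 36310380380969699699,
  36928217011723288127],
 [38679481348740170399, 32922750556103842962, 41829536132803726440, 34333249205088880054, 37041945706452831767,
  36969466571048781331],
 [38683362234879255807, 28340700156618940674, 47572490925229320802, 32541571163406523107, 37300203812836901532,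
  36918418999383567380],
 [38763451810205967838, 32722898020184321380, 39154168416503089743, 37047779680795174233, 36625162565000149843,
  36922216350569927682],
 [31609717261643214095, 53969089180719232761, 18446744073709178309, 44948016936711617161, 35559808031610668368,
  36950431792813171237]],
 [[37347175447846097720, 36488755719626943219, 36812279183419336325, 37323741741898981262, 36858659873247887911],
 [36822645262549242310, 34037110438457551743, 37039513519794945592, 36870013431957879426, 37231950572163975993],
 [36418295289371140284, 39440346308374528950, 36704890343655551635, 35376093585347349828, 37278023614967499003],
 [30334674625390562013, 46568952578544255711, 34804927086318996918, 35795737022772460504, 37141930672007641730],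
 [44520507331931363951, 18446744073249914515, 50834969726550817012, 33133190316915383994, 37177284210098629212]],
 [[37734202952667115507, 36372610953616867336, 38206668331081285364, 37028985057089767936],
 [37003215381223748836, 34409993473509451790, 37905462018092239745, 37016084638957978251],
 [31742153443420488935, 49259027319927703760, 29164150208509255572, 38145003286331404707],
 [26042456646798571935, 55340241698474006437, 28212662946922678194, 37978591297481156362]],
 [[37374479316911780601, 38543492411510511315, 37615553894304894733],
 [30645695742017100333, 37976167784011673305, 38042869160247611926],
 [54313753769580700529, 18361290677034425257, 40970571590903732387]],
 [[37160994671867749262, 37253242545387253418],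
 [34429368634660409138, 38125547903798450279]],
 [[36924502766809790599]]]

def ct : List ℕ := [8015998745584302409754930077779273577991504, 128646735075418064449633964990706692110481,
  1728174465872966132820758683671394056149, 5486699039571923816177835759333721520,
  63381840579768658714586141460669785, 196595432132819181514706771088090,
  254303742594682445188794482001, 493381250131161855757246939,
  2426849032994681178964, 7223113650573211837370,
  301488651498613237, 1778612499894,
  330418243, 468087,
  51, 1,
  1]

def ca : List ℕ := [0, 91036807611029167541233003464792294068469092913978673615053,
  28680565692429282123546964567522445154181667658289071447476, 1463073392613210605021118782874863942862485237434691442632885,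
  820332694190288329344583497253580053353250559180970175554, 24955919898691954904715724415089639378388829823256263945659,
  24839627267423029476129849895846385163984387906059987883, 95781677630866146711557281157914759813749566134962624745,
  4778223246410421758971887938741245980387383286648833, 32798532311473395539556535197315678381956535607957,
  7345084977243621250462926177310556432552861649, 163295113358732309306185361039355267139437758,
  11738152680103407642856984587854399195712847, 4974475472890166177880173581718395307903231,
  22000398662826852860081239355050764418689, 326357091274918728609604568739266666845,
  11027270807072055224022864156896610403, 465235692217221125060443381494549483,
  13227592794811255518146441448293247, 314216167573729783392872899332734,
  8312227435857173391150875815543, 231696224584206038660256424241,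
  5951057211636300953509881315, 146302754908577695618589887,
  3568620767277987875707072, 85718180733478325733538,
  1984822158753265562611, 45231704148185445210,
  1000424615542881232, 21785553369505300,
  463128148281217, 9684475108870,
  197016750163]

def ce : List ℕ := [36921137905358396070, 36893488147419103232, 36893488147419103232, 36893488147419103232, 36893488147419103232,
  36893488147419103232, 36893488147419103232, 36893488147419103232, 36893488147419103232, 36893488147419103232,
  36893488147419103232, 36893488147419103232, 36893488147419103232, 36893488147419103232, 36893488147419103232,
  36893488147419103232, 36893488147419103232]

def cz (c : ℕ) : ℤ := Int.subNatNat c 36893488147419103232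
def dD : Dat := ⟨fun k r => (((cr.getD k []).getD r []).take (17-k)).map cz, fun k => ct.getD k 0, fun k => ca.getD k 0, fun r => cz (ce.getD r 36893488147419103232)⟩

def cOF : ℤ := 91289089052094141878289420441486053422164410813130157025489847563200864499372276
def cOF1 : ℤ := 59586068216715152527679947981593447770501436496207784440837482426915884797103970
def cM : ℕ := 25727373730988828034880703211264724597365405390770118120725482136123244918707433543857792024576
def cM1 : ℕ := 255935970971656780711085025987185539849304162074165478536094102871967766088402797705827003

theorem hlen (k r : ℕ) (_ : k < 17) : (dD.row k r).length ≤ 17 - k := by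
  show ((((cr.getD k []).getD r []).take (17-k)).map cz).length ≤ _
  rw [List.length_map, List.length_take]; exact Nat.min_le_left _ _

def cT : ℕ := Nat.pow 2 316
def cT1 : ℕ := Nat.pow 2 300
def cS : ℕ := Nat.pow 2 220

theorem hbP : bP dD cOF1 cT1 cM1 300 = true := by decide +kernel
theorem hcP : chk 114 33 81 (rP dD cOF1 300 114 227 cM1) = true := by decide +kernel
theorem hoP : ok1 114 (mcst 114 33 (Nat.pow 2 80)) 5 (rP dD cOF1 300 114 227 cM1) = true := by decide +kernel
theorem hbW : bW dD cOF cT cM 316 = true := by decide +kernel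
def cV : ℕ := rV dD cOF 316 82 260 cM

theorem hcV : chk 82 4913 65 cV = true := by decide +kernel
def r0 : St := ⟨cV, 0,0,0,0,0,0⟩

noncomputable def cF : ℝ → ℝ → ℝ → ℝ := fun a b c => 720720^3/2^260 * H3 (fW dD cOF) 16 a b c

theorem hVV : Nat.beq (rV dD cOF 316 82 260 cM) cV = true := by
  unfold cV; exact Nat.beq_refl _

theorem hv0 : Val 82 (2^65) cF r0 :=
  root_val dD cOF cT cM 316 82 260 65 hbW (by norm_num) (by norm_num) cV hVV hcV

theorem nx {st : St} (v : Val 82 (2^65) cF st) (q : ℕ) : Val 82 (2^65) cF (stp 82 q st) := v.step (by norm_num) (by norm_num) q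

theorem cv {st : St} {t : T} (v : Val 82 (2^65) cF st) (k : ok 82 (mcst 82 4913 (Nat.pow 2 64)) t st = true) : Cov 64 cF st :=
  ok_spec (by norm_num) (by norm_num) (by norm_num) t st v k

open T in
def t0 : T :=
  X (Y (Z (X (Y (Z D (X D (Z D (Y S D)))) (Z S (X (Y D (Z S (Z P (Y P (Y (Z (X D (Y D (Z S (X D P)))) (X D (Y (X D P) (X D P)))) (Z S (X D (X (Y (Z D (X D (Y D P))) (Z S (X D P)))
  P)))))))) (Y P (Z S (Y (Z P P) P)))))) (Y S (Z S (X (Y (Z P (X (Y P (Z P (Y P (X P (Z P P))))) (Z (Y S (Z P P)) (Y S (X (Y P P) P))))) (Z S (Y (Z (X (Y (Z P (X P (Y (Z P P) (Z (X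
  P P) (X (Y P P) (Y P P)))))) (Z S (X (Y (Z P P) P) (Y (Z (X (Y (Z P P) (Z S P)) (Y P P)) P) P)))) (Y (Z (X P P) P) (Z S P))) (X (Y (X P (Z (Y (Z P P) P) P)) P) P)) (Z S (X P (Y P
  (X P (Z S P)))))))) (Y S (Z S (X (Y (Z (X (Y (Z (X (Y P P) P) P) P) P) P) (Z S (X (Y P (Z S P)) P))) (Y S (Z S P))))))))) (X (Y (X (Y (X (Y (Z D D) (Z D (Z D (Y D (Z D P))))) (Y
  S (Z D (Z (X D (Y S (Z D D))) (X (Y (Z D P) (Z (Y D P) P)) (Z (Y S P) P)))))) (Y (Z D (Y (X (Z D P) (Z (X D (Y (Z D (Z D P)) (Z D P))) P)) (X P (Z (X (Y (Z D P) P) (Z (Y (X D (Z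
  D P)) P) P)) P)))) (Z P P))) (Y S (Z (Z P (X (Y (X (Y D P) P) P) P)) (X (Y (Z (X (Y (X (Y (Z D (Z (X (Y D (Z D P)) (Z D P)) P)) (Z (Z D (Y D (X D (Z D P)))) P)) (Z (Y S (Z (X D
  (Z D D)) (X (Y (Z D P) P) P))) P)) P) P) P) (Z P (Z P (Z P (X P (Z P (Y P P))))))) (Z (Y S (Z (X (Y P (Z P (X P (Z P P)))) (Y S (Z P (Z (X P (Y S P)) (X P P))))) P)) (Y S (Z P (Z
  P (Z P (X (Y (Z P (Z P (X P P))) P) P)))))))))) (X (Z (Y P (Y P (Z (Y (X (Z D P) P) (Z (X (Z D P) P) P)) P))) (Y (X P (Z P P)) (Z (Y (X P (X P (Z P P))) (Z P (X P (Z P P)))) (Z P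
  (Z P (X P (Z P (X P (Y P P))))))))) (Z (Y (X P (Z (Y P (X P (Z P P))) P)) (Y (X (Z P (X P (Y (Z P (X P (Z P P))) (Z P (X P (Z P P)))))) (Z (Y (X P (Z P (X P (Z P (Y P P))))) (X P
  P)) (X (Z P (Y (X (Z P P) P) (Z (X (Y P P) P) P))) (Z P P)))) (Z (X P (Z P P)) (X P (Z (Y P (X (Z P P) (Z P P))) P))))) (Z (X (Y (X (Y P (Z P P)) (Z (Y (X P (Z P (Y P P))) (Y (Z
  P P) P)) (Y P (Y (Z P P) (Z (Z P (Y P P)) P))))) (Y (Z P (X P (Z P P))) (Z (X P (Z P (Z P (Y P P)))) (Z (X (Z (X P (Z P P)) P) (Z (Z (Y P P) P) P)) P)))) (Y (Z (Y (X (Z P (X (Y P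
  (Z P (Y (Z P P) (Z P P)))) (Z P (Y P (Z P P))))) (Y (Z P (Z P P)) (Z P P))) (X (Y (Z P P) P) P)) (Y P (Y (Z P P) (Z (Z P (Y P (X (Z P P) (Z P P)))) P)))) (Z (Y P P) (Y (Z (Z P P)
  P) (Z (Z P P) P))))) (Y (Z P (Y (Z P (X (Z P (Y (X P P) (X P P))) P)) (X P P))) (Z P (Z P (X (Z P (X (Y P (Z P (X (Z P (Y P P)) (Z P (Y P P))))) (Y P (Z P (X (Z P (Y P P)) P)))))
  (Y (Y (X P P) (X (Z P P) (Z P P))) (Z P (X (Z P (X (Z P (Y P P)) (Y P P))) (Z P (X (Y P P) (Y P P)))))))))))))) (Y S (Z (X (Y (Z (X (Y P (Z P P)) (Y S P)) (X (Y (Z P P) (X P (Y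
  (Z (Y (Z P P) (Z P P)) P) (Z P P)))) (Y S (Z (Z P P) P)))) (X (Y (Z (X (Y (Z P P) P) P) (Z P P)) (Z (Z (X (Z P P) (Z P P)) P) (Z (Y (Z P P) P) (X (Y P P) P)))) (Z (Y P (Z P P))
  (Z (Y (Z (X P P) P) (Y (Z P P) P)) P)))) (Y S (Z (Y (X (Z P P) S) (X P P)) (Z (Y (X P S) (X P P)) (Y (X P S) (X P P)))))) (Z (X (Y (Z (X (Y (Z P P) P) P) (X (Y (Z (X (Y P (Z P
  P)) (Z (Y S (Z P P)) P)) P) (Z (Y (Z (Z P P) P) (Z P P)) P)) (Z (Y S (Z (Z P P) P)) P))) (Z (Y P (X P P)) (Y (X (Z (Z P P) P) (Z P P)) (X (Z (Z (X (Z P P) P) P) P) (Z (Z P (Y P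
  P)) P))))) (Y S (Z (X (Y (Z P P) P) P) (X (Y P (Z (Y P P) P)) (Y S P))))) (Z (Y (X P S) (X P P)) (Y (X (Z P (X (Y P P) P)) S) (X (Y P (Z P (X (Z P (X P (Y P P))) (Y P P)))) (Z P
  (X (Y P P) (Y S (Z P (X P P))))))))))))) (Z S (X (Y (Z (Z (Y (X P (X (X P (Y P (Z S P))) (Y (Z P P) (Z S P)))) S) (X (Y P (Y (X P (Z P P)) P)) (Y (X P (Y (Z (X (Z P P) (Z P P))
  P) (Z (X (Z P P) (Z P P)) P))) (X (Y (Z (Y (Z P P) (Z S P)) P) P) (Y (Z (Y (Z P P) (Z S P)) (X P (Y P P))) (Z S P)))))) (Z (X (X (Z (Y P P) (Y (Z P P) P)) (Z (Y P P) (Y (Z (Y (Z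
  P P) P) P) P))) (Z (Y (X (Y P P) (Y P (Z P (Y P (X P (Y P (Z P P))))))) (X P (Y (X (Z P P) (Z P (Y (Y (Z P (X P P)) P) P))) P))) (Y (X (Z (Z (Y (X (Z P (Y (X P (Y P P)) P)) (Z P
  (Y (Y P P) P))) (Y P (X P P))) P) P) (Z (Y (Z (Y (Z P P) (X (Z P P) (Z P P))) (X P P)) (Z P P)) P)) (X (Z (Y (X (Z P P) (Z P P)) P) P) (Z (Y (Z (X (Y P (Z P (X P (Y P P)))) (Y P
  P)) (X (Z (Y P (X (Y P P) (Y P (Z (Y (X P P) P) P)))) P) (Y P P))) (Z P P)) P))))) (X (Y P P) (Z P (Y (Z P (X (Z P (Y P (X P (Z P (Y P P))))) (Z P (Y P (X (Z P (Y P (Z P (X (Y P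
  P) (Y (Z P (X P P)) P))))) (Z P (Y P (Z P (X (Y P P) (Y P P)))))))))) P))))) (Z S (X (Y (Z (X (Y (Z (Y P (Z S P)) P) (Z S P)) (Y (Z (Y P (Z S P)) (Z P P)) (Z S P))) P) (Z S (X D
  (Y D D)))) (Y (Z (Y (Z (Y P (Z S (X (Y P (Z S (X P (Y P (Z S P))))) (Y P (Z S (Y P (Z S (X P P)))))))) (X (Z (Y P (X (Z P P) (Z (Y P (Z (Y P P) P)) P))) P) (Z (Y P (Z (Y P (X (Z
  (Y P P) P) (Z P P))) P)) P))) (Z S (X P (Y (Z (X (Z (Y (Y (Z P P) P) S) P) (Y (Z (Y (Z (X (Y P P) (Y (Z P P) P)) P) P) P) P)) P) P)))) P) (Z S (Y (Z P (Z P (X D (Z P (Y (X (Z P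
  (X D (Z P D))) (Z P (Z P (Y P (X (Z P (Y P D)) (Z P (Y P (X (Z P (Y (X D P) D)) (Z P (Y P (Z P (X (Y P (Z P (Y (X D P) D))) P)))))))))))) (Z P (X D (Y (Z P (X D (Y (Z P (X D (Z P
  (Y (Z P (Y (X D P) (X D (Z P (Y P (Z P D)))))) D)))) D))) D)))))))) (Z S (Y (Z P (X D (Z P D))) (Z S D))))))))) (Y (Z (X (Y (Z (Y (Z (X (Y (Z (X P P) P) P) P) P) (Z S P)) (X (Z
  (Y (Z P P) (X (Z P P) (Y P (Z P P)))) P) (Z (Y P (Y P P)) P))) (X (Z S (X (Y (Z P P) P) (Y (Z (Y (Z P P) P) P) P))) (Z S (Y (Z (Z P P) P) P)))) (Y (Z (Z P P) (Z P P)) (Z S (Z (Y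
  (X (Y P P) P) S) P)))) (Z (Z (X (Y (X P (Z P (X P (Y P P)))) (X (Y (X (Y P P) P) P) (Y (Z P P) (X (Z P (Y (Z P P) P)) (Z P (Y (Z P P) P)))))) (Y (Z P P) (X (Y P P) P))) (X (Y (X
  (Y (Z P P) (Z P P)) (Y P (Z P P))) (Z (X (Z (Y P P) P) (Y (Y (Y (Z P P) P) P) P)) (X P P))) (X (Y P (Z (Y P P) P)) (Y P P)))) (Z (X (Y (X P (Y P P)) (X P (X (Y P P) P))) (X (Y P
  P) (Y P P))) (X (Z (Y (X P (Y P P)) (X P P)) (Y (X (Z P (Y P (X (Z P (Y P (X (Z P (Y P P)) P))) P))) (Y (X P (Y P P)) P)) (X (Z P (X (Y (Z P (Y (X P (Z P (Y P P))) P)) P) (Y (Z P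
  (Y (X (Z P (Y (Z P (X (Y P P) (Y P P))) P)) (Z P (Y (X (Z P (Y P P)) P) P))) P)) P))) (Z P (X (Y (Z P (Y (X (Y P P) (Y P P)) P)) P) (Y (Y P P) P)))))) (Z (X (Y P P) (Y P P)) (X
  (Y (Y (X (Z P (Y P P)) P) (Y P P)) (Z P (X (Y (Y P P) P) (Y P P)))) (Y (Y P P) P))))))) (Z S (Y (Z (X (Y (Z P (Z (Y P (X (Z P P) P)) P)) (Z S (X (Y (Z (Z (Y (X (Y (Z (Y (Z (X (Y
  P (Z S P)) (Y P (Z S P))) P) P) P) P) (Z (Y (Y (Z P P) (Z S P)) S) P)) S) P) P) P) (Y (Z (X (Y (Z (Y (Z P P) (Z S P)) P) P) (Y (Z (Y (Z P P) (Z S (X P P))) P) P)) P) P)))) (Y (Z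
  P (X (Z (Y P P) (Y P P)) (Y P (Z P P)))) (Z S (X (Y (Z (X (Y (Z P P) P) P) P) P) P)))) (Z (X P P) (X (Z P (X (Y P (Z P (X P (Y (Z P (X P (Z P (Y P P)))) P)))) (Y P (Z P (X (Y (Z
  P (X (Z P (Y P (Z P (Y (X P (Z P (Y P P))) P)))) (Y P (Z P (Z P (Y (X (Z P (Y P P)) P) P)))))) P) (Y (Z P (Y P P)) P)))))) (Z P (Y (X (Z P (X (Y P (Z P (X P (Y P (Z P (X P (Y P
  P))))))) (Y P (Z P (X (Y P (Z P (X (Y P (Z P (Z P (Y P P)))) (Y P P)))) (Y P P)))))) (X (Y P P) P)) (X P (Y (Z P (X P (Y (Z P (X P P)) P))) P))))))) (Z S (X (Y (Z P (Z P (X (Z P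
  (Y P (Z P (Y (X (Z P (X (Y P (Z P (Y (Z P (X (Z P (Y (X (Z P D) P) (X D P))) P)) (Z P (X (Y (Z P (X D P)) D) P))))) P)) P) (X (Z P (Y (X (Z P (Y (X D (Z P (X (Y P (Z P D)) P)))
  (X D (Z P (X D P))))) P) (X (Z P D) (Z P (X (Y P (Z P (X D P))) P))))) P))))) P))) (Z S (X (Y (Z P (Z P (X (Y (Z P (Y (Z P (X D (Z P (X (Y (Z P D) D) (Y P (Z P (X (Y P D)
  P))))))) (X D (Z P (X D (Z P (Y (X D (Z P (Y P D))) D))))))) (Z (Y P (X D P)) (X D (Y (Z P D) D)))) (Y (Z P (X (Z P (Y P (X (Z P (Y P (X (Z P (Y P D)) P))) P))) P)) (Z P (X (Y (Z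
  P (X (Y (Z P (X D (Z P (Y P D)))) (Z P D)) (Y P (Z P (X (Y P (Z P D)) P))))) (Z P (X D (Y (Z P (X D (Y P (Z P (X D P))))) (Z (X D P) D))))) (Y P (Z P (X (Y P (Z P (X (Y P (Z P (X
  D P))) P))) P))))))))) (Z S (X (Y (Z (Y P (Z S D)) D) D) (Y (Z P (Z (X (Y P (Z (Y P D) D)) P) (X (Y (Z (X D (Y P D)) D) D) (Y (Z P (X (Y (Z P (X D (Y P (Z P (X D P))))) (Z (X D
  P) D)) (Y P (Z P (X (Y P (Z P (X D P))) P))))) (X (Z (Y (Z P D) D) D) (Z P (Y (X (Z P (Y (Z (X D P) D) D)) (Z P (Y P (X (Z P D) P)))) (X D (Z (Y P (X D P)) (Y (X D (Z P D))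
  D)))))))))) (Z S (X D (Y (Z (X (Y (Z P D) D) (Y P (Z S (X D P)))) (X D (Z (Y (X D (Z P (Y P D))) D) D))) (Z S D)))))))) (Y P (Z S (X (Y (Z P (X (Z P (Y P (X (Z P (Y P (X (Z P (Y
  P (X (Z P D) P))) P))) P))) P)) (Z S (X (Y (Z P (X (Z (Y P (X (Z P (Y P D)) P)) (Y (X (Z (Y P (X D P)) (Y (X D (Z P D)) D)) (Z P (Y P (X (Z P D) P)))) (X D (Z (Y P (X D P)) (Y (X
  D (Z P D)) D))))) (Z P (Y P (X (Z P (Y P (X (Z P D) P))) P))))) (Z S (X (Y (Z (X D (Y (Z P (X D P)) (Z S D))) D) D) (Y (Z P (X (Z (Y (X (Z P D) P) (X D (Z P D))) (Y (X D (Z P D))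
  D)) (Z P (Y P (X (Z P D) P))))) (Z S (X D (Y (Z (X (Y P D) P) (X D (Z P D))) (Z S D)))))))) (Y P (Z S (X (Y P (Z S (X (Y P (Z S (X (Y P D) P))) P))) P)))))) P)))))) P)))))))) (Y
  S (Z S (X (Y (Z (X (Z (Y P S) (Y P P)) (Y S (Z S P))) (Z (X (Y (Z P P) (Z P P)) (Y S (Z P P))) (Z (X (Y P (X P P)) (Y S P)) (X (Y (Z P (X (Y P P) P)) (Z (X P P) (X P P))) (Y S
  P))))) (Z S (Z (Y (X (Y (Z P (X P P)) (Z S (X (Y (Z P P) P) P))) (Y (Z P P) (Z S P))) S) (Y (Z (X (Y (Y (X P P) P) P) (Y P P)) (X (Y (Z P (X P P)) (Z P (X (Y P P) P))) (Y P (Z P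
  (X P (Y P P)))))) (X (Y P (Z S (X P (Z P (Y P (X P (Y P (Z S (Y P (Z S (X P P))))))))))) (Z P (Y P (Y P (Z S (X (Y P (Z S (X P (Y P (Z S (Y P (Z S (X P P)))))))) P)))))))))) (Y S
  (Z S (X (Y (Z (X (Y (Z P P) (Z S P)) (Y S (Z S P))) (Z (X (Y P P) P) (Z (X (Y P P) P) (X (Y P P) (Y S P))))) (Z S (Y (Z P (Z P (Z P (X P P)))) (Z S (Y (Z P (X P P)) (Z S (X P (Y
  P (Z S (X (Y P (Z S (X P P))) P)))))))))) (Y S (Z S P))))))))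
theorem k0 : ok 82 (mcst 82 4913 (Nat.pow 2 64)) t0 r0 = true := by decide +kernel
theorem hcov : Cov 64 cF r0 :=
  (cv hv0 k0)

theorem cvv {h V : ℕ} {F : ℝ → ℝ → ℝ → ℝ} (H : Cov h F ⟨V,0,0,0,0,0,0⟩) : Cov h F ⟨0,0,0,0,0,0,0⟩ := fun a b c h1 h2 h3 => H a b c h1 h2 h3

theorem hcov0 : Cov 64 (fun a b c => 720720^3/2^260 * H3 (fW dD cOF) 16 a b c) ⟨0,0,0,0,0,0,0⟩ := cvv (V := cV) hcov

theorem hpair (x : ℝ) (h0 : 0 ≤ x) (h1 : x ≤ 1) : 2^80 ≤ 4375865239200/2^227 * H1 (fun i => fP dD cOF1 i 0 0) 32 x :=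
  pair_ok dD cOF1 cT1 cM1 300 114 227 81 80 5 hbP (by norm_num) (by norm_num) (by norm_num) (by norm_num) (by norm_num) hcP hoP x h0 h1

theorem hmain 
 (S : Finset (EuclideanSpace ℝ (Fin 20))) (hnorm : ∀ x ∈ S, ‖x‖ = 1)
    (hdist : ∀ x ∈ S, ∀ y ∈ S, x ≠ y → 1 ≤ dist x y) : S.card ≤ 36764 :=
  fin_asm dD cS (by decide) hlen cOF cOF1 cT cM 316 cT1 cM1 300 64 260 80 227 hbW hbP hcov0 hpair (by decide +kernel) S hnorm hdist

end Kiss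

theorem kissing_number_dim20_le_36764 (S : Finset (EuclideanSpace ℝ (Fin 20)))
    (hnorm : ∀ x ∈ S, ‖x‖ = 1)
    (hdist : ∀ x ∈ S, ∀ y ∈ S, x ≠ y → 1 ≤ dist x y) :
    S.card ≤ 36764 :=
  Kiss.hmain S hnorm hdist
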